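/- Let q ≥ 1 be fixed, let χ be a primitive Dirichlet character modulo q, and let ε > 0 be fixed. Then there exist constants C and T₀ (depending on q and ε) such that for all T ≥ T₀ and all real X with q² < X ≤ (log T)^{2−ε}: (1/T)·∫_T^{2T} |L(1/2+it, χ) · Q_X(1/2+it, χ)|² dt = (log(qT))/(e^γ log X) · (1 + E), where |E| ≤ C/log X and γ is the Euler–Mascheroni constant. -/

import Mathlib

open Complex Filter MeasureTheory Finset HurwitzZeta
open scoped ArithmeticFunction Real Classical

noncomputable section

/-- The finite set of primes `p ≤ X`. -/
def primesUpTo (X : ℝ) : Finset ℕ :=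
  (Finset.range (Nat.floor X + 1)).filter (fun p => p.Prime ∧ (p : ℝ) ≤ X)

/-- The finite set of naturals `n ≤ X`. -/
def natsUpTo (X : ℝ) : Finset ℕ :=
  (Finset.range (Nat.floor X + 1)).filter (fun n => (n : ℝ) ≤ X)

/-- Truncated Euler product `P_X(s,χ)`, defined via the primitive character `χ*` inducing `χ`:
`P_X(s,χ) = ∏_{p ∣ q} (1 - χ*(p) p^{-s}) · exp(∑_{n ≤ X} χ*(n) Λ(n) / (n^s log n))`. -/
def PX {q : ℕ} (X : ℝ) (χ : DirichletCharacter ℂ q) (s : ℂ) : ℂ :=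
  (∏ p ∈ q.primeFactors, (1 - χ.primitiveCharacter ((p : ℕ) : ZMod χ.conductor) * (p : ℂ) ^ (-s))) *
    Complex.exp (∑ n ∈ natsUpTo X,
      χ.primitiveCharacter ((n : ℕ) : ZMod χ.conductor) * (Λ n : ℂ) / ((n : ℂ) ^ s * (Real.log n : ℂ)))

/-- `𝓟_X^ℓ(s) = ∏_χ P_X(s,χ)^{ℓ_χ}`. -/
def PXl {q : ℕ} (X : ℝ) (ℓ : DirichletCharacter ℂ q → ℕ) (s : ℂ) : ℂ :=
  ∏ χ : DirichletCharacter ℂ q, (PX X χ s) ^ (ℓ χ)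

/-- A Dirichlet character as an arithmetic function. -/
def chiArith {q : ℕ} (χ : DirichletCharacter ℂ q) : ArithmeticFunction ℂ :=
  ⟨fun n => if n = 0 then 0 else χ ((n : ℕ) : ZMod q), by simp⟩

/-- `d_ℓ`, the coefficients of the Dirichlet series of `𝓛^ℓ(s) = ∏_χ L(s,χ)^{ℓ_χ}`,
i.e. the Dirichlet convolution product `∏_χ χ^{*ℓ_χ}`. -/
def dcoef {q : ℕ} (ℓ : DirichletCharacter ℂ q → ℕ) : ArithmeticFunction ℂ :=
  ∏ χ : DirichletCharacter ℂ q, (chiArith χ) ^ (ℓ χ)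

/-- `P*_X(s,χ) = ∏_{p ≤ X}(1 − χ(p)p^{−s})^{−1} · ∏_{√X < p ≤ X}(1 + χ(p)²/(2p^{2s}))^{−1}`. -/
def PstarX {q : ℕ} (X : ℝ) (χ : DirichletCharacter ℂ q) (s : ℂ) : ℂ :=
  ((primesUpTo X).prod (fun p : ℕ => (1 - χ ((p : ℕ) : ZMod q) * (p : ℂ) ^ (-s))⁻¹)) *
    ((primesUpTo X).filter (fun p : ℕ => Real.sqrt X < (p : ℝ))).prod
      (fun p : ℕ => (1 + χ ((p : ℕ) : ZMod q) ^ 2 / (2 * (p : ℂ) ^ (2 * s)))⁻¹)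

/-- `𝓟*_X^ℓ(s) = ∏_χ P*_X(s,χ)^{ℓ_χ}`. -/
def PstarXl {q : ℕ} (X : ℝ) (ℓ : DirichletCharacter ℂ q → ℕ) (s : ℂ) : ℂ :=
  ∏ χ : DirichletCharacter ℂ q, (PstarX X χ s) ^ (ℓ χ)

/-- `Q_X(s,χ) = ∏_{p ≤ √X}(1 − χ(p)p^{−s}) · ∏_{√X < p ≤ X}(1 − χ(p)p^{−s} + χ(p)²/(2p^{2s}))`. -/
def QX {q : ℕ} (X : ℝ) (χ : DirichletCharacter ℂ q) (s : ℂ) : ℂ :=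
  (((primesUpTo X).filter (fun p : ℕ => (p : ℝ) ≤ Real.sqrt X)).prod
      (fun p : ℕ => 1 - χ ((p : ℕ) : ZMod q) * (p : ℂ) ^ (-s))) *
    ((primesUpTo X).filter (fun p : ℕ => Real.sqrt X < (p : ℝ))).prod
      (fun p : ℕ => 1 - χ ((p : ℕ) : ZMod q) * (p : ℂ) ^ (-s)
        + χ ((p : ℕ) : ZMod q) ^ 2 / (2 * (p : ℂ) ^ (2 * s)))

/-- `𝓠_X^ℓ(s) = ∏_χ Q_X(s,χ)^{ℓ_χ}`. -/
def QXl {q : ℕ} (X : ℝ) (ℓ : DirichletCharacter ℂ q → ℕ) (s : ℂ) : ℂ :=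
  ∏ χ : DirichletCharacter ℂ q, (QX X χ s) ^ (ℓ χ)

/-- `𝓛^ℓ(s) = ∏_χ L(s,χ)^{ℓ_χ}`. -/
def Ll {q : ℕ} [NeZero q] (ℓ : DirichletCharacter ℂ q → ℕ) (s : ℂ) : ℂ :=
  ∏ χ : DirichletCharacter ℂ q, (DirichletCharacter.LFunction χ s) ^ (ℓ χ)

/-- GRH for the Dirichlet L-functions modulo `q`: every zero `ρ` of `L(s,χ)` with
`0 < Re ρ < 1` satisfies `Re ρ = 1/2`. -/
def GRHmod (q : ℕ) [NeZero q] : Prop :=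
  ∀ χ : DirichletCharacter ℂ q, ∀ ρ : ℂ,
    DirichletCharacter.LFunction χ ρ = 0 → 0 < ρ.re → ρ.re < 1 → ρ.re = 1 / 2

end

namespace LQ

lemma norm_integral_exp_I_le {θ : ℝ} (hθ : θ ≠ 0) (a b : ℝ) :
    ‖∫ t in a..b, Complex.exp (Complex.I * θ * t)‖ ≤ 2 / |θ| := by
  have hc : Complex.I * (θ : ℂ) ≠ 0 := mul_ne_zero Complex.I_ne_zero (by exact_mod_cast hθ)
  rw [integral_exp_mul_complex hc, norm_div]
  have h1 : ∀ x : ℝ, ‖Complex.exp (Complex.I * θ * x)‖ = 1 := by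
    intro x
    rw [show Complex.I * θ * x = ((θ * x : ℝ) : ℂ) * Complex.I by push_cast; ring]
    exact Complex.norm_exp_ofReal_mul_I _
  have h2 : ‖Complex.I * (θ : ℂ)‖ = |θ| := by simp
  rw [h2]
  gcongr
  refine (norm_sub_le _ _).trans ?_
  rw [h1, h1]; norm_num

lemma abs_integral_norm_sq_expSum_sub_le (s : Finset ℕ) (a : ℕ → ℂ) (lam : ℕ → ℝ)
    (hinj : ∀ m ∈ s, ∀ n ∈ s, m ≠ n → lam m ≠ lam n) (A B : ℝ) :
    |(∫ t in A..B, ‖∑ n ∈ s, a n * Complex.exp (Complex.I * lam n * t)‖ ^ 2)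
        - (B - A) * ∑ n ∈ s, ‖a n‖ ^ 2|
      ≤ ∑ m ∈ s, ∑ n ∈ s with n ≠ m, ‖a m‖ * ‖a n‖ * (2 / |lam m - lam n|) := by
  have key : ((∫ t in A..B, ‖∑ n ∈ s, a n * Complex.exp (Complex.I * lam n * t)‖ ^ 2 : ℝ) : ℂ)
      = ∑ m ∈ s, ∑ n ∈ s, a m * (starRingEnd ℂ) (a n) *
          ∫ t in A..B, Complex.exp (Complex.I * ((lam m - lam n : ℝ) : ℂ) * t) := by
    rw [← intervalIntegral.integral_ofReal]
    have : ∀ t : ℝ, ((‖∑ n ∈ s, a n * Complex.exp (Complex.I * lam n * t)‖ ^ 2 : ℝ) : ℂ)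
        = ∑ m ∈ s, ∑ n ∈ s, a m * (starRingEnd ℂ) (a n) *
          Complex.exp (Complex.I * ((lam m - lam n : ℝ) : ℂ) * t) := by
      intro t
      push_cast
      rw [← Complex.mul_conj', map_sum, Finset.sum_mul_sum]
      refine Finset.sum_congr rfl fun m _ => Finset.sum_congr rfl fun n _ => ?_
      rw [map_mul, ← Complex.exp_conj]
      simp only [map_mul, Complex.conj_I, Complex.conj_ofReal]
      rw [show Complex.I * ((lam m : ℂ) - lam n) * t
        = Complex.I * lam m * t + -Complex.I * lam n * t by ring, Complex.exp_add]
      ring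
    simp_rw [this]
    rw [intervalIntegral.integral_finsetSum]
    · refine Finset.sum_congr rfl fun m _ => ?_
      rw [intervalIntegral.integral_finsetSum]
      · refine Finset.sum_congr rfl fun n _ => ?_
        rw [intervalIntegral.integral_const_mul]
      · intro n _
        exact (by fun_prop : Continuous _).intervalIntegrable _ _
    · intro m _
      exact (by fun_prop : Continuous _).intervalIntegrable _ _
  have hsplit : ∀ m ∈ s, ∑ n ∈ s, a m * (starRingEnd ℂ) (a n) *
          ∫ t in A..B, Complex.exp (Complex.I * ((lam m - lam n : ℝ) : ℂ) * t)
      = (((B - A) * ‖a m‖ ^ 2 : ℝ) : ℂ) + ∑ n ∈ s with n ≠ m, a m * (starRingEnd ℂ) (a n) *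
          ∫ t in A..B, Complex.exp (Complex.I * ((lam m - lam n : ℝ) : ℂ) * t) := by
    intro m hm
    rw [← Finset.sum_filter_add_sum_filter_not s (fun n => n ≠ m), add_comm]
    congr 1
    have : s.filter (fun n => ¬ n ≠ m) = {m} := by
      ext n; simp only [not_not, Finset.mem_filter, Finset.mem_singleton]
      constructor
      · exact fun h => h.2
      · rintro rfl; exact ⟨hm, rfl⟩
    rw [this, Finset.sum_singleton, Complex.mul_conj']
    simp
    ring
  rw [Finset.sum_congr rfl hsplit, Finset.sum_add_distrib] at key
  have hdiff : (((∫ t in A..B, ‖∑ n ∈ s, a n * Complex.exp (Complex.I * lam n * t)‖ ^ 2)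
        - (B - A) * ∑ n ∈ s, ‖a n‖ ^ 2 : ℝ) : ℂ)
      = ∑ m ∈ s, ∑ n ∈ s with n ≠ m, a m * (starRingEnd ℂ) (a n) *
          ∫ t in A..B, Complex.exp (Complex.I * ((lam m - lam n : ℝ) : ℂ) * t) := by
    rw [Complex.ofReal_sub, key, Finset.mul_sum, Complex.ofReal_sum]
    ring
  rw [← Real.norm_eq_abs, ← Complex.norm_real, hdiff]
  refine (norm_sum_le _ _).trans (Finset.sum_le_sum fun m hm => (norm_sum_le _ _).trans
    (Finset.sum_le_sum fun n hn => ?_))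
  rw [Finset.mem_filter] at hn
  rw [norm_mul, norm_mul, RCLike.norm_conj]
  gcongr
  exact norm_integral_exp_I_le (sub_ne_zero.mpr (hinj m hm n hn.1 (Ne.symm hn.2))) _ _

lemma abs_sub_div_le_abs_log_sub_log {N m n : ℕ} (hm : m ∈ Icc 1 N) (hn : n ∈ Icc 1 N) :
    |(m : ℝ) - n| / N ≤ |Real.log m - Real.log n| := by
  have aux : ∀ m n : ℕ, m ∈ Icc 1 N → n ∈ Icc 1 N → n ≤ m →
      |(m : ℝ) - n| / N ≤ |Real.log m - Real.log n| := by
    intro m n hm hn h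
    rw [Finset.mem_Icc] at hm hn
    have hm0 : (0 : ℝ) < m := by exact_mod_cast hm.1
    have hn0 : (0 : ℝ) < n := by exact_mod_cast hn.1
    have hnm : (n : ℝ) ≤ m := by exact_mod_cast h
    have hmN : (m : ℝ) ≤ N := by exact_mod_cast hm.2
    rw [abs_of_nonneg (by linarith), abs_of_nonneg (sub_nonneg.mpr (Real.log_le_log hn0 hnm)),
      ← Real.log_div hm0.ne' hn0.ne']
    have h1 := Real.one_sub_inv_le_log_of_pos (div_pos hm0 hn0)
    refine le_trans ?_ h1
    rw [inv_div]
    have : 1 - (n : ℝ) / m = (m - n) / m := by field_simp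
    rw [this]
    gcongr
  rcases le_total n m with h | h
  · exact aux m n hm hn h
  · rw [abs_sub_comm, abs_sub_comm (Real.log m)]; exact aux n m hn hm h

lemma sum_inv_nat_le (N : ℕ) : ∑ n ∈ Icc 1 N, (1 : ℝ) / n ≤ 1 + Real.log N := by
  have h := harmonic_le_one_add_log N
  rw [harmonic_eq_sum_Icc] at h
  push_cast at h
  simpa using h

lemma sum_le_sum_of_injOn {s t : Finset ℕ} {f g : ℕ → ℝ} (e : ℕ → ℕ)
    (he : Set.MapsTo e s t) (hinj : Set.InjOn e s) (hg : ∀ n ∈ t, 0 ≤ g n)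
    (hfg : ∀ n ∈ s, f n ≤ g (e n)) : ∑ n ∈ s, f n ≤ ∑ n ∈ t, g n := by
  calc ∑ n ∈ s, f n ≤ ∑ n ∈ s, g (e n) := Finset.sum_le_sum hfg
    _ = ∑ n ∈ s.image e, g n := (Finset.sum_image hinj).symm
    _ ≤ _ := Finset.sum_le_sum_of_subset_of_nonneg
      (by intro n hn; rw [Finset.mem_image] at hn; obtain ⟨m, hm, rfl⟩ := hn; exact he hm)
      (fun n hn _ => hg n hn)

lemma sum_inv_abs_sub_le {N m : ℕ} (hm : m ∈ Icc 1 N) :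
    ∑ n ∈ Icc 1 N with n ≠ m, 1 / |(m : ℝ) - n| ≤ 2 * (1 + Real.log N) := by
  rw [Finset.mem_Icc] at hm
  have hsub : (Icc 1 N).filter (fun n => n ≠ m) ⊆
      ((Icc 1 N).filter (fun n => n < m)) ∪ ((Icc 1 N).filter (fun n => m < n)) := by
    intro n hn
    simp only [Finset.mem_filter, Finset.mem_union] at hn ⊢
    rcases lt_or_gt_of_ne hn.2 with h | h
    · exact Or.inl ⟨hn.1, h⟩
    · exact Or.inr ⟨hn.1, h⟩
  have h1 : ∑ n ∈ Icc 1 N with n < m, 1 / |(m : ℝ) - n| ≤ 1 + Real.log N := by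
    refine le_trans ?_ (sum_inv_nat_le N)
    refine sum_le_sum_of_injOn (fun n => m - n) ?_ ?_ ?_ ?_
    · intro n hn
      simp only [Finset.coe_filter, Finset.mem_Icc, Set.mem_ofPred_eq, Finset.coe_Icc, Set.mem_Icc] at hn ⊢
      omega
    · intro x hx y hy h
      simp only [Finset.coe_filter, Finset.mem_Icc, Set.mem_ofPred_eq] at hx hy h
      omega
    · intro n _; positivity
    · intro n hn
      simp only [Finset.mem_filter, Finset.mem_Icc] at hn
      rw [Nat.cast_sub hn.2.le, abs_of_nonneg]
      have : (n : ℝ) < m := by exact_mod_cast hn.2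
      linarith
  have h2 : ∑ n ∈ Icc 1 N with m < n, 1 / |(m : ℝ) - n| ≤ 1 + Real.log N := by
    refine le_trans ?_ (sum_inv_nat_le N)
    refine sum_le_sum_of_injOn (fun n => n - m) ?_ ?_ ?_ ?_
    · intro n hn
      simp only [Finset.coe_filter, Finset.mem_Icc, Set.mem_ofPred_eq, Finset.coe_Icc, Set.mem_Icc] at hn ⊢
      omega
    · intro x hx y hy h
      simp only [Finset.coe_filter, Finset.mem_Icc, Set.mem_ofPred_eq] at hx hy h
      omega
    · intro n _; positivity
    · intro n hn
      simp only [Finset.mem_filter, Finset.mem_Icc] at hn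
      rw [Nat.cast_sub hn.2.le, abs_sub_comm, abs_of_nonneg]
      have : (m : ℝ) < n := by exact_mod_cast hn.2
      linarith
  calc _ ≤ ∑ n ∈ ((Icc 1 N).filter (fun n => n < m)) ∪ ((Icc 1 N).filter (fun n => m < n)),
        1 / |(m : ℝ) - n| := Finset.sum_le_sum_of_subset_of_nonneg hsub (fun _ _ _ => by positivity)
    _ ≤ _ := (Finset.sum_union_inter (s₁ := (Icc 1 N).filter (fun n => n < m))
        (s₂ := (Icc 1 N).filter (fun n => m < n)) (f := fun n : ℕ => 1 / |(m : ℝ) - n|)).le.trans' (by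
          have : 0 ≤ ∑ n ∈ ((Icc 1 N).filter (fun n => n < m)) ∩ ((Icc 1 N).filter (fun n => m < n)),
            1 / |(m : ℝ) - n| := Finset.sum_nonneg (fun _ _ => by positivity)
          linarith)
    _ ≤ _ := by linarith

/-- The Dirichlet polynomial with coefficients `c`, of length `N`. -/
noncomputable def dirPoly (c : ℕ → ℂ) (N : ℕ) (s : ℂ) : ℂ :=
  ∑ n ∈ Icc 1 N, c n * (n : ℂ) ^ (-s)

lemma natCast_cpow_half_line {n : ℕ} (hn : n ≠ 0) (t : ℝ) :
    (n : ℂ) ^ (-(1 / 2 + t * Complex.I) : ℂ) =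
      ((1 / Real.sqrt n : ℝ) : ℂ) * Complex.exp (Complex.I * ((-Real.log n : ℝ) : ℂ) * t) := by
  have hn' : (n : ℂ) ≠ 0 := by exact_mod_cast hn
  have hn0 : (0 : ℝ) < n := by exact_mod_cast Nat.pos_of_ne_zero hn
  rw [show (-(1 / 2 + t * Complex.I) : ℂ) = (-(1/2) : ℂ) + -(t * Complex.I) by ring,
    Complex.cpow_add _ _ hn']
  congr 1
  · rw [Real.sqrt_eq_rpow, one_div ((n : ℝ) ^ (1 / 2 : ℝ)), ← Real.rpow_neg hn0.le,
      Complex.ofReal_cpow hn0.le]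
    push_cast; rfl
  · rw [Complex.cpow_def_of_ne_zero hn', ← Complex.ofReal_natCast, ← Complex.ofReal_log hn0.le]
    congr 1; push_cast; ring

theorem abs_integral_norm_sq_dirPoly_sub_le (c : ℕ → ℂ) (N : ℕ) (T : ℝ) :
    |(∫ t in T..(2 * T), ‖dirPoly c N (1 / 2 + t * Complex.I)‖ ^ 2)
        - T * ∑ n ∈ Icc 1 N, ‖c n‖ ^ 2 / n|
      ≤ 4 * N * (1 + Real.log N) * ∑ n ∈ Icc 1 N, ‖c n‖ ^ 2 / n := by
  set a : ℕ → ℂ := fun n => c n * ((1 / Real.sqrt n : ℝ) : ℂ) with ha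
  have hnorm : ∀ n, ‖a n‖ ^ 2 = ‖c n‖ ^ 2 / n := by
    intro n
    rw [ha]
    simp only [norm_mul, Complex.norm_real, Real.norm_eq_abs, mul_pow, sq_abs, div_pow, one_pow,
      Real.sq_sqrt (Nat.cast_nonneg n)]
    ring
  have hpoly : ∀ t : ℝ, dirPoly c N (1 / 2 + t * Complex.I)
      = ∑ n ∈ Icc 1 N, a n * Complex.exp (Complex.I * ((-Real.log n : ℝ) : ℂ) * t) := by
    intro t
    refine Finset.sum_congr rfl fun n hn => ?_
    rw [natCast_cpow_half_line (by rw [Finset.mem_Icc] at hn; omega), ha]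
    ring
  simp_rw [hpoly, ← hnorm]
  have hmain := abs_integral_norm_sq_expSum_sub_le (Icc 1 N) a (fun n => -Real.log n) (by
    intro m hm n hn hmn h
    rw [Finset.mem_Icc] at hm hn
    have := Real.log_injOn_pos (Set.mem_Ioi.mpr (by exact_mod_cast hm.1 : (0 : ℝ) < m))
      (Set.mem_Ioi.mpr (by exact_mod_cast hn.1 : (0 : ℝ) < n)) (neg_inj.mp h)
    exact hmn (by exact_mod_cast this)) T (2 * T)
  rw [show 2 * T - T = T by ring] at hmain
  refine hmain.trans ?_
  have hstep : ∀ m ∈ Icc 1 N, ∀ n ∈ (Icc 1 N).filter (fun n => n ≠ m),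
      ‖a m‖ * ‖a n‖ * (2 / |-Real.log m - -Real.log n|)
        ≤ (‖a m‖ ^ 2 + ‖a n‖ ^ 2) * (N * (1 / |(m : ℝ) - n|)) := by
    intro m hm n hn
    rw [Finset.mem_filter] at hn
    have h1 := abs_sub_div_le_abs_log_sub_log hm hn.1
    have hmn : 0 < |(m : ℝ) - n| := abs_pos.mpr (sub_ne_zero.mpr (by exact_mod_cast Ne.symm hn.2))
    have hN : (0 : ℝ) < N := by
      rw [Finset.mem_Icc] at hm; exact_mod_cast (by omega : 0 < N)
    have h2 : |-Real.log m - -Real.log n| = |Real.log m - Real.log n| := by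
      rw [← abs_neg]; ring_nf
    rw [h2]
    have h3 : 2 / |Real.log m - Real.log n| ≤ 2 * (N * (1 / |(m : ℝ) - n|)) := by
      calc 2 / |Real.log m - Real.log n| ≤ 2 / (|(m : ℝ) - n| / N) := by gcongr
        _ = _ := by field_simp
    calc ‖a m‖ * ‖a n‖ * (2 / |Real.log m - Real.log n|)
        ≤ ‖a m‖ * ‖a n‖ * (2 * (N * (1 / |(m : ℝ) - n|))) := by gcongr
      _ = (2 * ‖a m‖ * ‖a n‖) * (N * (1 / |(m : ℝ) - n|)) := by ring
      _ ≤ _ := by gcongr; exact two_mul_le_add_sq _ _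
  calc _ ≤ ∑ m ∈ Icc 1 N, ∑ n ∈ Icc 1 N with n ≠ m,
        (‖a m‖ ^ 2 + ‖a n‖ ^ 2) * (N * (1 / |(m : ℝ) - n|)) :=
        Finset.sum_le_sum fun m hm => Finset.sum_le_sum fun n hn => hstep m hm n hn
    _ = 2 * ∑ m ∈ Icc 1 N, ∑ n ∈ Icc 1 N with n ≠ m, ‖a m‖ ^ 2 * (N * (1 / |(m : ℝ) - n|)) := by
        have hsym : ∑ m ∈ Icc 1 N, ∑ n ∈ Icc 1 N with n ≠ m, ‖a n‖ ^ 2 * (N * (1 / |(m : ℝ) - n|))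
            = ∑ m ∈ Icc 1 N, ∑ n ∈ Icc 1 N with n ≠ m, ‖a m‖ ^ 2 * (N * (1 / |(m : ℝ) - n|)) := by
          simp_rw [Finset.sum_filter]
          rw [Finset.sum_comm]
          refine Finset.sum_congr rfl fun m _ => Finset.sum_congr rfl fun n _ => ?_
          rw [abs_sub_comm]
          simp only [ne_comm]
        simp_rw [add_mul, Finset.sum_add_distrib]
        rw [hsym]; ring
    _ ≤ 2 * ∑ m ∈ Icc 1 N, ‖a m‖ ^ 2 * (N * (2 * (1 + Real.log N))) := by
        gcongr with m hm
        rw [← Finset.mul_sum, ← Finset.mul_sum]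
        gcongr
        exact sum_inv_abs_sub_le hm
    _ = _ := by rw [← Finset.sum_mul]; ring

theorem integral_norm_sq_dirPoly_le (c : ℕ → ℂ) (N : ℕ) {T : ℝ}
    (hT : 4 * N * (1 + Real.log N) ≤ T) :
    (∫ t in T..(2 * T), ‖dirPoly c N (1 / 2 + t * Complex.I)‖ ^ 2)
      ≤ 2 * T * ∑ n ∈ Icc 1 N, ‖c n‖ ^ 2 / n := by
  have h := (abs_le.mp (abs_integral_norm_sq_dirPoly_sub_le c N T)).2
  have h0 : 0 ≤ ∑ n ∈ Icc 1 N, ‖c n‖ ^ 2 / (n : ℝ) := Finset.sum_nonneg fun _ _ => by positivity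
  nlinarith [mul_le_mul_of_nonneg_right hT h0]

/-- The coefficients of the product of two Dirichlet polynomials, the second of length `Y`. -/
noncomputable def dconv (β r : ℕ → ℂ) (Y N : ℕ) : ℂ :=
  ∑ k ∈ Icc 1 Y with k ∣ N, β (N / k) * r k

/-- The quadratic form `∑ |r k| |r h| / lcm (k, h)`. -/
noncomputable def lcmSum (r : ℕ → ℂ) (Y : ℕ) : ℝ :=
  ∑ k ∈ Icc 1 Y, ∑ h ∈ Icc 1 Y, ‖r k‖ * ‖r h‖ * (1 / (Nat.lcm k h : ℝ))

lemma lcmSum_nonneg (r : ℕ → ℂ) (Y : ℕ) : 0 ≤ lcmSum r Y :=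
  Finset.sum_nonneg fun _ _ => Finset.sum_nonneg fun _ _ => by positivity

lemma dirPoly_mul {β : ℕ → ℂ} {B : ℕ} (hβ : ∀ n, B < n → β n = 0) (r : ℕ → ℂ) (Y : ℕ) (s : ℂ) :
    dirPoly β B s * dirPoly r Y s = dirPoly (dconv β r Y) (B * Y) s := by
  unfold dirPoly dconv
  have h1 : ∀ N ∈ Icc 1 (B * Y), (∑ k ∈ Icc 1 Y with k ∣ N, β (N / k) * r k) * (N : ℂ) ^ (-s)
      = ∑ k ∈ Icc 1 Y, if k ∣ N then β (N / k) * r k * (N : ℂ) ^ (-s) else 0 := by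
    intro N _
    rw [Finset.sum_filter, Finset.sum_mul]
    exact Finset.sum_congr rfl fun k _ => by split_ifs <;> simp
  rw [Finset.sum_congr rfl h1, Finset.sum_comm, Finset.mul_sum]
  refine Finset.sum_congr rfl fun k hk => ?_
  rw [Finset.mem_Icc] at hk
  rw [← Finset.sum_filter, Finset.sum_mul]
  have hinj : Set.InjOn (fun n => k * n) (Icc 1 B : Finset ℕ) := fun a _ b _ h =>
    Nat.eq_of_mul_eq_mul_left hk.1 h
  have hsub : (Icc 1 B).image (fun n => k * n) ⊆ (Icc 1 (B * Y)).filter (fun N => k ∣ N) := by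
    intro N hN
    simp only [Finset.mem_image, Finset.mem_Icc, Finset.mem_filter] at hN ⊢
    obtain ⟨n, hn, rfl⟩ := hN
    refine ⟨⟨Nat.mul_pos hk.1 hn.1, ?_⟩, dvd_mul_right _ _⟩
    rw [mul_comm B]; exact Nat.mul_le_mul hk.2 hn.2
  rw [← Finset.sum_subset hsub, Finset.sum_image hinj]
  · refine Finset.sum_congr rfl fun n hn => ?_
    rw [Nat.mul_div_cancel_left _ hk.1, Nat.cast_mul, Complex.natCast_mul_natCast_cpow]
    ring
  · intro N hN hN'
    simp only [Finset.mem_image, Finset.mem_Icc, Finset.mem_filter, not_exists, not_and] at hN hN'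
    obtain ⟨⟨hN1, _⟩, n, rfl⟩ := hN
    have hn : 1 ≤ n := Nat.pos_of_ne_zero (by rintro rfl; simp at hN1)
    rw [Nat.mul_div_cancel_left _ hk.1, hβ n, zero_mul, zero_mul]
    by_contra hle
    exact hN' n ⟨hn, by omega⟩ rfl

lemma sum_inv_Ioc_le_log {a b : ℕ} (ha : 1 ≤ a) (hab : a ≤ b) :
    ∑ j ∈ Ioc a b, (1 : ℝ) / j ≤ Real.log (b / a) := by
  induction b, hab using Nat.le_induction with
  | base => simp
  | succ b hb ih =>
    rw [← Finset.insert_Ioc_right_eq_Ioc_add_one hb, Finset.sum_insert (by simp)]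
    have ha0 : (0 : ℝ) < a := by exact_mod_cast ha
    have hb0 : (0 : ℝ) < b := by exact_mod_cast (by omega : 0 < b)
    have h := Real.one_sub_inv_le_log_of_pos (x := ((b : ℝ) + 1) / b) (by positivity)
    have e1 : 1 - (((b : ℝ) + 1) / b)⁻¹ = 1 / (b + 1) := by field_simp; ring
    rw [e1] at h
    push_cast
    have e2 : Real.log (((b : ℝ) + 1) / a) = Real.log (((b : ℝ) + 1) / b) + Real.log (b / a) := by
      rw [← Real.log_mul (by positivity) (by positivity)]; congr 1; field_simp
    linarith

lemma sum_inv_le_one_add_log {x z : ℝ} (hx : 0 < x) (hxz : x ≤ z) {s : Finset ℕ}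
    (hs : ∀ j ∈ s, x < j ∧ (j : ℝ) ≤ z) : ∑ j ∈ s, (1 : ℝ) / j ≤ 1 + Real.log (z / x) := by
  have hlog : 0 ≤ Real.log (z / x) := Real.log_nonneg ((one_le_div hx).mpr hxz)
  set a := ⌊x⌋₊
  set b := ⌊z⌋₊
  have hz : 0 ≤ z := by linarith
  have hsub : s ⊆ Ioc a b := by
    intro j hj
    obtain ⟨h1, h2⟩ := hs j hj
    rw [Finset.mem_Ioc]
    exact ⟨(Nat.floor_lt hx.le).mpr h1, Nat.le_floor h2⟩
  refine (Finset.sum_le_sum_of_subset_of_nonneg hsub fun _ _ _ => by positivity).trans ?_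
  rcases le_or_gt b a with h | h
  · rw [Finset.Ioc_eq_empty (by omega)]; simp; linarith
  · have hsplit : Ioc a b = insert (a + 1) (Ioc (a + 1) b) := by
      ext j; simp only [Finset.mem_Ioc, Finset.mem_insert]; omega
    rw [hsplit, Finset.sum_insert (by simp)]
    have h1 := sum_inv_Ioc_le_log (a := a + 1) (b := b) (by omega) h
    have h2 : (1 : ℝ) / ((a + 1 : ℕ) : ℝ) ≤ 1 := by
      rw [div_le_one (by positivity)]; push_cast; linarith [(Nat.cast_nonneg a : (0 : ℝ) ≤ a)]
    have h3 : Real.log ((b : ℝ) / ((a + 1 : ℕ) : ℝ)) ≤ Real.log (z / x) := by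
      have hb0 : (0 : ℝ) < b := by exact_mod_cast (by omega : 0 < b)
      apply Real.log_le_log (by positivity)
      have := Nat.floor_le hz
      have h4 := (Nat.lt_floor_add_one x).le
      push_cast
      gcongr
    linarith

lemma sum_inv_dvd_le {A B : ℝ} (hA : 0 < A) (hAB : A ≤ B) {L : ℕ} (hL : 0 < L) {s : Finset ℕ}
    (hs : ∀ j ∈ s, A < j ∧ (j : ℝ) ≤ B ∧ L ∣ j) :
    ∑ j ∈ s, (1 : ℝ) / j ≤ (1 / L) * (1 + Real.log (B / A)) := by
  have hL0 : (0 : ℝ) < L := by exact_mod_cast hL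
  have hinj : Set.InjOn (fun j => j / L) (s : Set ℕ) := by
    intro i hi j hj h
    have h' : i / L = j / L := h
    rw [← Nat.div_mul_cancel (hs i hi).2.2, h', Nat.div_mul_cancel (hs j hj).2.2]
  have h := sum_inv_le_one_add_log (x := A / L) (z := B / L) (by positivity) (by gcongr)
    (s := s.image fun j => j / L) (by
      intro j hj
      rw [Finset.mem_image] at hj
      obtain ⟨i, hi, rfl⟩ := hj
      obtain ⟨h1, h2, h3⟩ := hs i hi
      rw [Nat.cast_div h3 hL0.ne']
      exact ⟨by gcongr, by gcongr⟩)
  rw [Finset.sum_image hinj] at h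
  rw [show B / L / (A / L) = B / A by field_simp] at h
  calc ∑ j ∈ s, (1 : ℝ) / j = ∑ j ∈ s, (1 / L) * ((1 : ℝ) / ((j / L : ℕ) : ℝ)) := by
        refine Finset.sum_congr rfl fun j hj => ?_
        rw [Nat.cast_div (hs j hj).2.2 hL0.ne']
        by_cases hj0 : (j : ℝ) = 0
        · simp [hj0]
        · field_simp
    _ = (1 / L) * ∑ j ∈ s, ((1 : ℝ) / ((j / L : ℕ) : ℝ)) := by rw [Finset.mul_sum]
    _ ≤ _ := by gcongr

theorem sum_norm_sq_dconv_le {β : ℕ → ℂ} {A B M : ℝ} (hA : 0 < A) (hAB : A ≤ B)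
    (hM : ∀ n, ‖β n‖ ≤ M) (hβ : ∀ n, β n ≠ 0 → A < n ∧ (n : ℝ) ≤ B) (r : ℕ → ℂ) (Y : ℕ)
    (s : Finset ℕ) :
    ∑ N ∈ s, ‖dconv β r Y N‖ ^ 2 / N ≤ M ^ 2 * (1 + Real.log (B / A)) * lcmSum r Y := by
  have hM0 : 0 ≤ M := (norm_nonneg _).trans (hM 0)
  have h1 : ∀ N ∈ s, ‖dconv β r Y N‖ ^ 2 / N ≤ ∑ k ∈ Icc 1 Y, ∑ h ∈ Icc 1 Y,
      M ^ 2 * (‖r k‖ * ‖r h‖) * (if A * k < N ∧ (N : ℝ) ≤ B * k ∧ Nat.lcm k h ∣ N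
        then (1 : ℝ) / N else 0) := by
    intro N _
    have h2 : ‖dconv β r Y N‖ ≤ ∑ k ∈ Icc 1 Y,
        M * ‖r k‖ * (if A * k < N ∧ (N : ℝ) ≤ B * k ∧ k ∣ N then 1 else 0) := by
      unfold dconv
      rw [Finset.sum_filter]
      refine (norm_sum_le _ _).trans (Finset.sum_le_sum fun k hk => ?_)
      rw [Finset.mem_Icc] at hk
      have hk0 : (0 : ℝ) < k := by exact_mod_cast hk.1
      by_cases hkN : k ∣ N
      · rw [if_pos hkN, norm_mul]
        by_cases hb : β (N / k) = 0
        · rw [hb]; simp only [norm_zero, zero_mul]; positivity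
        · have := hβ _ hb
          rw [Nat.cast_div hkN hk0.ne', lt_div_iff₀ hk0, div_le_iff₀ hk0] at this
          rw [if_pos ⟨this.1, this.2, hkN⟩, mul_one]
          gcongr; exact hM _
      · rw [if_neg hkN, norm_zero]; positivity
    calc ‖dconv β r Y N‖ ^ 2 / N ≤ (∑ k ∈ Icc 1 Y,
        M * ‖r k‖ * (if A * k < N ∧ (N : ℝ) ≤ B * k ∧ k ∣ N then 1 else 0)) ^ 2 / N := by gcongr
      _ ≤ _ := by
        rw [sq, Finset.sum_mul_sum, Finset.sum_div]
        refine Finset.sum_le_sum fun k hk => ?_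
        rw [Finset.sum_div]
        refine Finset.sum_le_sum fun h hh => ?_
        by_cases c1 : A * k < N ∧ (N : ℝ) ≤ B * k ∧ k ∣ N
        · by_cases c2 : A * h < N ∧ (N : ℝ) ≤ B * h ∧ h ∣ N
          · rw [if_pos c1, if_pos c2, if_pos ⟨c1.1, c1.2.1, Nat.lcm_dvd c1.2.2 c2.2.2⟩]
            apply le_of_eq; ring
          · rw [if_neg c2]; simp only [mul_zero, zero_div]; positivity
        · rw [if_neg c1]; simp only [mul_zero, zero_mul, zero_div]; positivity
  refine (Finset.sum_le_sum h1).trans ?_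
  rw [Finset.sum_comm]
  unfold lcmSum
  rw [Finset.mul_sum]
  refine Finset.sum_le_sum fun k hk => ?_
  rw [Finset.sum_comm, Finset.mul_sum]
  refine Finset.sum_le_sum fun h hh => ?_
  rw [Finset.mem_Icc] at hk hh
  have hk0 : (0 : ℝ) < k := by exact_mod_cast hk.1
  rw [← Finset.mul_sum, ← Finset.sum_filter]
  have h3 := sum_inv_dvd_le (A := A * k) (B := B * k) (by positivity) (by gcongr)
    (L := Nat.lcm k h) (Nat.lcm_pos hk.1 hh.1)
    (s := s.filter fun N : ℕ => A * k < N ∧ (N : ℝ) ≤ B * k ∧ Nat.lcm k h ∣ N)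
    (fun j hj => (Finset.mem_filter.mp hj).2)
  rw [mul_div_mul_right _ _ hk0.ne'] at h3
  calc _ ≤ M ^ 2 * (‖r k‖ * ‖r h‖) * (1 / (Nat.lcm k h : ℝ) * (1 + Real.log (B / A))) := by gcongr
    _ = _ := by ring

/-- Mean square of a product of Dirichlet polynomials. -/
theorem integral_norm_sq_dirPoly_mul_le {β : ℕ → ℂ} {A M : ℝ} {B : ℕ} (hA : 0 < A) (hAB : A ≤ B)
    (hM : ∀ n, ‖β n‖ ≤ M) (hβ : ∀ n, β n ≠ 0 → A < n ∧ n ≤ B) (r : ℕ → ℂ) (Y : ℕ) {T : ℝ}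
    (hT0 : 0 ≤ T) (hT : 4 * (B * Y : ℕ) * (1 + Real.log (B * Y : ℕ)) ≤ T) :
    (∫ t in T..(2 * T), ‖dirPoly β B (1 / 2 + t * Complex.I) *
        dirPoly r Y (1 / 2 + t * Complex.I)‖ ^ 2)
      ≤ 2 * T * (M ^ 2 * (1 + Real.log (B / A)) * lcmSum r Y) := by
  have h0 : ∀ n, B < n → β n = 0 := fun n hn => by
    by_contra h; exact absurd (hβ n h).2 (by omega)
  simp_rw [dirPoly_mul h0]
  refine (integral_norm_sq_dirPoly_le _ _ hT).trans ?_
  gcongr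
  exact sum_norm_sq_dconv_le hA hAB hM (fun n hn => ⟨(hβ n hn).1, by exact_mod_cast (hβ n hn).2⟩) r Y _

lemma sum_factoredNumbers_rpow_le {P F : Finset ℕ} (hP : ∀ p ∈ P, p.Prime) {σ : ℝ} (hσ : 0 < σ)
    (hF : ∀ n ∈ F, n ∈ Nat.factoredNumbers P) :
    ∑ n ∈ F, (n : ℝ) ^ (-σ) ≤ ∏ p ∈ P, (1 - (p : ℝ) ^ (-σ))⁻¹ := by
  let f : ℕ →* ℝ :=
    { toFun := fun n => (n : ℝ) ^ (-σ)
      map_one' := by simp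
      map_mul' := by intro a b; push_cast; exact Real.mul_rpow (by positivity) (by positivity) }
  have hf : ∀ {p : ℕ}, p.Prime → ‖f p‖ < 1 := by
    intro p hp
    have : (1 : ℝ) < p := by exact_mod_cast hp.one_lt
    change ‖(p : ℝ) ^ (-σ)‖ < 1
    rw [Real.norm_of_nonneg (by positivity)]
    exact Real.rpow_lt_one_of_one_lt_of_neg this (by linarith)
  have h := (EulerProduct.summable_and_hasSum_factoredNumbers_prod_filter_prime_geometric
    (f := f) hf P).2
  rw [Finset.filter_true_of_mem hP] at h
  have h2 : ∑ m ∈ F.subtype (fun k => k ∈ Nat.factoredNumbers P), f (m : ℕ) ≤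
      ∏ p ∈ P, (1 - f p)⁻¹ :=
    sum_le_hasSum _ (fun m _ => by change 0 ≤ ((m : ℕ) : ℝ) ^ (-σ); positivity) h
  rw [Finset.sum_subtype_of_mem (f := fun n : ℕ => f n) hF] at h2
  exact h2

lemma lcmSum_le_pow_three {r : ℕ → ℂ} {P : Finset ℕ} (hP : ∀ p ∈ P, p.Prime) (hr : ∀ k, ‖r k‖ ≤ 1)
    (hsupp : ∀ k, r k ≠ 0 → k ∈ Nat.factoredNumbers P) (Y : ℕ) :
    lcmSum r Y ≤ (∏ p ∈ P, (1 - (1 : ℝ) / p)⁻¹) ^ 3 := by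
  set F := (Icc 1 Y).filter (fun k => k ∈ Nat.factoredNumbers P) with hF
  have hsumF : ∑ n ∈ F, (1 : ℝ) / n ≤ ∏ p ∈ P, (1 - (1 : ℝ) / p)⁻¹ := by
    have := sum_factoredNumbers_rpow_le hP one_pos (F := F) fun n hn => (Finset.mem_filter.mp hn).2
    simpa only [Real.rpow_neg_one, one_div] using this
  have h1 : lcmSum r Y ≤ ∑ x ∈ F ×ˢ F, 1 / (Nat.lcm x.1 x.2 : ℝ) := by
    unfold lcmSum
    rw [Finset.sum_product, hF, Finset.sum_filter]
    refine Finset.sum_le_sum fun k _ => ?_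
    by_cases hk : k ∈ Nat.factoredNumbers P
    · rw [if_pos hk, Finset.sum_filter]
      refine Finset.sum_le_sum fun h _ => ?_
      by_cases hh : h ∈ Nat.factoredNumbers P
      · rw [if_pos hh]
        have : ‖r k‖ * ‖r h‖ ≤ 1 := mul_le_one₀ (hr k) (norm_nonneg _) (hr h)
        calc _ ≤ 1 * (1 / (Nat.lcm k h : ℝ)) := by gcongr
          _ = _ := one_mul _
      · rw [if_neg hh]
        have : r h = 0 := by by_contra h'; exact hh (hsupp h h')
        simp [this]
    · rw [if_neg hk]
      have : r k = 0 := by by_contra h'; exact hk (hsupp k h')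
      simp [this]
  have hdiv : ∀ {a b : ℕ}, b ∈ Nat.factoredNumbers P → a ∣ b → a ∈ Nat.factoredNumbers P := by
    intro a b hb hab
    rw [Nat.mem_factoredNumbers_iff_forall_le] at hb ⊢
    have ha0 : a ≠ 0 := by rintro rfl; exact hb.1 (zero_dvd_iff.mp hab)
    exact ⟨ha0, fun p hp hpp hpa => hb.2 p (hp.trans (Nat.le_of_dvd (Nat.pos_of_ne_zero hb.1) hab))
      hpp (hpa.trans hab)⟩
  have hmemF : ∀ {a b : ℕ}, b ∈ F → a ∣ b → a ∈ F := by
    intro a b hb hab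
    rw [hF, Finset.mem_filter, Finset.mem_Icc] at hb ⊢
    have := Nat.le_of_dvd hb.1.1 hab
    exact ⟨⟨Nat.pos_of_dvd_of_pos hab hb.1.1, by omega⟩, hdiv hb.2 hab⟩
  have h2 : ∑ x ∈ F ×ˢ F, 1 / (Nat.lcm x.1 x.2 : ℝ)
      ≤ ∑ y ∈ F ×ˢ F ×ˢ F, (1 / (y.1 : ℝ)) * ((1 / (y.2.1 : ℝ)) * (1 / (y.2.2 : ℝ))) := by
    have hpos : ∀ {b : ℕ}, b ∈ F → 0 < b := fun {b} hb => by
      rw [hF, Finset.mem_filter, Finset.mem_Icc] at hb; exact hb.1.1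
    let e : ℕ × ℕ → ℕ × ℕ × ℕ := fun x => (Nat.gcd x.1 x.2, x.1 / Nat.gcd x.1 x.2, x.2 / Nat.gcd x.1 x.2)
    have hinj : Set.InjOn e (F ×ˢ F : Finset (ℕ × ℕ)) := by
      rintro ⟨a, b⟩ _ ⟨c, d⟩ _ h
      simp only [e, Prod.mk.injEq] at h
      obtain ⟨h1, h2, h3⟩ := h
      have e1 := Nat.div_mul_cancel (Nat.gcd_dvd_left a b)
      have e2 := Nat.div_mul_cancel (Nat.gcd_dvd_right a b)
      have e3 := Nat.div_mul_cancel (Nat.gcd_dvd_left c d)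
      have e4 := Nat.div_mul_cancel (Nat.gcd_dvd_right c d)
      rw [h2, h1] at e1
      rw [h3, h1] at e2
      ext <;> simp <;> omega
    calc _ = ∑ x ∈ F ×ˢ F, (1 / ((e x).1 : ℝ)) * ((1 / ((e x).2.1 : ℝ)) * (1 / ((e x).2.2 : ℝ))) := by
          refine Finset.sum_congr rfl fun x hx => ?_
          rw [Finset.mem_product] at hx
          have hg := Nat.gcd_pos_of_pos_left x.2 (hpos hx.1)
          have : Nat.lcm x.1 x.2 = Nat.gcd x.1 x.2 * ((x.1 / Nat.gcd x.1 x.2) * (x.2 / Nat.gcd x.1 x.2)) := by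
            apply Nat.eq_of_mul_eq_mul_left hg
            rw [Nat.gcd_mul_lcm]
            obtain ⟨a, ha⟩ := Nat.gcd_dvd_left x.1 x.2
            obtain ⟨b, hb⟩ := Nat.gcd_dvd_right x.1 x.2
            set g := Nat.gcd x.1 x.2
            rw [ha, hb, Nat.mul_div_cancel_left _ hg, Nat.mul_div_cancel_left _ hg]
            ring
          rw [this]
          push_cast
          simp only [e, one_div, mul_inv]
      _ = ∑ y ∈ (F ×ˢ F).image e, (1 / (y.1 : ℝ)) * ((1 / (y.2.1 : ℝ)) * (1 / (y.2.2 : ℝ))) :=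
          (Finset.sum_image (f := fun y : ℕ × ℕ × ℕ => (1 / (y.1 : ℝ)) * ((1 / (y.2.1 : ℝ)) * (1 / (y.2.2 : ℝ)))) hinj).symm
      _ ≤ _ := by
          refine Finset.sum_le_sum_of_subset_of_nonneg ?_ fun _ _ _ => by positivity
          intro y hy
          rw [Finset.mem_image] at hy
          obtain ⟨x, hx, rfl⟩ := hy
          rw [Finset.mem_product] at hx
          simp only [e, Finset.mem_product]
          exact ⟨hmemF hx.1 (Nat.gcd_dvd_left _ _), hmemF hx.1 (Nat.div_dvd_of_dvd (Nat.gcd_dvd_left _ _)),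
            hmemF hx.2 (Nat.div_dvd_of_dvd (Nat.gcd_dvd_right _ _))⟩
  refine h1.trans (h2.trans ?_)
  rw [Finset.sum_product]
  simp_rw [← Finset.mul_sum]
  rw [← Finset.sum_mul, Finset.sum_product]
  simp_rw [← Finset.mul_sum]
  rw [← Finset.sum_mul]
  calc _ = (∑ n ∈ F, (1 : ℝ) / n) ^ 3 := by ring
    _ ≤ _ := by gcongr

lemma sum_divisors_dvd {d n : ℕ} (hd : 0 < d) (hn : n ≠ 0) (f : ℕ → ℂ) :
    ∑ k ∈ n.divisors, (if d ∣ k then f k else 0) =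
      if d ∣ n then ∑ j ∈ (n / d).divisors, f (d * j) else 0 := by
  split_ifs with h
  · rw [← Finset.sum_filter]
    obtain ⟨m, rfl⟩ := h
    have hm : m ≠ 0 := by rintro rfl; simp at hn
    rw [Nat.mul_div_cancel_left _ hd]
    symm
    refine Finset.sum_bij (fun j _ => d * j) ?_ ?_ ?_ ?_
    · intro j hj
      rw [Nat.mem_divisors] at hj
      rw [Finset.mem_filter, Nat.mem_divisors]
      exact ⟨⟨Nat.mul_dvd_mul_left d hj.1, hn⟩, dvd_mul_right _ _⟩
    · intro a _ b _ h; exact Nat.eq_of_mul_eq_mul_left hd h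
    · intro k hk
      rw [Finset.mem_filter, Nat.mem_divisors] at hk
      obtain ⟨j, rfl⟩ := hk.2
      exact ⟨j, Nat.mem_divisors.mpr ⟨Nat.dvd_of_mul_dvd_mul_left hd hk.1.1, hm⟩, rfl⟩
    · intro _ _; rfl
  · refine Finset.sum_eq_zero fun k hk => ?_
    rw [if_neg]
    exact fun h' => h (h'.trans (Nat.dvd_of_mem_divisors hk))

/-- Local density of the mollified coefficients: `∏ (1 - 1_{p ∣ n} + c p 1_{p² ∣ n})`. -/
noncomputable def locFactor (c : ℕ → ℝ) (P : Finset ℕ) (n : ℕ) : ℝ :=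
  ∏ p ∈ P, (1 - (if p ∣ n then 1 else 0) + c p * (if p ^ 2 ∣ n then 1 else 0))

theorem exists_mollifier_coeffs {χ : ℕ → ℂ} (hmul : ∀ a b, χ (a * b) = χ a * χ b)
    (hb : ∀ n, ‖χ n‖ ≤ 1) {c : ℕ → ℝ} (hc0 : ∀ p, 0 ≤ c p) (hc1 : ∀ p, c p ≤ 1) (P : Finset ℕ)
    (hP : ∀ p ∈ P, p.Prime) :
    ∃ (α : ℕ → ℂ) (K : ℕ), (∀ n, ‖α n‖ ≤ 1) ∧ (∀ n, α n ≠ 0 → n ∈ Nat.factoredNumbers P) ∧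
      (∀ n, K < n → α n = 0) ∧
      (∀ s, ∏ p ∈ P, (1 - χ p * (p : ℂ) ^ (-s) + c p * (χ p * (p : ℂ) ^ (-s)) ^ 2) = dirPoly α K s) ∧
      (∀ n, n ≠ 0 → ∑ k ∈ n.divisors, χ (n / k) * α k = χ n * locFactor c P n) := by
  induction P using Finset.induction_on with
  | empty =>
    refine ⟨fun n => if n = 1 then 1 else 0, 1, ?_, ?_, ?_, ?_, ?_⟩
    · intro n; dsimp only; split_ifs <;> simp
    · intro n hn
      have : n = 1 := by by_contra h; simp [h] at hn
      subst this; simp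
    · intro n hn; dsimp only; rw [if_neg (by omega)]
    · intro s; simp [dirPoly]
    · intro n hn
      simp only [mul_ite, mul_one, mul_zero, Finset.sum_ite_eq', Nat.mem_divisors]
      simp [hn, locFactor]
  | insert p P hpP ih =>
    obtain ⟨α, K, ha1, hasupp, haK, haQ, haconv⟩ := ih fun q hq => hP q (Finset.mem_insert_of_mem hq)
    have hp : p.Prime := hP p (Finset.mem_insert_self _ _)
    have hp2 : p < p ^ 2 := by nlinarith [hp.one_lt]
    have hcop : ∀ n, p ∣ n → α n = 0 := by
      intro n hpn
      by_contra h
      have := hasupp n h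
      rw [Nat.mem_factoredNumbers'] at this
      exact hpP (this p hp hpn)
    set r : ℕ → ℂ := fun k => if k = 1 then 1 else if k = p then -χ p else
      if k = p ^ 2 then c p * χ p ^ 2 else 0 with hr
    have hr1 : r 1 = 1 := by simp [hr]
    have hrp : r p = -χ p := by simp [hr, hp.ne_one]
    have hrp2 : r (p ^ 2) = c p * χ p ^ 2 := by
      simp [hr, hp.ne_one, hp2.ne']
    have hr0 : ∀ k, k ≠ 1 → k ≠ p → k ≠ p ^ 2 → r k = 0 := by
      intro k h1 h2 h3; simp [hr, h1, h2, h3]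
    have hsum3 : ∀ F : ℕ → ℂ, ∑ k ∈ Icc 1 (p ^ 2), F k * r k
        = F 1 - F p * χ p + F (p ^ 2) * (c p * χ p ^ 2) := by
      intro F
      have hsub : ({1, p, p ^ 2} : Finset ℕ) ⊆ Icc 1 (p ^ 2) := by
        intro k hk
        simp only [Finset.mem_insert, Finset.mem_singleton] at hk
        rw [Finset.mem_Icc]
        have := hp.one_lt
        rcases hk with rfl | rfl | rfl <;> constructor <;> omega
      rw [← Finset.sum_subset hsub]
      · rw [Finset.sum_insert, Finset.sum_insert, Finset.sum_singleton, hr1, hrp, hrp2]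
        · ring
        · simp [hp2.ne]
        · have : p ^ 2 ≠ 1 := by nlinarith [hp.one_lt]
          simp [hp.ne_one.symm, this.symm]
      · intro k _ hk
        simp only [Finset.mem_insert, Finset.mem_singleton, not_or] at hk
        rw [hr0 k hk.1 hk.2.1 hk.2.2, mul_zero]
    have hform : ∀ n, dconv α r (p ^ 2) n = α n - (if p ∣ n then α (n / p) else 0) * χ p
        + (if p ^ 2 ∣ n then α (n / p ^ 2) else 0) * (c p * χ p ^ 2) := by
      intro n
      unfold dconv
      rw [Finset.sum_filter]
      have := hsum3 (fun k => if k ∣ n then α (n / k) else 0)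
      simp only [ite_mul, zero_mul] at this
      rw [this]
      simp
    refine ⟨dconv α r (p ^ 2), K * p ^ 2, ?_, ?_, ?_, ?_, ?_⟩
    · intro n
      rw [hform]
      by_cases hn : p ∣ n
      · rw [hcop n hn, if_pos hn]
        obtain ⟨m, rfl⟩ := hn
        rw [Nat.mul_div_cancel_left _ hp.pos]
        by_cases hm : p ^ 2 ∣ p * m
        · have hpm : p ∣ m := by rw [sq] at hm; exact Nat.dvd_of_mul_dvd_mul_left hp.pos hm
          rw [hcop m hpm, if_pos hm]
          simp only [zero_mul, sub_zero, zero_add, norm_mul, norm_pow]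
          rw [Complex.norm_real, Real.norm_of_nonneg (hc0 p)]
          exact mul_le_one₀ (ha1 _) (by have := hc0 p; positivity)
            (mul_le_one₀ (hc1 p) (by positivity) (pow_le_one₀ (norm_nonneg _) (hb p)))
        · rw [if_neg hm]
          simp only [zero_sub, zero_mul, add_zero, norm_neg, norm_mul]
          exact mul_le_one₀ (ha1 _) (norm_nonneg _) (hb p)
      · have : ¬ p ^ 2 ∣ n := fun h => hn ((dvd_pow_self p two_ne_zero).trans h)
        rw [if_neg hn, if_neg this]
        simpa using ha1 n
    · intro n hn
      rw [hform] at hn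
      have hins : ∀ m, m ∈ Nat.factoredNumbers P → m ∈ Nat.factoredNumbers (insert p P) :=
        fun m hm => Nat.factoredNumbers_mono (Finset.subset_insert _ _) hm
      have hpm : p ∈ Nat.factoredNumbers (insert p P) := by
        rw [Nat.mem_factoredNumbers']
        intro q hq hqp
        rw [(Nat.prime_dvd_prime_iff_eq hq hp).mp hqp]
        exact Finset.mem_insert_self _ _
      by_cases h : α n = 0
      · by_cases h2 : (if p ∣ n then α (n / p) else 0) = 0
        · rw [h, h2] at hn
          have h3 : (if p ^ 2 ∣ n then α (n / p ^ 2) else 0) ≠ 0 := by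
            intro h3; rw [h3] at hn; simp at hn
          split_ifs at h3 with h4
          · rw [← Nat.div_mul_cancel h4]
            exact Nat.mul_mem_factoredNumbers (hins _ (hasupp _ h3))
              (by rw [sq]; exact Nat.mul_mem_factoredNumbers hpm hpm)
          · exact absurd rfl h3
        · split_ifs at h2 with h4
          · rw [← Nat.div_mul_cancel h4]
            exact Nat.mul_mem_factoredNumbers (hins _ (hasupp _ h2)) hpm
          · exact absurd rfl h2
      · exact hins _ (hasupp n h)
    · intro n hn
      have hp0 : 1 ≤ p := hp.pos
      rw [hform, haK n (by nlinarith [Nat.mul_le_mul_left K (Nat.one_le_pow 2 p hp0)])]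
      have e1 : (if p ∣ n then α (n / p) else 0) = 0 := by
        split_ifs with h
        · apply haK
          rw [Nat.lt_div_iff_mul_lt' h]
          nlinarith [Nat.mul_le_mul_left K hp2.le]
        · rfl
      have e2 : (if p ^ 2 ∣ n then α (n / p ^ 2) else 0) = 0 := by
        split_ifs with h
        · apply haK
          rw [Nat.lt_div_iff_mul_lt' h]
          linarith [mul_comm K (p ^ 2)]
        · rfl
      rw [e1, e2]; ring
    · intro s
      rw [Finset.prod_insert hpP, haQ s, ← dirPoly_mul haK, mul_comm]
      congr 1
      unfold dirPoly
      have := hsum3 (fun k => (k : ℂ) ^ (-s))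
      simp only [mul_comm _ (r _)] at this
      rw [this, sq p, Nat.cast_mul, Complex.natCast_mul_natCast_cpow, Nat.cast_one,
        Complex.one_cpow]
      ring
    · intro n hn
      simp_rw [hform]
      have e0 : ∀ k, χ (n / k) * (α k - (if p ∣ k then α (k / p) else 0) * χ p
        + (if p ^ 2 ∣ k then α (k / p ^ 2) else 0) * (c p * χ p ^ 2))
        = χ (n / k) * α k - (if p ∣ k then χ (n / k) * α (k / p) else 0) * χ p
          + (if p ^ 2 ∣ k then χ (n / k) * α (k / p ^ 2) else 0) * (c p * χ p ^ 2) := by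
        intro k; split_ifs <;> ring
      simp_rw [e0]
      rw [Finset.sum_add_distrib, Finset.sum_sub_distrib, ← Finset.sum_mul, ← Finset.sum_mul,
        sum_divisors_dvd hp.pos hn, sum_divisors_dvd (pow_pos hp.pos 2) hn, haconv n hn]
      have hloc : ∀ d, (d = p ∨ d = p ^ 2) → d ∣ n →
          ∑ j ∈ (n / d).divisors, χ (n / (d * j)) * α (d * j / d)
            = χ (n / d) * locFactor c P n := by
        intro d hd hdn
        have hd0 : 0 < d := by rcases hd with rfl | rfl; exact hp.pos; exact pow_pos hp.pos 2
        have hnd : n / d ≠ 0 := (Nat.div_pos (Nat.le_of_dvd (Nat.pos_of_ne_zero hn) hdn) hd0).ne'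
        have hl : locFactor c P n = locFactor c P (n / d) := by
          unfold locFactor
          refine Finset.prod_congr rfl fun q hq => ?_
          have hqp : q ≠ p := by rintro rfl; exact hpP hq
          have hqpr := hP q (Finset.mem_insert_of_mem hq)
          have hcop1 : Nat.Coprime q d := by
            have := (Nat.coprime_primes hqpr hp).mpr hqp
            rcases hd with rfl | rfl
            · exact this
            · exact this.pow_right 2
          have hk : ∀ k, Nat.Coprime k d → (k ∣ n ↔ k ∣ n / d) := by
            intro k hk
            conv_lhs => rw [← Nat.div_mul_cancel hdn]
            exact hk.dvd_mul_right
          rw [if_congr (hk q hcop1) rfl rfl, if_congr (hk (q ^ 2) (hcop1.pow_left 2)) rfl rfl]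
        rw [hl, ← haconv _ hnd]
        refine Finset.sum_congr rfl fun j _ => ?_
        rw [Nat.mul_div_cancel_left _ hd0, Nat.div_div_eq_div_mul]
      have hχd : ∀ d, d ∣ n → χ d * χ (n / d) = χ n := by
        intro d hd; rw [← hmul, Nat.mul_div_cancel' hd]
      have hχ2 : χ (p ^ 2) = χ p ^ 2 := by rw [sq, hmul, sq]
      have hins : locFactor c (insert p P) n = (1 - (if p ∣ n then 1 else 0)
          + c p * (if p ^ 2 ∣ n then 1 else 0)) * locFactor c P n := by
        unfold locFactor; rw [Finset.prod_insert hpP]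
      rw [hins]
      push_cast
      by_cases d1 : p ∣ n
      · by_cases d2 : p ^ 2 ∣ n
        · simp only [d1, d2, if_true]
          rw [hloc p (Or.inl rfl) d1, hloc _ (Or.inr rfl) d2]
          have := hχd _ d1
          have h2 := hχd _ d2
          rw [hχ2] at h2
          push_cast
          linear_combination (-(locFactor c P n : ℂ)) * this + (c p) * (locFactor c P n : ℂ) * h2
        · simp only [d1, d2, if_true, if_false]
          rw [hloc p (Or.inl rfl) d1]
          have := hχd _ d1
          push_cast
          linear_combination (-(locFactor c P n : ℂ)) * this
      · have d2 : ¬ p ^ 2 ∣ n := fun h => d1 ((dvd_pow_self p two_ne_zero).trans h)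
        simp only [d1, d2, if_false]
        push_cast
        ring

/-- `∑_{N ≤ x} G(N)/N = (∑ λ(k)/k) log x + O(∑ |λ(k)| (1 + log k)/k)` when `G = 1 * λ`. -/
lemma norm_sum_div_sub_le {lam : ℕ → ℂ} {K : ℕ} (hK : ∀ n, K < n → lam n = 0) {G : ℕ → ℂ}
    (hG : ∀ n, n ≠ 0 → ∑ k ∈ n.divisors, lam k = G n) {x : ℕ} (hx : 1 ≤ x) :
    ‖∑ N ∈ Icc 1 x, G N / N - (∑ k ∈ Icc 1 K, lam k / k) * Real.log x‖
      ≤ ∑ k ∈ Icc 1 K, ‖lam k‖ / k * (1 + Real.log k) := by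
  have hharm : ∀ k ∈ Icc 1 K, |∑ j ∈ Icc 1 (x / k), (1 : ℝ) / j - Real.log x| ≤ 1 + Real.log k := by
    intro k hk
    rw [Finset.mem_Icc] at hk
    have hk0 : (0 : ℝ) < k := by exact_mod_cast hk.1
    have hx0 : (0 : ℝ) < x := by exact_mod_cast hx
    have hlk : 0 ≤ Real.log k := Real.log_natCast_nonneg k
    rcases le_or_gt k x with h | h
    · have hpos : 1 ≤ x / k := (Nat.one_le_div_iff hk.1).mpr h
      have hle := sum_inv_nat_le (x / k)
      have hge := log_add_one_le_harmonic (x / k)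
      rw [harmonic_eq_sum_Icc] at hge
      push_cast at hge
      have e1 : Real.log ((x / k : ℕ) : ℝ) ≤ Real.log x := by
        apply Real.log_le_log (by exact_mod_cast hpos)
        exact_mod_cast Nat.div_le_self _ _
      have e2 : Real.log x - Real.log k ≤ Real.log (((x / k : ℕ) : ℝ) + 1) := by
        rw [← Real.log_div hx0.ne' hk0.ne']
        apply Real.log_le_log (by positivity)
        have : x < (x / k + 1) * k := by
          have := Nat.div_add_mod x k
          have := Nat.mod_lt x hk.1
          nlinarith
        rw [div_le_iff₀ hk0]
        exact_mod_cast this.le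
      simp only [one_div] at hle ⊢
      rw [abs_le]; constructor <;> linarith
    · rw [Nat.div_eq_of_lt h]
      simp only [Finset.Icc_eq_empty_of_lt (show (0 : ℕ) < 1 by norm_num), Finset.sum_empty, zero_sub, abs_neg]
      have : Real.log x ≤ Real.log k := Real.log_le_log hx0 (by exact_mod_cast h.le)
      rw [abs_of_nonneg (Real.log_natCast_nonneg x)]
      linarith
  have hswap : ∑ N ∈ Icc 1 x, G N / N
      = ∑ k ∈ Icc 1 K, lam k / k * ((∑ j ∈ Icc 1 (x / k), (1 : ℝ) / j : ℝ) : ℂ) := by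
    have e1 : ∀ N ∈ Icc 1 x, G N / N = ∑ k ∈ Icc 1 K, if k ∣ N then lam k / N else 0 := by
      intro N hN
      rw [Finset.mem_Icc] at hN
      rw [← hG N (by omega), Finset.sum_div, ← Finset.sum_filter]
      have hs : (Icc 1 K).filter (fun k => k ∣ N) ⊆ N.divisors := by
        intro k hk
        rw [Finset.mem_filter] at hk
        exact Nat.mem_divisors.mpr ⟨hk.2, by omega⟩
      symm
      apply Finset.sum_subset hs
      intro k hk hk'
      have hkd := Nat.dvd_of_mem_divisors hk
      rw [hK k, zero_div]
      by_contra hle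
      apply hk'
      rw [Finset.mem_filter, Finset.mem_Icc]
      exact ⟨⟨Nat.pos_of_dvd_of_pos hkd (by omega), by omega⟩, hkd⟩
    rw [Finset.sum_congr rfl e1, Finset.sum_comm]
    refine Finset.sum_congr rfl fun k hk => ?_
    rw [Finset.mem_Icc] at hk
    have hk0 : (k : ℂ) ≠ 0 := by exact_mod_cast (by omega : k ≠ 0)
    rw [← Finset.sum_filter]
    push_cast
    rw [Finset.mul_sum]
    symm
    refine Finset.sum_bij (fun j _ => k * j) ?_ ?_ ?_ ?_
    · intro j hj
      rw [Finset.mem_Icc] at hj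
      rw [Finset.mem_filter, Finset.mem_Icc]
      refine ⟨⟨Nat.mul_pos hk.1 hj.1, ?_⟩, dvd_mul_right _ _⟩
      calc k * j ≤ k * (x / k) := Nat.mul_le_mul_left _ hj.2
        _ ≤ x := Nat.mul_div_le _ _
    · intro a _ b _ h; exact Nat.eq_of_mul_eq_mul_left hk.1 h
    · intro N hN
      rw [Finset.mem_filter, Finset.mem_Icc] at hN
      obtain ⟨j, rfl⟩ := hN.2
      refine ⟨j, ?_, rfl⟩
      rw [Finset.mem_Icc]
      refine ⟨Nat.pos_of_ne_zero (by rintro rfl; simp at hN), ?_⟩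
      rw [Nat.le_div_iff_mul_le hk.1, mul_comm]; exact hN.1.2
    · intro j _
      push_cast
      field_simp
  rw [hswap, Finset.sum_mul, ← Finset.sum_sub_distrib]
  refine (norm_sum_le _ _).trans (Finset.sum_le_sum fun k hk => ?_)
  rw [← mul_sub, norm_mul, norm_div, Complex.norm_natCast, ← Complex.ofReal_sub, Complex.norm_real,
    Real.norm_eq_abs]
  gcongr
  exact hharm k hk

lemma exists_norm_mellin_le {f : ℝ → ℂ} {a b : ℝ} (ha : MellinConvergent f a)
    (hb : MellinConvergent f b) :
    ∃ C : ℝ, 0 ≤ C ∧ ∀ s : ℂ, a ≤ s.re → s.re ≤ b → ‖mellin f s‖ ≤ C := by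
  refine ⟨∫ t in Set.Ioi (0 : ℝ), (‖(t : ℂ) ^ ((a : ℂ) - 1) • f t‖ + ‖(t : ℂ) ^ ((b : ℂ) - 1) • f t‖),
    integral_nonneg fun t => by positivity, fun s hsa hsb => ?_⟩
  have hIntegral : IntegrableOn (fun t : ℝ => ‖(t : ℂ) ^ ((a : ℂ) - 1) • f t‖
      + ‖(t : ℂ) ^ ((b : ℂ) - 1) • f t‖) (Set.Ioi 0) := ha.norm.add hb.norm
  refine norm_integral_le_of_norm_le hIntegral ?_
  refine (ae_restrict_iff' measurableSet_Ioi).mpr (Eventually.of_forall fun t ht => ?_)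
  have ht0 : (0 : ℝ) < t := ht
  rw [norm_smul, norm_smul, norm_smul, ← add_mul]
  refine mul_le_mul_of_nonneg_right ?_ (norm_nonneg _)
  rw [Complex.norm_cpow_eq_rpow_re_of_pos ht0, Complex.norm_cpow_eq_rpow_re_of_pos ht0,
    Complex.norm_cpow_eq_rpow_re_of_pos ht0]
  simp only [Complex.sub_re, Complex.one_re, Complex.ofReal_re]
  rcases le_total 1 t with h | h
  · have := Real.rpow_le_rpow_of_exponent_le h (by linarith : s.re - 1 ≤ b - 1)
    have h2 : 0 ≤ t ^ (a - 1) := by positivity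
    linarith
  · have := Real.rpow_le_rpow_of_exponent_ge ht0 h (by linarith : a - 1 ≤ s.re - 1)
    have h2 : 0 ≤ t ^ (b - 1) := by positivity
    linarith

lemma exists_norm_Gamma_le {a b : ℝ} (ha : 0 < a) (hab : a ≤ b) :
    ∃ C : ℝ, 0 ≤ C ∧ ∀ z : ℂ, a ≤ z.re → z.re ≤ b → ‖Complex.Gamma z‖ ≤ C := by
  have hconv : ∀ c : ℝ, 0 < c → MellinConvergent (fun t => ((Real.exp (-t) : ℝ) : ℂ)) c := by
    intro c hc
    have := Complex.GammaIntegral_convergent (s := (c : ℂ)) (by simpa using hc)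
    refine this.congr_fun (fun t _ => ?_) measurableSet_Ioi
    simp only [smul_eq_mul]; ring
  obtain ⟨C, hC0, hC⟩ := exists_norm_mellin_le (hconv a ha) (hconv b (by linarith))
  refine ⟨C, hC0, fun z h1 h2 => ?_⟩
  rw [Complex.Gamma_eq_integral (by linarith), Complex.GammaIntegral_eq_mellin]
  exact hC z h1 h2

lemma norm_sin_le (z : ℂ) : ‖Complex.sin z‖ ≤ Real.exp |z.im| := by
  unfold Complex.sin
  rw [norm_div, norm_mul, Complex.norm_I, mul_one]
  have h1 : ‖Complex.exp (-z * Complex.I)‖ ≤ Real.exp |z.im| := by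
    rw [Complex.norm_exp]; apply Real.exp_le_exp.mpr
    simpa using le_abs_self z.im
  have h2 : ‖Complex.exp (z * Complex.I)‖ ≤ Real.exp |z.im| := by
    rw [Complex.norm_exp]; apply Real.exp_le_exp.mpr
    simpa using neg_le_abs z.im
  have := norm_sub_le (Complex.exp (-z * Complex.I)) (Complex.exp (z * Complex.I))
  rw [div_le_iff₀ (by simp)]
  simp only [Complex.norm_ofNat]
  linarith

lemma exists_norm_Gamma_inv_le :
    ∃ C : ℝ, 0 ≤ C ∧ ∀ z : ℂ, -(1/4) ≤ z.re → z.re ≤ 3/2 → 1/2 ≤ |z.im| →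
      ‖(Complex.Gamma z)⁻¹‖ ≤ C * Real.exp (4 * |z.im|) := by
  obtain ⟨C, hC0, hC⟩ := exists_norm_Gamma_le (a := 1/4) (b := 5/4) (by norm_num) (by norm_num)
  have key : ∀ z : ℂ, -(1/4) ≤ z.re → z.re ≤ 3/4 → 1/2 ≤ |z.im| →
      ‖(Complex.Gamma z)⁻¹‖ ≤ C * Real.exp (4 * |z.im|) := by
    intro z h1 h2 h3
    have him : z.im ≠ 0 := by intro h; rw [h] at h3; norm_num at h3
    have hG : Complex.Gamma z ≠ 0 := by
      refine Complex.Gamma_ne_zero fun m h => him ?_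
      rw [h]; simp
    have hsin : Complex.sin (π * z) ≠ 0 := by
      rw [Complex.sin_ne_zero_iff]
      intro k h
      have := congrArg Complex.im h
      simp [Real.pi_ne_zero, him] at this
    have hrefl := Complex.Gamma_mul_Gamma_one_sub z
    have hpi : (π : ℂ) ≠ 0 := by exact_mod_cast Real.pi_ne_zero
    have e : (Complex.Gamma z)⁻¹ = Complex.Gamma (1 - z) * Complex.sin (π * z) / π := by
      rw [eq_div_iff hsin] at hrefl
      rw [eq_div_iff hpi, inv_mul_eq_iff_eq_mul₀ hG]
      linear_combination -hrefl
    rw [e, norm_div, norm_mul, Complex.norm_real, Real.norm_of_nonneg Real.pi_pos.le]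
    have b1 := hC (1 - z) (by simp; linarith) (by simp; linarith)
    have b2 := norm_sin_le (π * z)
    have b3 : |((π : ℂ) * z).im| ≤ 4 * |z.im| := by
      simp only [Complex.mul_im, Complex.ofReal_re, Complex.ofReal_im, zero_mul, add_zero, abs_mul,
        abs_of_pos Real.pi_pos]
      gcongr; exact Real.pi_le_four
    calc _ ≤ C * Real.exp (4 * |z.im|) / 1 := by
          gcongr
          · exact b2.trans (Real.exp_le_exp.mpr b3)
          · linarith [Real.pi_gt_three]
      _ = _ := div_one _
  refine ⟨2 * C, by positivity, fun z h1 h2 h3 => ?_⟩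
  have hexp := Real.exp_pos (4 * |z.im|)
  rcases le_or_gt z.re (3/4) with h | h
  · have := key z h1 h h3
    nlinarith [mul_nonneg hC0 hexp.le]
  · have hz1 : z - 1 ≠ 0 := by
      intro h0
      have := congrArg Complex.im h0
      simp at this
      rw [this] at h3; norm_num at h3
    have e := Complex.Gamma_add_one (z - 1) hz1
    rw [sub_add_cancel] at e
    have := key (z - 1) (by simp; linarith) (by simp; linarith) (by simpa using h3)
    simp only [Complex.sub_im, Complex.one_im, sub_zero] at this
    rw [e, mul_inv, norm_mul, norm_inv]
    have hn : 1/2 ≤ ‖z - 1‖ := by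
      refine h3.trans ?_
      have := Complex.abs_im_le_norm (z - 1)
      simpa using this
    have hn2 : ‖z - 1‖⁻¹ ≤ 2 := by
      rw [inv_le_comm₀ (by linarith) (by norm_num)]; linarith
    calc _ ≤ 2 * (C * Real.exp (4 * |z.im|)) := by gcongr
      _ = _ := by ring

lemma exists_norm_Gammaℝ_inv_le :
    ∃ C : ℝ, 0 ≤ C ∧ ∀ s : ℂ, -(1/2) ≤ s.re → s.re ≤ 3 → 1 ≤ |s.im| →
      ‖(Gammaℝ s)⁻¹‖ ≤ C * Real.exp (2 * |s.im|) := by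
  obtain ⟨C, hC0, hC⟩ := exists_norm_Gamma_inv_le
  refine ⟨π ^ (3/2 : ℝ) * C, by positivity, fun s h1 h2 h3 => ?_⟩
  rw [Gammaℝ_def, mul_inv, norm_mul]
  have him : (s / 2).im = s.im / 2 := by simp
  have hre : (s / 2).re = s.re / 2 := by simp
  have := hC (s / 2) (by rw [hre]; linarith) (by rw [hre]; linarith)
    (by rw [him, abs_div, abs_two]; linarith)
  rw [him, abs_div, abs_two] at this
  have h4 : ‖((π : ℂ) ^ (-s / 2))⁻¹‖ ≤ π ^ (3/2 : ℝ) := by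
    rw [norm_inv, Complex.norm_cpow_eq_rpow_re_of_pos Real.pi_pos, ← Real.rpow_neg Real.pi_pos.le]
    apply Real.rpow_le_rpow_of_exponent_le (by linarith [Real.pi_gt_three])
    have : (-s / 2).re = -s.re / 2 := by simp
    rw [this]; linarith
  calc _ ≤ π ^ (3/2 : ℝ) * (C * Real.exp (4 * (|s.im| / 2))) := by gcongr
    _ = _ := by ring_nf

lemma exists_norm_completedHurwitz_le (a : UnitAddCircle) :
    ∃ C : ℝ, 0 ≤ C ∧ ∀ s : ℂ, -(1/2) ≤ s.re → s.re ≤ 3/2 → 1 ≤ |s.im| →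
      ‖completedHurwitzZetaEven a s‖ ≤ C ∧ ‖completedHurwitzZetaOdd a s‖ ≤ C := by
  have hcE : ∀ x : ℝ, MellinConvergent (hurwitzEvenFEPair a).f_modif x := fun x =>
    (((hurwitzEvenFEPair a).isStrongFEPair_toStrongFEPair).hasMellin x).1
  have hcO : ∀ x : ℝ, MellinConvergent (hurwitzOddFEPair a).f x := fun x =>
    ((isStrong_hurwitzOddFEPair a).hasMellin x).1
  obtain ⟨C1, hC1, h1⟩ := exists_norm_mellin_le (hcE (-(1/4))) (hcE (3/4))
  obtain ⟨C2, hC2, h2⟩ := exists_norm_mellin_le (hcO (1/4)) (hcO (5/4))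
  refine ⟨C1 + C2 + 2, by positivity, fun s hs1 hs2 hs3 => ⟨?_, ?_⟩⟩
  · have hn : ∀ z : ℂ, 1 ≤ |z.im| → 1 ≤ ‖z‖ := fun z hz => hz.trans (Complex.abs_im_le_norm z)
    rw [completedHurwitzZetaEven_eq]
    have b1 : ‖completedHurwitzZetaEven₀ a s‖ ≤ C1 := by
      have := h1 (s / 2) (by simp; linarith) (by simp; linarith)
      change ‖mellin (hurwitzEvenFEPair a).f_modif (s / 2) / 2‖ ≤ C1
      rw [norm_div, Complex.norm_ofNat]; linarith [norm_nonneg (mellin (hurwitzEvenFEPair a).f_modif (s / 2))]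
    have b2 : ‖(if a = 0 then (1 : ℂ) else 0) / s‖ ≤ 1 := by
      have := hn s hs3
      rw [norm_div, div_le_one (by linarith)]
      split_ifs <;> simp <;> linarith
    have b3 : ‖1 / (1 - s)‖ ≤ 1 := by
      have := hn (1 - s) (by simpa using hs3)
      rw [norm_div, norm_one, div_le_one (by linarith)]; exact this
    have := norm_sub_le (completedHurwitzZetaEven₀ a s - (if a = 0 then 1 else 0) / s) (1 / (1 - s))
    have := norm_sub_le (completedHurwitzZetaEven₀ a s) ((if a = 0 then 1 else 0) / s)
    linarith
  · have := h2 ((s + 1) / 2) (by simp; linarith) (by simp; linarith)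
    change ‖(hurwitzOddFEPair a).Λ ((s + 1) / 2) / 2‖ ≤ _
    rw [(isStrong_hurwitzOddFEPair a).Λ_eq, norm_div, Complex.norm_ofNat]
    linarith [norm_nonneg (mellin (hurwitzOddFEPair a).f ((s + 1) / 2))]

lemma exists_norm_hurwitzZeta_le (a : UnitAddCircle) :
    ∃ C : ℝ, 0 ≤ C ∧ ∀ s : ℂ, -(1/2) ≤ s.re → s.re ≤ 3/2 → 1 ≤ |s.im| →
      ‖hurwitzZeta a s‖ ≤ C * Real.exp (2 * |s.im|) := by
  obtain ⟨C, hC0, hC⟩ := exists_norm_completedHurwitz_le a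
  obtain ⟨G, hG0, hG⟩ := exists_norm_Gammaℝ_inv_le
  refine ⟨2 * (C * G), by positivity, fun s h1 h2 h3 => ?_⟩
  obtain ⟨hE, hO⟩ := hC s h1 h2 h3
  have g1 := hG s h1 (by linarith) h3
  have g2 := hG (s + 1) (by simp; linarith) (by simp; linarith) (by simpa using h3)
  simp only [Complex.add_im, Complex.one_im, add_zero] at g2
  have hs0 : s ≠ 0 := by rintro rfl; norm_num at h3
  have e : hurwitzZeta a s = completedHurwitzZetaEven a s * (Gammaℝ s)⁻¹
      + completedHurwitzZetaOdd a s * (Gammaℝ (s + 1))⁻¹ := by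
    rw [hurwitzZeta, hurwitzZetaEven_def_of_ne_or_ne (Or.inr hs0), hurwitzZetaOdd, div_eq_mul_inv,
      div_eq_mul_inv]
  rw [e]
  refine (norm_add_le _ _).trans ?_
  rw [norm_mul, norm_mul]
  calc _ ≤ C * (G * Real.exp (2 * |s.im|)) + C * (G * Real.exp (2 * |s.im|)) := by gcongr
    _ = _ := by ring

lemma exists_norm_LFunction_le {q : ℕ} [NeZero q] (χ : DirichletCharacter ℂ q) :
    ∃ C : ℝ, 0 ≤ C ∧ ∀ s : ℂ, -(1/2) ≤ s.re → s.re ≤ 3/2 → 1 ≤ |s.im| →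
      ‖DirichletCharacter.LFunction χ s‖ ≤ C * Real.exp (2 * |s.im|) := by
  choose C hC0 hC using fun a : UnitAddCircle => exists_norm_hurwitzZeta_le a
  refine ⟨(q : ℝ) ^ (1/2 : ℝ) * ∑ j : ZMod q, C (ZMod.toAddCircle j), by
    have := Finset.sum_nonneg fun (j : ZMod q) (_ : j ∈ Finset.univ) => hC0 (ZMod.toAddCircle j)
    positivity, fun s h1 h2 h3 => ?_⟩
  have hq : (0 : ℝ) < q := by exact_mod_cast NeZero.pos q
  change ‖ZMod.LFunction χ s‖ ≤ _
  rw [ZMod.LFunction, norm_mul, mul_assoc]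
  have hq1 : (1 : ℝ) ≤ q := by exact_mod_cast NeZero.pos q
  gcongr
  · rw [← Complex.ofReal_natCast, Complex.norm_cpow_eq_rpow_re_of_pos hq]
    exact Real.rpow_le_rpow_of_exponent_le hq1 (by simp; linarith)
  · rw [Finset.sum_mul]
    refine (norm_sum_le _ _).trans (Finset.sum_le_sum fun j _ => ?_)
    rw [norm_mul]
    calc _ ≤ 1 * ‖hurwitzZeta (ZMod.toAddCircle j) s‖ := by gcongr; exact χ.norm_le_one j
      _ ≤ _ := by rw [one_mul]; exact hC _ s h1 h2 h3

/-- The factor in the functional equation `L(z, χ) = feFactor χ z * L(1 - z, χ⁻¹)`. -/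
noncomputable def feFactor {q : ℕ} [NeZero q] (χ : DirichletCharacter ℂ q) (z : ℂ) : ℂ :=
  (q : ℂ) ^ (1 / 2 - z) * DirichletCharacter.rootNumber χ *
    (DirichletCharacter.gammaFactor χ (1 - z) * (DirichletCharacter.gammaFactor χ z)⁻¹)

lemma exists_gammaFactor_eq {q : ℕ} (χ : DirichletCharacter ℂ q) :
    ∃ κ : ℝ, (κ = 0 ∨ κ = 1) ∧ (∀ z, DirichletCharacter.gammaFactor χ z = Gammaℝ (z + κ)) ∧
      (∀ z, DirichletCharacter.gammaFactor χ⁻¹ z = Gammaℝ (z + κ)) := by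
  rcases χ.even_or_odd with h | h
  · refine ⟨0, Or.inl rfl, fun z => ?_, fun z => ?_⟩
    · rw [h.gammaFactor_def]; simp
    · have h' : χ⁻¹.Even := by
        have : χ (-1) = 1 := h
        change χ⁻¹ (-1) = 1
        rw [MulChar.inv_apply_eq_inv', this, inv_one]
      rw [h'.gammaFactor_def]; simp
  · refine ⟨1, Or.inr rfl, fun z => ?_, fun z => ?_⟩
    · rw [h.gammaFactor_def]; simp
    · have h' : χ⁻¹.Odd := by
        have : χ (-1) = -1 := h
        change χ⁻¹ (-1) = -1
        rw [MulChar.inv_apply_eq_inv', this]; norm_num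
      rw [h'.gammaFactor_def]; simp

lemma LFunction_eq_feFactor_mul {q : ℕ} [NeZero q] {χ : DirichletCharacter ℂ q}
    (hχ : χ.IsPrimitive) {z : ℂ} (hz : z.im ≠ 0) :
    DirichletCharacter.LFunction χ z = feFactor χ z * DirichletCharacter.LFunction χ⁻¹ (1 - z) := by
  have hz0 : z ≠ 0 := by rintro rfl; simp at hz
  have hz1 : 1 - z ≠ 0 := by
    intro h; have := congrArg Complex.im h; simp at this; exact hz this
  obtain ⟨κ, hκ, hg, hg'⟩ := exists_gammaFactor_eq χ
  have hne : DirichletCharacter.gammaFactor χ (1 - z) ≠ 0 := by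
    rw [hg, Ne, Gammaℝ_eq_zero_iff]
    rintro ⟨n, h⟩
    have := congrArg Complex.im h
    simp at this
    exact hz this
  have hfe := hχ.completedLFunction_one_sub (1 - z)
  rw [sub_sub_cancel] at hfe
  rw [DirichletCharacter.LFunction_eq_completed_div_gammaFactor χ z (Or.inl hz0),
    DirichletCharacter.LFunction_eq_completed_div_gammaFactor χ⁻¹ (1 - z) (Or.inl hz1), hfe,
    hg' (1 - z), ← hg (1 - z), feFactor, show (1 - z - 1 / 2 : ℂ) = 1 / 2 - z by ring]
  field_simp

lemma norm_Gammaℝ_conj (z : ℂ) : ‖Gammaℝ ((starRingEnd ℂ) z)‖ = ‖Gammaℝ z‖ := by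
  rw [Gammaℝ_def, Gammaℝ_def, norm_mul, norm_mul]
  congr 1
  · rw [Complex.norm_cpow_eq_rpow_re_of_pos Real.pi_pos, Complex.norm_cpow_eq_rpow_re_of_pos Real.pi_pos]
    simp
  · rw [show (starRingEnd ℂ) z / 2 = (starRingEnd ℂ) (z / 2) by rw [map_div₀, map_ofNat], Complex.Gamma_conj,
      RCLike.norm_conj]

lemma exists_norm_feFactor_le {q : ℕ} [NeZero q] (χ : DirichletCharacter ℂ q) :
    ∃ C : ℝ, 0 ≤ C ∧ (∀ u : ℝ, ‖feFactor χ (1/2 + u * Complex.I)‖ ≤ C) ∧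
      (∀ u : ℝ, ‖feFactor χ (-(1/2) + u * Complex.I)‖ ≤ C * (1 + |u|)) ∧
      (∀ z : ℂ, -(1/2) ≤ z.re → z.re ≤ 1/2 → 1 ≤ |z.im| →
        ‖feFactor χ z‖ ≤ C * Real.exp (2 * |z.im|)) := by
  obtain ⟨κ, hκ, hg, -⟩ := exists_gammaFactor_eq χ
  obtain ⟨G, hG0, hG⟩ := exists_norm_Gammaℝ_inv_le
  obtain ⟨H, hH0, hH⟩ := exists_norm_Gamma_le (a := 1/4) (b := 5/4) (by norm_num) (by norm_num)
  set W := ‖DirichletCharacter.rootNumber χ‖ with hW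
  have hq : (0 : ℝ) < q := by exact_mod_cast NeZero.pos q
  have hq1 : (1 : ℝ) ≤ q := by exact_mod_cast NeZero.pos q
  have hqz : ∀ z : ℂ, -(1/2) ≤ z.re → ‖(q : ℂ) ^ (1 / 2 - z)‖ ≤ q := by
    intro z hz
    rw [← Complex.ofReal_natCast, Complex.norm_cpow_eq_rpow_re_of_pos hq]
    have : ((1 / 2 : ℂ) - z).re = 1 / 2 - z.re := by simp
    rw [this]
    calc (q : ℝ) ^ (1 / 2 - z.re) ≤ (q : ℝ) ^ (1 : ℝ) :=
          Real.rpow_le_rpow_of_exponent_le hq1 (by linarith)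
      _ = q := Real.rpow_one _
  have hW0 : 0 ≤ W := norm_nonneg _
  have hgen : ∀ z : ℂ, -(1/2) ≤ z.re → ‖feFactor χ z‖ ≤
      q * W * (‖Gammaℝ (1 - z + κ)‖ * ‖(Gammaℝ (z + κ))⁻¹‖) := by
    intro z hz
    rw [feFactor, norm_mul, norm_mul, norm_mul, hg, hg]
    gcongr
    exact hqz z hz
  have hκ0 : 0 ≤ κ ∧ κ ≤ 1 := by rcases hκ with h | h <;> rw [h] <;> norm_num
  refine ⟨q * W * (1 + 1 * H * G), by positivity, fun u => ?_, fun u => ?_, fun z h1 h2 h3 => ?_⟩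
  · refine (hgen _ (by simp)).trans ?_
    have e : (1 - (1/2 + u * Complex.I) + κ : ℂ) = (starRingEnd ℂ) (1/2 + u * Complex.I + κ) := by
      simp only [map_add, map_mul, Complex.conj_ofReal, Complex.conj_I, map_div₀, map_one, map_ofNat]
      ring
    rw [e, norm_Gammaℝ_conj, norm_inv]
    gcongr
    have : ‖Gammaℝ (1/2 + u * Complex.I + κ)‖ * ‖Gammaℝ (1/2 + u * Complex.I + κ)‖⁻¹ ≤ 1 := mul_inv_le_one
    nlinarith [mul_nonneg hH0 hG0]
  · refine (hgen _ (by simp)).trans ?_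
    have e : (1 - (-(1/2) + u * Complex.I) + κ : ℂ)
        = (starRingEnd ℂ) (-(1/2) + u * Complex.I + κ) + 2 := by
      simp only [map_add, map_neg, map_mul, Complex.conj_ofReal, Complex.conj_I, map_div₀, map_one, map_ofNat]
      ring
    set v : ℂ := -(1/2) + u * Complex.I + κ with hv
    have hv0 : (starRingEnd ℂ) v ≠ 0 := by
      rw [Ne, map_eq_zero]
      intro h0
      have := congrArg Complex.re h0
      simp [hv] at this
      rcases hκ with h | h <;> rw [h] at this <;> norm_num at this
    rw [e, Gammaℝ_add_two hv0, norm_div, norm_div, norm_mul, norm_Gammaℝ_conj, RCLike.norm_conj,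
      norm_inv, Complex.norm_ofNat, Complex.norm_real, Real.norm_of_nonneg Real.pi_pos.le, mul_assoc (q * W)]
    refine mul_le_mul_of_nonneg_left ?_ (by positivity)
    have hvn : ‖v‖ ≤ 1 + |u| := by
      have h1 : ‖v‖ ≤ |v.re| + |v.im| := Complex.norm_le_abs_re_add_abs_im v
      have hre : v.re = -(1/2) + κ := by simp [hv]
      have him : v.im = u := by simp [hv]
      rw [hre, him] at h1
      have : |-(1/2) + κ| ≤ 1 := by rw [abs_le]; constructor <;> linarith
      linarith
    have h2 : ‖Gammaℝ v‖ * ‖Gammaℝ v‖⁻¹ ≤ 1 := mul_inv_le_one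
    have h20 : 0 ≤ ‖Gammaℝ v‖ * ‖Gammaℝ v‖⁻¹ := by positivity
    calc ‖Gammaℝ v‖ * ‖v‖ / 2 / π * ‖Gammaℝ v‖⁻¹
        = (‖Gammaℝ v‖ * ‖Gammaℝ v‖⁻¹) * (‖v‖ / (2 * π)) := by field_simp
      _ ≤ 1 * (‖v‖ / 1) := by
          gcongr
          linarith [Real.pi_gt_three]
      _ ≤ 1 + |u| := by rw [one_mul, div_one]; exact hvn
      _ ≤ (1 + 1 * H * G) * (1 + |u|) := by
          have : 0 ≤ H * G * (1 + |u|) := by positivity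
          nlinarith
  · refine (hgen z h1).trans ?_
    have g := hG (z + κ) (by simp; linarith) (by simp; linarith) (by simpa using h3)
    simp only [Complex.add_im, Complex.ofReal_im, add_zero] at g
    have g2 : ‖Gammaℝ (1 - z + κ)‖ ≤ 1 * H := by
      rw [Gammaℝ_def, norm_mul]
      have hre : ((1 - z + κ : ℂ) / 2).re = (1 - z.re + κ) / 2 := by simp
      gcongr
      · rw [Complex.norm_cpow_eq_rpow_re_of_pos Real.pi_pos]
        apply Real.rpow_le_one_of_one_le_of_nonpos (by linarith [Real.pi_gt_three])
        have : (-(1 - z + κ : ℂ) / 2).re = -(1 - z.re + κ) / 2 := by simp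
        rw [this]; linarith
      · exact hH _ (by rw [hre]; linarith) (by rw [hre]; linarith)
    have he := Real.exp_pos (2 * |z.im|)
    calc _ ≤ q * W * ((1 * H) * (G * Real.exp (2 * |z.im|))) := by gcongr
      _ ≤ _ := by
        have : 0 ≤ q * W * Real.exp (2 * |z.im|) := by positivity
        linarith

lemma norm_integral_vertical_sub_le {f : ℂ → ℂ} {a b H M : ℝ} (hab : a ≤ b) (hH : 0 ≤ H)
    (hf : ∀ w : ℂ, a ≤ w.re → w.re ≤ b → |w.im| ≤ H → DifferentiableAt ℂ f w)
    (hM : ∀ w : ℂ, a ≤ w.re → w.re ≤ b → |w.im| = H → ‖f w‖ ≤ M) :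
    ‖(∫ v in (-H)..H, f (b + v * I)) - ∫ v in (-H)..H, f (a + v * I)‖ ≤ 2 * M * (b - a) := by
  have h := Complex.integral_boundary_rect_eq_zero_of_differentiableOn f (a + (-H : ℝ) * I)
    (b + (H : ℝ) * I) (by
      intro w hw
      rw [Complex.mem_reProdIm] at hw
      simp only [add_re, ofReal_re, mul_re, I_re, mul_zero, ofReal_im, I_im, mul_one, sub_self,
        add_zero, add_im, mul_im, zero_add, Set.uIcc_of_le hab,
        Set.uIcc_of_le (by linarith : -H ≤ H), Set.mem_Icc] at hw
      exact (hf w hw.1.1 hw.1.2 (abs_le.mpr hw.2)).differentiableWithinAt)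
  simp only [add_re, ofReal_re, mul_re, I_re, mul_zero, ofReal_im, I_im, mul_one, sub_self,
        add_zero, add_im, mul_im, zero_add, smul_eq_mul] at h
  have hb : ∀ c : ℝ, |c| = H → ‖∫ x in a..b, f (x + c * I)‖ ≤ M * (b - a) := by
    intro c hc
    refine (intervalIntegral.norm_integral_le_of_norm_le_const fun x hx => ?_).trans_eq
      (by rw [abs_of_nonneg (sub_nonneg.mpr hab)])
    rw [Set.uIoc_of_le hab] at hx
    exact hM _ (by simpa using hx.1.le) (by simpa using hx.2) (by simpa using hc)
  have h1 := hb (-H) (by rw [abs_neg, abs_of_nonneg hH])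
  have h2 := hb H (abs_of_nonneg hH)
  have e : (∫ v in (-H)..H, f (b + v * I)) - ∫ v in (-H)..H, f (a + v * I)
      = I * ((∫ x in a..b, f (x + (-H : ℝ) * I)) - ∫ x in a..b, f (x + H * I)) := by
    linear_combination (-I) * h + ((∫ v in (-H)..H, f (b + v * I)) -
      ∫ v in (-H)..H, f (a + v * I)) * Complex.I_sq
  rw [e, norm_mul, norm_I, one_mul]
  exact (norm_sub_le _ _).trans (by linarith)

lemma add_mul_I_ne_zero {b : ℝ} (hb : b ≠ 0) (v : ℝ) : (b + v * I : ℂ) ≠ 0 := by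
  intro h
  have := congrArg Complex.re h
  simp at this
  exact hb this

lemma integral_inv_add_mul_I {b : ℝ} (hb : b ≠ 0) (H : ℝ) :
    ∫ v in (-H)..H, (1 : ℂ) / (b + v * I) = (2 * Real.arctan (H / b) : ℝ) := by
  have hd : ∀ v : ℝ, HasDerivAt
      (fun v : ℝ => ((Real.arctan (v / b) : ℝ) : ℂ) - I / 2 * (Real.log (b ^ 2 + v ^ 2) : ℝ))
      ((1 : ℂ) / (b + v * I)) v := by
    intro v
    have h0 : 0 < b ^ 2 + v ^ 2 := by positivity
    have h1 := (((hasDerivAt_id v).div_const b).arctan).ofReal_comp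
    have h2 := ((((hasDerivAt_id v).pow 2).const_add (b ^ 2)).log (by simpa using h0.ne')).ofReal_comp
    refine (h1.sub (h2.const_mul (I / 2))).congr_deriv ?_
    have hz := add_mul_I_ne_zero hb v
    have h0' : ((b : ℂ) ^ 2 + v ^ 2) ≠ 0 := by exact_mod_cast h0.ne'
    have hb' : (b : ℂ) ≠ 0 := by exact_mod_cast hb
    have h3 : (1 : ℂ) + (v / b) ^ 2 ≠ 0 := by
      have : (0:ℝ) < 1 + (v / b) ^ 2 := by positivity
      exact_mod_cast this.ne'
    have e1 : (1 : ℂ) + (v / b) ^ 2 = (b ^ 2 + v ^ 2) / b ^ 2 := by field_simp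
    simp only [id, Pi.pow_apply]
    push_cast
    rw [e1]
    rw [eq_div_iff hz]
    field_simp
    linear_combination (-(v : ℂ) ^ 2) * Complex.I_sq
  have hc : Continuous fun v : ℝ => (1 : ℂ) / (b + v * I) := by
    refine continuous_const.div (by fun_prop) fun v => add_mul_I_ne_zero hb v
  rw [intervalIntegral.integral_eq_sub_of_hasDerivAt (fun v _ => hd v) (hc.intervalIntegrable _ _)]
  rw [neg_div, Real.arctan_neg, neg_sq]
  push_cast
  ring

lemma pi_div_two_sub_le_arctan {x : ℝ} (hx : 0 < x) : π / 2 - x⁻¹ ≤ Real.arctan x := by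
  have h := Real.arctan_inv_of_pos hx
  have h1 : 0 < Real.arctan x⁻¹ := Real.arctan_pos.mpr (by positivity)
  have h2 := Real.lt_tan h1 (Real.arctan_lt_pi_div_two _)
  rw [Real.tan_arctan] at h2
  linarith

/-- A one-sided residue theorem for the kernel `1 / w` on a rectangle. -/
lemma norm_apply_zero_le {f : ℂ → ℂ} {a b H M : ℝ} (ha : a < 0) (hb : 0 < b)
    (hH : 2 * (b - a) ≤ H)
    (hf : ∀ w : ℂ, a ≤ w.re → w.re ≤ b → |w.im| ≤ H → DifferentiableAt ℂ f w)
    (hM : ∀ w : ℂ, a ≤ w.re → w.re ≤ b → |w.im| = H → ‖f w / w‖ ≤ M) :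
    ‖f 0‖ ≤ ‖∫ v in (-H)..H, f (b + v * I) / (b + v * I)‖ +
      ‖∫ v in (-H)..H, f (a + v * I) / (a + v * I)‖ + 2 * M * (b - a) := by
  have hH0 : 0 < H := by linarith
  have hdiff : ∀ w : ℂ, a ≤ w.re → w.re ≤ b → |w.im| ≤ H → DifferentiableAt ℂ (dslope f 0) w := by
    intro w h1 h2 h3
    rcases eq_or_ne w 0 with rfl | hw
    · have hnhds : {w : ℂ | (a < w.re ∧ w.re < b) ∧ (-H < w.im ∧ w.im < H)} ∈ nhds (0 : ℂ) := by
        refine IsOpen.mem_nhds ?_ (by simp; exact ⟨⟨ha, hb⟩, hH0⟩)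
        exact ((isOpen_lt continuous_const continuous_re).inter
          (isOpen_lt continuous_re continuous_const)).inter
          ((isOpen_lt continuous_const continuous_im).inter
          (isOpen_lt continuous_im continuous_const))
      exact ((Complex.differentiableOn_dslope hnhds).mpr fun w hw =>
        (hf w hw.1.1.le hw.1.2.le (abs_le.mpr ⟨hw.2.1.le, hw.2.2.le⟩)).differentiableWithinAt).differentiableAt
        hnhds
    · exact (differentiableAt_dslope_of_ne hw).mpr (hf w h1 h2 h3)
  have hds : ∀ w : ℂ, w ≠ 0 → dslope f 0 w = f w / w - f 0 * (1 / w) := by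
    intro w hw
    rw [dslope_of_ne _ hw, slope_def_field]
    field_simp
    ring
  have key := norm_integral_vertical_sub_le (M := M + ‖f 0‖ / H) (by linarith : a ≤ b) hH0.le hdiff
    (by
      intro w h1 h2 h3
      have hw : w ≠ 0 := by rintro rfl; simp at h3; linarith
      rw [hds w hw]
      refine (norm_sub_le _ _).trans (add_le_add (hM w h1 h2 h3) ?_)
      rw [norm_mul, norm_div, norm_one, mul_one_div]
      gcongr
      rw [← h3]; exact Complex.abs_im_le_norm w)
  have hIntegral : ∀ c : ℝ, a ≤ c → c ≤ b → c ≠ 0 → ∫ v in (-H)..H, dslope f 0 (c + v * I) =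
      (∫ v in (-H)..H, f (c + v * I) / (c + v * I)) - f 0 * (2 * Real.arctan (H / c) : ℝ) := by
    intro c h1 h2 hc
    rw [← integral_inv_add_mul_I hc, ← intervalIntegral.integral_const_mul,
      ← intervalIntegral.integral_sub]
    · exact intervalIntegral.integral_congr fun v _ => hds _ (add_mul_I_ne_zero hc v)
    · apply ContinuousOn.intervalIntegrable
      refine ContinuousOn.div ?_ (by fun_prop) fun v _ => add_mul_I_ne_zero hc v
      intro v hv
      rw [Set.uIcc_of_le (by linarith)] at hv
      have := (hf (c + v * I) (by simpa using h1) (by simpa using h2)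
        (by simpa using abs_le.mpr hv)).continuousAt
      exact (ContinuousAt.comp (f := fun v : ℝ => (c + v * I : ℂ)) this (by fun_prop)).continuousWithinAt
    · exact (Continuous.mul continuous_const (continuous_const.div (by fun_prop)
        fun v => add_mul_I_ne_zero hc v)).intervalIntegrable _ _
  rw [hIntegral b (by linarith) le_rfl hb.ne', hIntegral a le_rfl (by linarith) ha.ne] at key
  set Ib := ∫ v in (-H)..H, f (b + v * I) / (b + v * I)
  set Ia := ∫ v in (-H)..H, f (a + v * I) / (a + v * I)
  have h1 := pi_div_two_sub_le_arctan (div_pos hH0 hb)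
  have h2 := pi_div_two_sub_le_arctan (div_pos hH0 (neg_pos.mpr ha))
  rw [div_neg, Real.arctan_neg] at h2
  rw [inv_div] at h1
  rw [← div_neg, inv_div] at h2
  set α := Real.arctan (H / b)
  set β := Real.arctan (H / a)
  have e : f 0 * ((2 * α - 2 * β : ℝ) : ℂ) = (Ib - Ia) -
      (Ib - f 0 * (2 * α : ℝ) - (Ia - f 0 * (2 * β : ℝ))) := by
    push_cast; ring
  have h3 : ‖f 0‖ * (2 * α - 2 * β) ≤ ‖Ib‖ + ‖Ia‖ + 2 * (M + ‖f 0‖ / H) * (b - a) := by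
    calc ‖f 0‖ * (2 * α - 2 * β) ≤ ‖f 0 * ((2 * α - 2 * β : ℝ) : ℂ)‖ := by
          rw [norm_mul, Complex.norm_real]
          exact mul_le_mul_of_nonneg_left (le_abs_self _) (norm_nonneg _)
      _ ≤ ‖Ib - Ia‖ + _ := by rw [e]; exact norm_sub_le _ _
      _ ≤ _ := add_le_add (norm_sub_le _ _) key
  have h4 : (b - a) / H ≤ 1 / 2 := by rw [div_le_iff₀ hH0]; linarith
  have h5 : b / H + -a / H = (b - a) / H := by ring
  have h6 : 2 * (M + ‖f 0‖ / H) * (b - a) = 2 * M * (b - a) + ‖f 0‖ * (2 * ((b - a) / H)) := by ring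
  have h7 : 2 ≤ 2 * α - 2 * β := by linarith [Real.pi_gt_three]
  have h8 := mul_le_mul_of_nonneg_left h7 (norm_nonneg (f 0))
  have h9 := mul_le_mul_of_nonneg_left h4 (norm_nonneg (f 0))
  rw [h6] at h3
  linarith

/-- `L²` bound for superpositions, by Cauchy–Schwarz and Fubini. -/
lemma integral_sq_integral_mul_le {k : ℝ → ℝ} {G : ℝ → ℝ → ℝ} {a b H M : ℝ} (hab : a ≤ b)
    (hH : 0 < H) (hk : Continuous k) (hk0 : ∀ v, 0 < k v) (hG : Continuous (Function.uncurry G))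
    (hM : ∀ v, ∫ t in a..b, G t v ^ 2 ≤ M) :
    ∫ t in a..b, (∫ v in (-H)..H, k v * G t v) ^ 2 ≤ (∫ v in (-H)..H, k v) ^ 2 * M := by
  set K := ∫ v in (-H)..H, k v with hK
  have hK0 : 0 < K := intervalIntegral.intervalIntegral_pos_of_pos (hk.intervalIntegrable _ _) hk0
    (by linarith)
  have hGt : ∀ t, Continuous (G t) := fun t => hG.comp (Continuous.prodMk_right t)
  have hGv : ∀ v, Continuous fun t => G t v := fun v => hG.comp (Continuous.prodMk_left v)
  have hcs : ∀ t, (∫ v in (-H)..H, k v * G t v) ^ 2 ≤ K * ∫ v in (-H)..H, k v * G t v ^ 2 := by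
    intro t
    set B := ∫ v in (-H)..H, k v * G t v with hB
    have h0 : 0 ≤ ∫ v in (-H)..H, k v * (K * G t v - B) ^ 2 :=
      intervalIntegral.integral_nonneg (by linarith) fun v _ => by
        have := (hk0 v).le; positivity
    have e : (∫ v in (-H)..H, k v * (K * G t v - B) ^ 2)
        = K ^ 2 * (∫ v in (-H)..H, k v * G t v ^ 2) - 2 * K * B * B + B ^ 2 * K := by
      have hi : ∀ g : ℝ → ℝ, Continuous g → IntervalIntegrable g volume (-H) H :=
        fun g hg => hg.intervalIntegrable _ _
      have := hGt t
      calc (∫ v in (-H)..H, k v * (K * G t v - B) ^ 2)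
          = ∫ v in (-H)..H, (K ^ 2 * (k v * G t v ^ 2) - 2 * K * B * (k v * G t v) + B ^ 2 * k v) :=
            intervalIntegral.integral_congr fun v _ => by ring
        _ = _ := by
          rw [intervalIntegral.integral_add (hi _ (by fun_prop)) (hi _ (by fun_prop)),
            intervalIntegral.integral_sub (hi _ (by fun_prop)) (hi _ (by fun_prop)),
            intervalIntegral.integral_const_mul, intervalIntegral.integral_const_mul,
            intervalIntegral.integral_const_mul]
    rw [e] at h0
    have : 0 ≤ K * (K * (∫ v in (-H)..H, k v * G t v ^ 2) - B ^ 2) := by nlinarith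
    have := (mul_nonneg_iff_of_pos_left hK0).mp this
    linarith
  have hcont : Continuous (Function.uncurry fun t v => k v * G t v ^ 2) :=
    (hk.comp continuous_snd).mul (hG.pow 2)
  have hcont1 : Continuous (Function.uncurry fun t v => k v * G t v) :=
    (hk.comp continuous_snd).mul hG
  calc ∫ t in a..b, (∫ v in (-H)..H, k v * G t v) ^ 2
      ≤ ∫ t in a..b, K * ∫ v in (-H)..H, k v * G t v ^ 2 := by
        refine intervalIntegral.integral_mono_on hab ?_ ?_ fun t _ => hcs t
        · exact ((intervalIntegral.continuous_parametric_intervalIntegral_of_continuous' hcont1 _ _).pow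
            2).intervalIntegrable _ _
        · exact (continuous_const.mul (intervalIntegral.continuous_parametric_intervalIntegral_of_continuous'
            hcont _ _)).intervalIntegrable _ _
    _ = K * ∫ v in (-H)..H, k v * ∫ t in a..b, G t v ^ 2 := by
        rw [intervalIntegral.integral_const_mul, MeasureTheory.intervalIntegral_intervalIntegral_swap]
        · simp_rw [intervalIntegral.integral_const_mul]
        · exact (hcont.continuousOn.integrableOn_compact
            (isCompact_uIcc.prod isCompact_uIcc)).mono_set
            (Set.prod_mono Set.uIoc_subset_uIcc Set.uIoc_subset_uIcc)
    _ ≤ K * ∫ v in (-H)..H, k v * M := by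
        refine mul_le_mul_of_nonneg_left (intervalIntegral.integral_mono_on (by linarith) ?_ ?_
          fun v _ => mul_le_mul_of_nonneg_left (hM v) (hk0 v).le) hK0.le
        · refine (hk.mul ?_).intervalIntegrable _ _
          refine intervalIntegral.continuous_parametric_intervalIntegral_of_continuous' ?_ _ _
          exact (hG.comp continuous_swap).pow 2
        · exact (hk.mul continuous_const).intervalIntegrable _ _
    _ = K ^ 2 * M := by rw [intervalIntegral.integral_mul_const, ← hK]; ring

/-- The weight `L e^{-v²} / (1 + L|v|)`. -/
noncomputable def weight (L v : ℝ) : ℝ := L / (1 + L * |v|) * Real.exp (-v ^ 2)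

lemma weight_pos {L : ℝ} (hL : 0 < L) (v : ℝ) : 0 < weight L v := by
  unfold weight; positivity

lemma continuous_weight {L : ℝ} (hL : 0 < L) : Continuous (weight L) := by
  unfold weight
  refine (continuous_const.div (by fun_prop) fun v => ?_).mul (by fun_prop)
  positivity

lemma integral_weight_le {L H : ℝ} (hL : 1 ≤ L) (hH : 1 ≤ H) :
    ∫ v in (-H)..H, weight L v ≤ 2 * (1 + Real.log (1 + L)) := by
  have hL0 : 0 < L := by linarith
  have hc := continuous_weight hL0
  have hneg : ∫ v in (-H)..0, weight L v = ∫ v in 0..H, weight L v := by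
    have := intervalIntegral.integral_comp_neg (a := 0) (b := H) (weight L)
    rw [neg_zero] at this
    rw [← this]
    exact intervalIntegral.integral_congr fun v _ => by simp [weight]
  rw [← intervalIntegral.integral_add_adjacent_intervals (hc.intervalIntegrable (-H) 0)
    (hc.intervalIntegrable 0 H), hneg, ← two_mul]
  refine mul_le_mul_of_nonneg_left ?_ (by norm_num)
  rw [← intervalIntegral.integral_add_adjacent_intervals (hc.intervalIntegrable 0 1)
    (hc.intervalIntegrable 1 H), add_comm]
  refine add_le_add ?_ ?_
  · have hd : ∀ v : ℝ, HasDerivAt (fun v => -Real.exp (-v)) (Real.exp (-v)) v := fun v =>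
      ((hasDerivAt_neg v).exp.neg).congr_deriv (by ring)
    calc ∫ v in 1..H, weight L v ≤ ∫ v in 1..H, Real.exp (-v) := by
          refine intervalIntegral.integral_mono_on hH (hc.intervalIntegrable _ _)
            ((by fun_prop : Continuous fun v : ℝ => Real.exp (-v)).intervalIntegrable _ _) fun v hv => ?_
          unfold weight
          have h1 : L / (1 + L * |v|) ≤ 1 := by
            rw [abs_of_nonneg (by linarith [hv.1]), div_le_one (by nlinarith [hv.1])]
            nlinarith [hv.1]
          calc _ ≤ 1 * Real.exp (-v) := by
                gcongr
                nlinarith [hv.1]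
            _ = _ := one_mul _
      _ = Real.exp (-1) - Real.exp (-H) := by
          rw [intervalIntegral.integral_eq_sub_of_hasDerivAt (fun v _ => hd v)
            ((by fun_prop : Continuous fun v : ℝ => Real.exp (-v)).intervalIntegrable _ _)]
          ring
      _ ≤ 1 := by
          have := Real.exp_pos (-H)
          have : Real.exp (-1) ≤ 1 := Real.exp_le_one_iff.mpr (by norm_num)
          linarith
  · have hpos : ∀ v ∈ Set.uIcc (0:ℝ) 1, 0 < 1 + L * v := by
      intro v hv
      rw [Set.uIcc_of_le zero_le_one] at hv
      nlinarith [hv.1]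
    have hd : ∀ v ∈ Set.uIcc (0:ℝ) 1, HasDerivAt (fun v => Real.log (1 + L * v)) (L / (1 + L * v)) v :=
      fun v hv => (((hasDerivAt_id v).const_mul L).const_add 1 |>.log (hpos v hv).ne').congr_deriv
        (by simp)
    have hci : IntervalIntegrable (fun v => L / (1 + L * v)) volume 0 1 :=
      ContinuousOn.intervalIntegrable (continuousOn_const.div (by fun_prop) fun v hv => (hpos v hv).ne')
    calc ∫ v in 0..1, weight L v ≤ ∫ v in 0..1, L / (1 + L * v) := by
          refine intervalIntegral.integral_mono_on zero_le_one (hc.intervalIntegrable _ _) hci fun v hv => ?_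
          unfold weight
          rw [abs_of_nonneg hv.1]
          have : 0 ≤ L / (1 + L * v) := by have := hv.1; positivity
          exact mul_le_of_le_one_right this (Real.exp_le_one_iff.mpr (by nlinarith [sq_nonneg v]))
      _ = Real.log (1 + L) := by
          rw [intervalIntegral.integral_eq_sub_of_hasDerivAt hd hci]
          simp

lemma exists_norm_LFunction_sub_dirPoly_le (q : ℕ) [NeZero q] :
    ∃ C : ℝ, 0 ≤ C ∧ ∀ χ : DirichletCharacter ℂ q, ∀ s : ℂ, 3/2 ≤ s.re → ∀ N : ℕ,
      ‖DirichletCharacter.LFunction χ s - dirPoly (fun n => χ (n : ZMod q)) N s‖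
        ≤ C * ((N : ℝ) + 1) ^ (5/4 - s.re) := by
  have hsum : Summable fun n : ℕ => ((n : ℝ) + 1) ^ (-(5/4) : ℝ) := by
    have := (summable_nat_add_iff 1).mpr (Real.summable_nat_rpow.mpr (by norm_num : (-(5/4) : ℝ) < -1))
    simpa using this
  refine ⟨∑' n : ℕ, ((n : ℝ) + 1) ^ (-(5/4) : ℝ), tsum_nonneg fun n => by positivity,
    fun χ s hs N => ?_⟩
  have hs1 : 1 < s.re := by linarith
  rw [DirichletCharacter.LFunction_eq_LSeries χ hs1]
  have hS : LSeriesSummable (fun n : ℕ => χ (n : ZMod q)) s :=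
    DirichletCharacter.LSeriesSummable_of_one_lt_re χ hs1
  have h1 : dirPoly (fun n => χ (n : ZMod q)) N s
      = ∑ n ∈ Finset.range (N + 1), LSeries.term (fun n : ℕ => χ (n : ZMod q)) s n := by
    rw [Finset.sum_range_succ', LSeries.term_zero, add_zero, dirPoly, Finset.range_eq_Ico,
      Finset.sum_Ico_add' (fun n => LSeries.term (fun n : ℕ => χ (n : ZMod q)) s n) 0 N 1]
    refine Finset.sum_congr (by ext; simp) fun n hn => ?_
    rw [LSeries.term_of_ne_zero (by have := (Finset.mem_Icc.mp hn).1; omega), cpow_neg, div_eq_mul_inv]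
  have h2 := Summable.sum_add_tsum_nat_add (N + 1) hS
  rw [LSeries, ← h2, h1, add_sub_cancel_left]
  have h3 : HasSum (fun n : ℕ => ((N : ℝ) + 1) ^ (5/4 - s.re) * ((n : ℝ) + 1) ^ (-(5/4) : ℝ))
      (((N : ℝ) + 1) ^ (5/4 - s.re) * ∑' n : ℕ, ((n : ℝ) + 1) ^ (-(5/4) : ℝ)) :=
    hsum.hasSum.mul_left _
  rw [mul_comm]
  refine tsum_of_norm_bounded h3 fun n => ?_
  rw [LSeries.term_of_ne_zero (by omega), norm_div]
  have hn : (0 : ℝ) < ((n + (N + 1) : ℕ) : ℝ) := by positivity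
  have h4 : ‖((n + (N + 1) : ℕ) : ℂ) ^ s‖ = ((n + (N + 1) : ℕ) : ℝ) ^ s.re := by
    rw [← Complex.ofReal_natCast, Complex.norm_cpow_eq_rpow_re_of_pos hn]
  rw [h4]
  calc _ ≤ 1 / ((n + (N + 1) : ℕ) : ℝ) ^ s.re := by gcongr; exact χ.norm_le_one _
    _ = ((n + (N + 1) : ℕ) : ℝ) ^ (5/4 - s.re) * ((n + (N + 1) : ℕ) : ℝ) ^ (-(5/4) : ℝ) := by
      rw [← Real.rpow_add hn, one_div, ← Real.rpow_neg hn.le]; congr 1; ring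
    _ ≤ _ := by
      refine mul_le_mul ?_ ?_ (by positivity) (by positivity)
      · refine Real.rpow_le_rpow_of_nonpos (by positivity) ?_ (by linarith)
        push_cast; linarith [Nat.cast_nonneg (α := ℝ) n]
      · refine Real.rpow_le_rpow_of_nonpos (by positivity) ?_ (by norm_num)
        push_cast; linarith [Nat.cast_nonneg (α := ℝ) N]

lemma norm_natCast_cpow_neg {n : ℕ} (hn : n ≠ 0) (s : ℂ) : ‖(n : ℂ) ^ (-s)‖ = (n : ℝ) ^ (-s.re) := by
  rw [← Complex.ofReal_natCast, Complex.norm_cpow_eq_rpow_re_of_pos (by positivity), neg_re]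

lemma norm_dirPoly_le_of_nonneg {c : ℕ → ℂ} (hc : ∀ n, ‖c n‖ ≤ 1) (N : ℕ) {s : ℂ} (hs : 0 ≤ s.re) :
    ‖dirPoly c N s‖ ≤ N := by
  calc ‖dirPoly c N s‖ ≤ ∑ n ∈ Finset.Icc 1 N, (1 : ℝ) := by
        refine norm_sum_le_of_le _ fun n hn => ?_
        have hn1 := (Finset.mem_Icc.mp hn).1
        rw [norm_mul, norm_natCast_cpow_neg (by omega)]
        refine mul_le_one₀ (hc n) (by positivity) ?_
        exact Real.rpow_le_one_of_one_le_of_nonpos (by exact_mod_cast hn1) (by linarith)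
    _ = N := by simp

lemma norm_dirPoly_le_sq {c : ℕ → ℂ} (hc : ∀ n, ‖c n‖ ≤ 1) (N : ℕ) {s : ℂ} (hs : -1 ≤ s.re) :
    ‖dirPoly c N s‖ ≤ (N : ℝ) ^ 2 := by
  calc ‖dirPoly c N s‖ ≤ ∑ n ∈ Finset.Icc 1 N, (N : ℝ) := by
        refine norm_sum_le_of_le _ fun n hn => ?_
        have hn1 := Finset.mem_Icc.mp hn
        have hn0 : (1 : ℝ) ≤ n := by exact_mod_cast hn1.1
        rw [norm_mul, norm_natCast_cpow_neg (by omega)]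
        have h1 : (n : ℝ) ^ (-s.re) ≤ N := by
          calc (n : ℝ) ^ (-s.re) ≤ (n : ℝ) ^ (1 : ℝ) :=
                Real.rpow_le_rpow_of_exponent_le hn0 (by linarith)
            _ = n := Real.rpow_one _
            _ ≤ N := by exact_mod_cast hn1.2
        calc _ ≤ 1 * (n : ℝ) ^ (-s.re) := by gcongr; exact hc n
          _ ≤ _ := by rw [one_mul]; exact h1
    _ = (N : ℝ) ^ 2 := by simp [sq]

lemma differentiable_dirPoly (c : ℕ → ℂ) (N : ℕ) : Differentiable ℂ (dirPoly c N) := by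
  unfold dirPoly
  refine Differentiable.fun_sum fun n hn => ?_
  have hn1 := (Finset.mem_Icc.mp hn).1
  have h0 : (n : ℂ) ≠ 0 := by exact_mod_cast (by omega : n ≠ 0)
  exact (differentiable_const _).mul (differentiable_id.neg.const_cpow (Or.inl h0))

lemma dirPoly_add (c : ℕ → ℂ) (N : ℕ) (s w : ℂ) :
    dirPoly c N (s + w) = dirPoly (fun n => c n * (n : ℂ) ^ (-w)) N s := by
  refine Finset.sum_congr rfl fun n hn => ?_
  have hn1 := (Finset.mem_Icc.mp hn).1
  have h0 : (n : ℂ) ≠ 0 := by exact_mod_cast (by omega : n ≠ 0)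
  rw [neg_add, cpow_add _ _ h0]; ring

lemma mul_dirPoly (a : ℂ) (c : ℕ → ℂ) (N : ℕ) (s : ℂ) :
    a * dirPoly c N s = dirPoly (fun n => a * c n) N s := by
  rw [dirPoly, Finset.mul_sum]
  exact Finset.sum_congr rfl fun n _ => by ring

lemma norm_cexp_sq (c v : ℝ) : ‖Complex.exp ((c + v * I) ^ 2)‖ = Real.exp (c ^ 2 - v ^ 2) := by
  rw [Complex.norm_exp]
  congr 1
  simp [sq]

lemma norm_cexp_sq' (w : ℂ) : ‖Complex.exp (w ^ 2)‖ = Real.exp (w.re ^ 2 - w.im ^ 2) := by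
  rw [Complex.norm_exp]
  congr 1
  simp [sq]

/-- Bound for the kernel `e^{w²} / w` on a vertical line. -/
lemma norm_cexp_sq_div_le {c L : ℝ} (hc : |c| ≤ 1) (hL : 0 < L) (hcL : 1 ≤ L * |c|) (v : ℝ) :
    ‖Complex.exp ((c + v * I) ^ 2) / (c + v * I)‖ ≤ 6 * weight L v := by
  have h0 : 0 < |c| := by
    by_contra h
    have : |c| = 0 := le_antisymm (not_lt.mp h) (abs_nonneg c)
    rw [this] at hcL; norm_num at hcL
  rw [norm_div, norm_cexp_sq, weight]
  have h1 : |c| ≤ ‖(c + v * I : ℂ)‖ := by simpa using Complex.abs_re_le_norm (c + v * I : ℂ)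
  have h2 : |v| ≤ ‖(c + v * I : ℂ)‖ := by simpa using Complex.abs_im_le_norm (c + v * I : ℂ)
  have hpos : 0 < ‖(c + v * I : ℂ)‖ := h0.trans_le h1
  have h3 : 1 + L * |v| ≤ 2 * (L * ‖(c + v * I : ℂ)‖) := by
    have := mul_le_mul_of_nonneg_left h1 hL.le
    have := mul_le_mul_of_nonneg_left h2 hL.le
    linarith
  have h4 : Real.exp (c ^ 2 - v ^ 2) ≤ 3 * Real.exp (-v ^ 2) := by
    rw [sub_eq_add_neg, Real.exp_add]
    gcongr
    have : c ^ 2 ≤ 1 := by rw [← sq_abs]; exact pow_le_one₀ (abs_nonneg c) hc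
    exact (Real.exp_le_exp.mpr this).trans (by linarith [Real.exp_one_lt_d9])
  have h5 : 1 / ‖(c + v * I : ℂ)‖ ≤ 2 * (L / (1 + L * |v|)) := by
    rw [← mul_div_assoc, div_le_div_iff₀ hpos (by positivity)]
    linarith
  calc _ = Real.exp (c ^ 2 - v ^ 2) * (1 / ‖(c + v * I : ℂ)‖) := by rw [mul_one_div]
    _ ≤ (3 * Real.exp (-v ^ 2)) * (2 * (L / (1 + L * |v|))) := by gcongr
    _ = _ := by ring

lemma norm_ofReal_cpow {x : ℝ} (hx : 0 < x) (w : ℂ) : ‖(x : ℂ) ^ w‖ = x ^ w.re :=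
  Complex.norm_cpow_eq_rpow_re_of_pos hx w

lemma differentiable_ofReal_cpow {x : ℝ} (hx : 0 < x) : Differentiable ℂ fun w : ℂ => (x : ℂ) ^ w :=
  differentiable_id.const_cpow (Or.inl (by exact_mod_cast hx.ne'))

lemma norm_integral_le_weight {F : ℝ → ℂ} {H D : ℝ} (hH : 1 ≤ H)
    (hF : ∀ v, |v| ≤ H → ‖F v‖ ≤ D * weight 1 v) (hD : 0 ≤ D) :
    ‖∫ v in (-H)..H, F v‖ ≤ 4 * D := by
  have hc : Continuous fun v => D * weight 1 v := continuous_const.mul (continuous_weight one_pos)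
  refine (intervalIntegral.norm_integral_le_of_norm_le (by linarith) ?_
    (hc.intervalIntegrable _ _)).trans ?_
  · exact Eventually.of_forall fun v hv => hF v (abs_le.mpr ⟨hv.1.le, hv.2⟩)
  · rw [intervalIntegral.integral_const_mul]
    have h1 := integral_weight_le le_rfl hH
    have h2 : Real.log (1 + 1) ≤ 1 := by
      have := Real.log_two_lt_d9; norm_num; linarith
    have h3 : ∫ v in (-H)..H, weight 1 v ≤ 4 := by linarith
    nlinarith

lemma norm_integral_right_tail_le {q : ℕ} [NeZero q] (χ : DirichletCharacter ℂ q) {C₀ : ℝ}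
    (hC₀ : ∀ s : ℂ, 3/2 ≤ s.re → ∀ N : ℕ, ‖DirichletCharacter.LFunction χ s -
      dirPoly (fun n => χ (n : ZMod q)) N s‖ ≤ C₀ * ((N : ℝ) + 1) ^ (5/4 - s.re))
    {s : ℂ} (hs : s.re = 1/2) {A x H : ℝ} (hA : 1 ≤ A) (hx : 0 < x) (hH : 0 ≤ H) (N : ℕ) :
    ‖∫ v in (-H)..H, (DirichletCharacter.LFunction χ (s + (A + v * I)) -
        dirPoly (fun n => χ (n : ZMod q)) N (s + (A + v * I))) * (x : ℂ) ^ (A + v * I : ℂ) *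
        Complex.exp ((A + v * I) ^ 2) / (A + v * I)‖
      ≤ 2 * H * (C₀ * ((N : ℝ) + 1) ^ (3/4 - A) * x ^ A * Real.exp (A ^ 2)) := by
  refine (intervalIntegral.norm_integral_le_of_norm_le_const
    (C := C₀ * ((N : ℝ) + 1) ^ (3/4 - A) * x ^ A * Real.exp (A ^ 2)) fun v hv => ?_).trans_eq ?_
  · have hre : (s + (A + v * I)).re = 1/2 + A := by simp [hs]
    have h1 := hC₀ (s + (A + v * I)) (by rw [hre]; linarith) N
    rw [hre, show (5/4 - (1/2 + A) : ℝ) = 3/4 - A by ring] at h1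
    rw [norm_div, norm_mul, norm_mul, norm_cexp_sq, norm_ofReal_cpow hx]
    have h2 : ((A : ℂ) + v * I).re = A := by simp
    have h3 : (1 : ℝ) ≤ ‖(A + v * I : ℂ)‖ := by
      have := Complex.re_le_norm (A + v * I : ℂ)
      rw [h2] at this; linarith
    rw [h2]
    refine (div_le_self (by positivity) h3).trans ?_
    have h4 : Real.exp (A ^ 2 - v ^ 2) ≤ Real.exp (A ^ 2) := Real.exp_le_exp.mpr (by nlinarith [sq_nonneg v])
    have h5 := (norm_nonneg _).trans h1
    gcongr
  · rw [abs_of_nonneg (by linarith)]; ring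

lemma norm_integral_right_main_le {c : ℕ → ℂ} (hc : ∀ n, ‖c n‖ ≤ 1) {s : ℂ} (hs : 0 ≤ s.re)
    {A x H δ : ℝ} (hx : 1 ≤ x) (hH : 1 ≤ H) (hδ : 0 < δ) (hδ1 : δ ≤ 1) (hδA : δ ≤ A) (N : ℕ) :
    ‖∫ v in (-H)..H, dirPoly c N (s + (A + v * I)) * (x : ℂ) ^ (A + v * I : ℂ) *
        Complex.exp ((A + v * I) ^ 2) / (A + v * I)‖
      ≤ (∫ v in (-H)..H, 6 * (weight δ⁻¹ v *
          ‖dirPoly (fun n => (x : ℂ) ^ (δ + v * I : ℂ) * (c n * (n : ℂ) ^ (-(δ + v * I : ℂ)))) N s‖)) +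
        2 * (N * x ^ A * Real.exp (A ^ 2 - H ^ 2)) * (A - δ) := by
  set f : ℂ → ℂ := fun w => dirPoly c N (s + w) * (x : ℂ) ^ w * Complex.exp (w ^ 2) / w with hf
  have hx0 : 0 < x := by linarith
  have hdp := differentiable_dirPoly c N
  have hxd := differentiable_ofReal_cpow hx0
  have h1 := norm_integral_vertical_sub_le (f := f) (M := N * x ^ A * Real.exp (A ^ 2 - H ^ 2))
    (H := H) hδA (by linarith)
    (by
      intro w h1 _ _
      have hw : w ≠ 0 := by rintro rfl; simp at h1; linarith
      refine DifferentiableAt.div ?_ differentiableAt_id hw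
      refine ((hdp.comp (differentiable_id.const_add s)).mul hxd).mul ?_ |>.differentiableAt
      exact (differentiable_id.pow 2).cexp)
    (by
      intro w h1 h2 h3
      have h4 : (1 : ℝ) ≤ ‖w‖ := by
        have := Complex.abs_im_le_norm w; rw [h3] at this; linarith
      rw [hf]; simp only
      rw [norm_div, norm_mul, norm_mul, norm_cexp_sq', norm_ofReal_cpow hx0]
      refine (div_le_self (by positivity) h4).trans ?_
      have h5 := Real.rpow_le_rpow_of_exponent_le hx h2
      have h6 : Real.exp (w.re ^ 2 - w.im ^ 2) ≤ Real.exp (A ^ 2 - H ^ 2) := by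
        rw [← sq_abs w.im, h3]
        exact Real.exp_le_exp.mpr (by nlinarith)
      have h7 : ‖dirPoly c N (s + w)‖ ≤ N :=
        norm_dirPoly_le_of_nonneg hc N (by rw [add_re]; linarith)
      gcongr)
  have h2 : ‖∫ v in (-H)..H, f (δ + v * I)‖ ≤ ∫ v in (-H)..H, 6 * (weight δ⁻¹ v *
          ‖dirPoly (fun n => (x : ℂ) ^ (δ + v * I : ℂ) * (c n * (n : ℂ) ^ (-(δ + v * I : ℂ)))) N s‖) := by
    refine intervalIntegral.norm_integral_le_of_norm_le (by linarith)
      (Eventually.of_forall fun v hv => ?_) ?_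
    · rw [hf]; simp only
      rw [mul_div_assoc, norm_mul, dirPoly_add, mul_comm (dirPoly _ _ _), mul_dirPoly, mul_comm,
        ← mul_assoc]
      refine mul_le_mul_of_nonneg_right ?_ (norm_nonneg _)
      exact norm_cexp_sq_div_le (by rw [abs_of_pos hδ]; exact hδ1) (by positivity)
        (by rw [abs_of_pos hδ, inv_mul_cancel₀ hδ.ne']) v
    · apply Continuous.intervalIntegrable
      refine continuous_const.mul ((continuous_weight (by positivity)).mul (Continuous.norm ?_))
      have e : ∀ v : ℝ, dirPoly (fun n => (x : ℂ) ^ (δ + v * I : ℂ) * (c n * (n : ℂ) ^ (-(δ + v * I : ℂ)))) N s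
          = (x : ℂ) ^ (δ + v * I : ℂ) * dirPoly c N (s + (δ + v * I)) := fun v => by
        rw [dirPoly_add, mul_dirPoly]
      simp_rw [e]
      exact (hxd.continuous.comp (by fun_prop)).mul (hdp.continuous.comp (by fun_prop))
  calc _ = ‖(∫ v in (-H)..H, f (δ + v * I)) + ((∫ v in (-H)..H, f (A + v * I)) -
        ∫ v in (-H)..H, f (δ + v * I))‖ := by rw [add_sub_cancel]
    _ ≤ _ := (norm_add_le _ _).trans (add_le_add h2 h1)

lemma norm_integral_left_dirPoly_le (c : ℕ → ℂ) (s : ℂ) {x H : ℝ} (hx : 0 < x) (hH : 1 ≤ H) (N : ℕ) :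
    ‖∫ v in (-H)..H, dirPoly c N (s + ((-1 : ℝ) + v * I)) * (x : ℂ) ^ ((-1 : ℝ) + v * I : ℂ) *
        Complex.exp (((-1 : ℝ) + v * I) ^ 2) / ((-1 : ℝ) + v * I)‖
      ≤ ∫ v in (-H)..H, 6 * (weight 1 v * ‖dirPoly (fun n => (x : ℂ) ^ ((-1 : ℝ) + v * I : ℂ) *
          (c n * (n : ℂ) ^ (-((-1 : ℝ) + v * I : ℂ)))) N s‖) := by
  refine intervalIntegral.norm_integral_le_of_norm_le (by linarith)
    (Eventually.of_forall fun v hv => ?_) ?_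
  · rw [mul_div_assoc, norm_mul, dirPoly_add, mul_comm (dirPoly _ _ _), mul_dirPoly, mul_comm,
        ← mul_assoc]
    refine mul_le_mul_of_nonneg_right ?_ (norm_nonneg _)
    exact norm_cexp_sq_div_le (by simp) (by positivity) (by simp) v
  · apply Continuous.intervalIntegrable
    refine continuous_const.mul ((continuous_weight (by positivity)).mul (Continuous.norm ?_))
    have e : ∀ v : ℝ, dirPoly (fun n => (x : ℂ) ^ ((-1 : ℝ) + v * I : ℂ) *
          (c n * (n : ℂ) ^ (-((-1 : ℝ) + v * I : ℂ)))) N s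
        = (x : ℂ) ^ ((-1 : ℝ) + v * I : ℂ) * dirPoly c N (s + ((-1 : ℝ) + v * I)) := fun v => by
      rw [dirPoly_add, mul_dirPoly]
    simp_rw [e]
    exact ((differentiable_ofReal_cpow hx).continuous.comp (by fun_prop)).mul
      ((differentiable_dirPoly c N).continuous.comp (by fun_prop))

lemma differentiableAt_feFactor {q : ℕ} [NeZero q] (χ : DirichletCharacter ℂ q) {z : ℂ}
    (hz : z.im ≠ 0) : DifferentiableAt ℂ (feFactor χ) z := by
  obtain ⟨κ, -, hg, -⟩ := exists_gammaFactor_eq χ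
  have hq : (q : ℂ) ≠ 0 := by exact_mod_cast NeZero.ne q
  unfold feFactor
  simp_rw [hg]
  refine DifferentiableAt.mul (DifferentiableAt.mul ?_ (differentiableAt_const _)) (DifferentiableAt.mul ?_ ?_)
  · exact (differentiableAt_id.const_sub _).const_cpow (Or.inl hq)
  · have h1 : (Gammaℝ (1 - z + κ))⁻¹ ≠ 0 := by
      rw [Ne, inv_eq_zero, Gammaℝ_eq_zero_iff]
      rintro ⟨n, h⟩
      have := congrArg Complex.im h
      simp at this
      exact hz this
    have h2 := (differentiable_Gammaℝ_inv (1 - z + κ)).inv h1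
    simp only [Pi.inv_def, inv_inv] at h2
    exact h2.comp z ((differentiableAt_id.const_sub _).add_const _)
  · exact (differentiable_Gammaℝ_inv.comp (differentiable_id.add_const (κ : ℂ))) z

lemma dirPoly_inv_conj {q : ℕ} [NeZero q] (χ : DirichletCharacter ℂ q) (N : ℕ) (z : ℂ) :
    dirPoly (fun n => χ⁻¹ (n : ZMod q)) N ((starRingEnd ℂ) z)
      = (starRingEnd ℂ) (dirPoly (fun n => χ (n : ZMod q)) N z) := by
  rw [dirPoly, dirPoly, map_sum]
  refine Finset.sum_congr rfl fun n _ => ?_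
  rw [map_mul, ← map_neg, Complex.cpow_conj _ _ (by rw [natCast_arg]; exact Real.pi_ne_zero.symm),
    Complex.conj_natCast, ← MulChar.star_apply']
  rfl

/-- The entire kernel `(x₁^w - x₂^w) / w`. -/
noncomputable def diffKernel (x₁ x₂ : ℝ) : ℂ → ℂ :=
  dslope (fun w : ℂ => (x₁ : ℂ) ^ w - (x₂ : ℂ) ^ w) 0

lemma differentiable_diffKernel {x₁ x₂ : ℝ} (h1 : 0 < x₁) (h2 : 0 < x₂) :
    Differentiable ℂ (diffKernel x₁ x₂) := by
  have h := (differentiable_ofReal_cpow h1).sub (differentiable_ofReal_cpow h2)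
  rw [← differentiableOn_univ]
  exact (Complex.differentiableOn_dslope Filter.univ_mem).mpr h.differentiableOn

lemma diffKernel_of_ne (x₁ x₂ : ℝ) {w : ℂ} (hw : w ≠ 0) :
    diffKernel x₁ x₂ w = ((x₁ : ℂ) ^ w - (x₂ : ℂ) ^ w) / w := by
  rw [diffKernel, dslope_of_ne _ hw, slope_def_field]
  simp

lemma norm_diffKernel_le {x₁ x₂ L : ℝ} (h1 : 0 < x₁) (h2 : 0 < x₂) (hL : 0 < L)
    (hx : |Real.log x₁ - Real.log x₂| ≤ L) (v : ℝ) :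
    ‖diffKernel x₁ x₂ ((0 : ℝ) + v * I)‖ ≤ 3 * (L / (1 + L * |v|)) := by
  have key : ‖diffKernel x₁ x₂ ((0 : ℝ) + v * I)‖ ≤ L ∧
      ‖diffKernel x₁ x₂ ((0 : ℝ) + v * I)‖ * |v| ≤ 2 := by
    rw [ofReal_zero, zero_add]
    rcases eq_or_ne v 0 with rfl | hv
    · have hx1 : (x₁ : ℂ) ≠ 0 := by exact_mod_cast h1.ne'
      have hx2 : (x₂ : ℂ) ≠ 0 := by exact_mod_cast h2.ne'
      have hd := ((hasDerivAt_id (0 : ℂ)).const_cpow (c := (x₁ : ℂ)) (Or.inl hx1)).sub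
        ((hasDerivAt_id (0 : ℂ)).const_cpow (c := (x₂ : ℂ)) (Or.inl hx2))
      have e : diffKernel x₁ x₂ ((0 : ℝ) * I) = ((Real.log x₁ - Real.log x₂ : ℝ) : ℂ) := by
        rw [ofReal_zero, zero_mul, diffKernel, dslope_same]
        refine hd.deriv.trans ?_
        simp [Complex.ofReal_log h1.le, Complex.ofReal_log h2.le]
      rw [e, Complex.norm_real]
      exact ⟨hx, by simp⟩
    · have hvI : (v * I : ℂ) ≠ 0 := by simp [hv]
      have hv0 : 0 < |v| := abs_pos.mpr hv
      have hnv : ‖(v * I : ℂ)‖ = |v| := by simp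
      rw [diffKernel_of_ne _ _ hvI, norm_div, hnv]
      have hre : (v * I : ℂ).re = 0 := by simp
      have n1 : ‖(x₁ : ℂ) ^ (v * I : ℂ)‖ = 1 := by rw [norm_ofReal_cpow h1, hre, Real.rpow_zero]
      have n2 : ‖(x₂ : ℂ) ^ (v * I : ℂ)‖ = 1 := by rw [norm_ofReal_cpow h2, hre, Real.rpow_zero]
      constructor
      · rw [div_le_iff₀ hv0]
        have e : (x₁ : ℂ) ^ (v * I : ℂ) - (x₂ : ℂ) ^ (v * I : ℂ) = (x₂ : ℂ) ^ (v * I : ℂ) *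
            (Complex.exp (I * ((v * (Real.log x₁ - Real.log x₂) : ℝ) : ℂ)) - 1) := by
          rw [mul_sub, mul_one, cpow_def_of_ne_zero (by exact_mod_cast h1.ne'),
            cpow_def_of_ne_zero (by exact_mod_cast h2.ne'), ← Complex.exp_add,
            ← Complex.ofReal_log h1.le, ← Complex.ofReal_log h2.le]
          congr 2
          push_cast; ring
        rw [e, norm_mul, n2, one_mul]
        refine Real.norm_exp_I_mul_ofReal_sub_one_le.trans ?_
        rw [Real.norm_eq_abs, abs_mul, mul_comm]
        gcongr
      · rw [div_mul_cancel₀ _ hv0.ne']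
        refine (norm_sub_le _ _).trans ?_
        rw [n1, n2]; norm_num
  rw [← mul_div_assoc, le_div_iff₀ (by positivity)]
  nlinarith [key.1, key.2]

lemma continuousOn_vertical {f : ℂ → ℂ} {c H : ℝ} 
    (hf : ∀ w : ℂ, w.re = c → |w.im| ≤ H → DifferentiableAt ℂ f w) :
    ContinuousOn (fun v : ℝ => f (c + v * I)) (Set.Icc (-H) H) := by
  intro v hv
  have := (hf (c + v * I) (by simp) (by simpa using abs_le.mpr hv)).continuousAt
  exact (ContinuousAt.comp (f := fun v : ℝ => (c + v * I : ℂ)) this (by fun_prop)).continuousWithinAt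

lemma norm_integral_left_LFunction_le {q : ℕ} [NeZero q] {χ : DirichletCharacter ℂ q}
    (hχ : χ.IsPrimitive) {C₀ C₂ : ℝ}
    (hC₀ : ∀ χ : DirichletCharacter ℂ q, ∀ s : ℂ, 3/2 ≤ s.re → ∀ N : ℕ,
      ‖DirichletCharacter.LFunction χ s - dirPoly (fun n => χ (n : ZMod q)) N s‖
        ≤ C₀ * ((N : ℝ) + 1) ^ (5/4 - s.re))
    (hC₀' : 0 ≤ C₀) (hC₂' : 0 ≤ C₂)
    (hC₂ : (∀ u : ℝ, ‖feFactor χ (1/2 + u * Complex.I)‖ ≤ C₂) ∧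
      (∀ u : ℝ, ‖feFactor χ (-(1/2) + u * Complex.I)‖ ≤ C₂ * (1 + |u|)) ∧
      (∀ z : ℂ, -(1/2) ≤ z.re → z.re ≤ 1/2 → 1 ≤ |z.im| →
        ‖feFactor χ z‖ ≤ C₂ * Real.exp (2 * |z.im|)))
    {T t x₁ x₂ L : ℝ} (hT : 4 ≤ T) (ht : T ≤ t) (ht' : t ≤ 2 * T) (hx₁ : 1 ≤ x₁) (hx₂ : 1 ≤ x₂)
    (hL : 0 < L) (hxL : |Real.log x₁ - Real.log x₂| ≤ L) (y : ℕ) :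
    ‖∫ v in (-(T/2))..(T/2), DirichletCharacter.LFunction χ (1/2 + t * I + ((-1 : ℝ) + v * I)) *
        (x₁ : ℂ) ^ ((-1 : ℝ) + v * I : ℂ) * Complex.exp (((-1 : ℝ) + v * I) ^ 2) / ((-1 : ℝ) + v * I)‖
      ≤ (∫ v in (-(T/2))..(T/2), 3 * C₂ * (weight L v *
          ‖dirPoly (fun n => χ (n : ZMod q) * (n : ℂ) ^ (-(v * I : ℂ))) y (1/2 + t * I)‖)) +
        4 * (24 * C₂ * C₀ * T * (((y : ℝ) + 1) ^ (-(1/4) : ℝ) * x₁⁻¹ + 2 * x₂⁻¹)) +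
        4 * C₂ * y * Real.exp (5 * T + 1 - T ^ 2 / 4) := by
  set s : ℂ := 1/2 + t * I with hs
  set H : ℝ := T / 2 with hH
  have hre : s.re = 1 / 2 := by simp [hs]
  have him : s.im = t := by simp [hs]
  have hx₁0 : 0 < x₁ := by linarith
  have hx₂0 : 0 < x₂ := by linarith
  set D : ℂ → ℂ := dirPoly (fun n => χ⁻¹ (n : ZMod q)) y with hD
  have hDd : Differentiable ℂ D := differentiable_dirPoly _ _
  set h : ℂ → ℂ := fun w => feFactor χ (s + w) * D (1 - (s + w)) * diffKernel x₁ x₂ w *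
    Complex.exp (w ^ 2) with hh
  set g : ℂ → ℂ := fun w => DirichletCharacter.LFunction χ (s + w) *
        (x₁ : ℂ) ^ w * Complex.exp (w ^ 2) / w with hg
  have himw : ∀ w : ℂ, |w.im| ≤ H → 2 ≤ (s + w).im ∧ (s + w).im ≤ 5 / 2 * T := by
    intro w hw
    rw [add_im, him]
    have := abs_le.mp hw
    constructor <;> linarith [this.1, this.2]
  have hhd : ∀ w : ℂ, |w.im| ≤ H → DifferentiableAt ℂ h w := by
    intro w hw
    have h1 : (s + w).im ≠ 0 := by have := (himw w hw).1; linarith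
    have h2 : DifferentiableAt ℂ (fun w => feFactor χ (s + w)) w :=
      (differentiableAt_feFactor χ h1).comp w (differentiableAt_id.const_add s)
    exact ((h2.mul (hDd.comp ((differentiable_id.const_add s).const_sub 1) w)).mul
      (differentiable_diffKernel hx₁0 hx₂0 w)).mul ((differentiableAt_id.pow 2).cexp)
  have hgd : ∀ w : ℂ, w.re = -1 → |w.im| ≤ H → DifferentiableAt ℂ g w := by
    intro w hw hw'
    have h1 : s + w ≠ 1 := by
      intro h
      have := congrArg Complex.im h
      rw [one_im] at this
      linarith [(himw w hw').1]
    have hw0 : w ≠ 0 := by rintro rfl; simp at hw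
    have h2 : DifferentiableAt ℂ (fun w => DirichletCharacter.LFunction χ (s + w)) w :=
      (DirichletCharacter.differentiableAt_LFunction χ (s + w) (Or.inl h1)).comp w
        (differentiableAt_id.const_add s)
    exact ((h2.mul (differentiable_ofReal_cpow hx₁0 w)).mul ((differentiableAt_id.pow 2).cexp)).div
      differentiableAt_id hw0
  -- the shifted integral
  have hshift := norm_integral_vertical_sub_le (f := h) (a := -1) (b := 0) (H := H)
    (M := 2 * C₂ * y * Real.exp (5 * T + 1 - T ^ 2 / 4)) (by norm_num) (by linarith)
    (fun w _ _ hw => hhd w hw) (by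
      intro w h1 h2 h3
      have hi := himw w h3.le
      have h4 : (1 : ℝ) ≤ ‖w‖ := by
        have := Complex.abs_im_le_norm w; rw [h3] at this; linarith
      have hw0 : w ≠ 0 := by rintro rfl; simp at h4; linarith
      have b1 : ‖feFactor χ (s + w)‖ ≤ C₂ * Real.exp (5 * T) := by
        refine (hC₂.2.2 (s + w) (by rw [add_re, hre]; linarith) (by rw [add_re, hre]; linarith)
          (by rw [abs_of_nonneg (by linarith)]; linarith)).trans ?_
        rw [abs_of_nonneg (by linarith)]
        exact mul_le_mul_of_nonneg_left (Real.exp_le_exp.mpr (by linarith)) hC₂'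
      have b2 : ‖D (1 - (s + w))‖ ≤ y :=
        norm_dirPoly_le_of_nonneg (fun n => χ⁻¹.norm_le_one _) y (by
          rw [sub_re, add_re, hre, one_re]; linarith)
      have b3 : ‖diffKernel x₁ x₂ w‖ ≤ 2 := by
        rw [diffKernel_of_ne _ _ hw0, norm_div]
        refine (div_le_self (norm_nonneg _) h4).trans ((norm_sub_le _ _).trans ?_)
        rw [norm_ofReal_cpow hx₁0, norm_ofReal_cpow hx₂0]
        have := Real.rpow_le_one_of_one_le_of_nonpos hx₁ h2
        have := Real.rpow_le_one_of_one_le_of_nonpos hx₂ h2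
        linarith
      have b4 : ‖Complex.exp (w ^ 2)‖ ≤ Real.exp (1 - T ^ 2 / 4) := by
        rw [norm_cexp_sq', ← sq_abs w.im, h3]
        refine Real.exp_le_exp.mpr ?_
        have : H ^ 2 = T ^ 2 / 4 := by rw [hH]; ring
        nlinarith
      rw [hh]; simp only
      rw [norm_mul, norm_mul, norm_mul]
      calc _ ≤ C₂ * Real.exp (5 * T) * y * 2 * Real.exp (1 - T ^ 2 / 4) := by gcongr
        _ = _ := by
          rw [show 5 * T + 1 - T ^ 2 / 4 = 5 * T + (1 - T ^ 2 / 4) by ring, Real.exp_add]; ring)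
  have hzero : ‖∫ v in (-H)..H, h ((0 : ℝ) + v * I)‖ ≤ ∫ v in (-H)..H, 3 * C₂ * (weight L v *
          ‖dirPoly (fun n => χ (n : ZMod q) * (n : ℂ) ^ (-(v * I : ℂ))) y s‖) := by
    refine intervalIntegral.norm_integral_le_of_norm_le (by linarith)
      (Eventually.of_forall fun v hv => ?_) ?_
    · have b1 : ‖feFactor χ (s + ((0 : ℝ) + v * I))‖ ≤ C₂ := by
        have := hC₂.1 (t + v)
        rwa [show (1/2 + ((t + v : ℝ) : ℂ) * I : ℂ) = s + ((0 : ℝ) + v * I) by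
          rw [hs]; push_cast; ring] at this
      have b2 : ‖D (1 - (s + ((0 : ℝ) + v * I)))‖ =
          ‖dirPoly (fun n => χ (n : ZMod q) * (n : ℂ) ^ (-(v * I : ℂ))) y s‖ := by
        rw [← dirPoly_add, ← RCLike.norm_conj (dirPoly _ y (s + v * I)), ← dirPoly_inv_conj, hD]
        congr 2
        rw [hs]
        simp only [map_add, map_mul, Complex.conj_ofReal, Complex.conj_I, map_div₀, map_one, map_ofNat]
        push_cast; ring
      have b3 := norm_diffKernel_le hx₁0 hx₂0 hL hxL v
      have b4 := norm_cexp_sq 0 v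
      rw [hh]; simp only
      rw [norm_mul, norm_mul, norm_mul, b2, b4, weight]
      calc _ ≤ C₂ * ‖dirPoly (fun n => χ (n : ZMod q) * (n : ℂ) ^ (-(v * I : ℂ))) y s‖ *
            (3 * (L / (1 + L * |v|))) * Real.exp (0 ^ 2 - v ^ 2) := by gcongr
        _ = _ := by rw [show (0 : ℝ) ^ 2 - v ^ 2 = -v ^ 2 by ring]; ring
    · apply Continuous.intervalIntegrable
      refine continuous_const.mul ((continuous_weight hL).mul (Continuous.norm ?_))
      simp_rw [← dirPoly_add]
      exact (differentiable_dirPoly _ y).continuous.comp (by fun_prop)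
  have hsmall : ‖∫ v in (-H)..H, (g ((-1 : ℝ) + v * I) - h ((-1 : ℝ) + v * I))‖ ≤
      4 * (24 * C₂ * C₀ * T * (((y : ℝ) + 1) ^ (-(1/4) : ℝ) * x₁⁻¹ + 2 * x₂⁻¹)) := by
    refine norm_integral_le_weight (by linarith) (fun v hv => ?_) (by positivity)
    set w : ℂ := (-1 : ℝ) + v * I with hw
    have hwre : w.re = -1 := by simp [hw]
    have hwim : w.im = v := by simp [hw]
    have hw0 : w ≠ 0 := by intro h; rw [h] at hwre; norm_num at hwre
    have hi := himw w (by rw [hwim]; exact hv)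
    have e : g w - h w = feFactor χ (s + w) * ((DirichletCharacter.LFunction χ⁻¹ (1 - (s + w)) -
        D (1 - (s + w))) * (x₁ : ℂ) ^ w + D (1 - (s + w)) * (x₂ : ℂ) ^ w) *
        (Complex.exp (w ^ 2) / w) := by
      rw [hg, hh]; simp only
      rw [LFunction_eq_feFactor_mul hχ (by linarith : (s + w).im ≠ 0), diffKernel_of_ne _ _ hw0]
      field_simp
      ring
    have hre2 : (1 - (s + w)).re = 3 / 2 := by
      rw [sub_re, add_re, hre, hwre, one_re]; norm_num
    have b1 : ‖feFactor χ (s + w)‖ ≤ C₂ * (4 * T) := by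
      have := hC₂.2.1 (t + v)
      rw [show (-(1/2) + ((t + v : ℝ) : ℂ) * I : ℂ) = s + w by
          rw [hs, hw]; push_cast; ring] at this
      refine this.trans ?_
      have h1 : t + v = (s + w).im := by rw [add_im, him, hwim]
      rw [h1, abs_of_nonneg (by linarith)]
      gcongr
      linarith
    have b2 := hC₀ χ⁻¹ (1 - (s + w)) (by rw [hre2]) y
    rw [hre2, show (5/4 - 3/2 : ℝ) = -(1/4) by norm_num] at b2
    have b3 := hC₀ χ⁻¹ (1 - (s + w)) (by rw [hre2]) 0
    have hD0 : dirPoly (fun n => χ⁻¹ (n : ZMod q)) 0 (1 - (s + w)) = 0 := by simp [dirPoly]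
    rw [hD0, sub_zero, Nat.cast_zero, zero_add, Real.one_rpow, mul_one] at b3
    have b4 : ‖D (1 - (s + w))‖ ≤ 2 * C₀ := by
      have h1 : ((y : ℝ) + 1) ^ (-(1/4) : ℝ) ≤ 1 :=
        Real.rpow_le_one_of_one_le_of_nonpos (by linarith [Nat.cast_nonneg (α := ℝ) y]) (by norm_num)
      have h2 := norm_sub_norm_le (D (1 - (s + w))) (DirichletCharacter.LFunction χ⁻¹ (1 - (s + w)))
      rw [norm_sub_rev] at h2
      have h3 := mul_le_mul_of_nonneg_left h1 hC₀'
      change _ ≤ C₀ * _ at b2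
      have b2' : ‖DirichletCharacter.LFunction χ⁻¹ (1 - (s + w)) - D (1 - (s + w))‖ ≤ _ := b2
      linarith
    have n1 : ‖(x₁ : ℂ) ^ w‖ = x₁⁻¹ := by rw [norm_ofReal_cpow hx₁0, hwre, Real.rpow_neg_one]
    have n2 : ‖(x₂ : ℂ) ^ w‖ = x₂⁻¹ := by rw [norm_ofReal_cpow hx₂0, hwre, Real.rpow_neg_one]
    have b5 := norm_cexp_sq_div_le (c := -1) (L := 1) (by simp) one_pos (by simp) v
    have b6 : ‖(DirichletCharacter.LFunction χ⁻¹ (1 - (s + w)) -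
        D (1 - (s + w))) * (x₁ : ℂ) ^ w + D (1 - (s + w)) * (x₂ : ℂ) ^ w‖ ≤
        C₀ * (((y : ℝ) + 1) ^ (-(1/4) : ℝ) * x₁⁻¹ + 2 * x₂⁻¹) := by
      refine (norm_add_le _ _).trans ?_
      rw [norm_mul, norm_mul, n1, n2]
      calc _ ≤ (C₀ * ((y : ℝ) + 1) ^ (-(1/4) : ℝ)) * x₁⁻¹ + (2 * C₀) * x₂⁻¹ := by
            gcongr
        _ = _ := by ring
    rw [e, norm_mul, norm_mul]
    calc _ ≤ (C₂ * (4 * T)) * (C₀ * (((y : ℝ) + 1) ^ (-(1/4) : ℝ) * x₁⁻¹ + 2 * x₂⁻¹)) *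
          (6 * weight 1 v) := by gcongr
      _ = _ := by ring
  have hIntegral : (∫ v in (-H)..H, g ((-1 : ℝ) + v * I)) =
      (∫ v in (-H)..H, (g ((-1 : ℝ) + v * I) - h ((-1 : ℝ) + v * I))) +
      ∫ v in (-H)..H, h ((-1 : ℝ) + v * I) := by
    have i1 : IntervalIntegrable (fun v : ℝ => g ((-1 : ℝ) + v * I)) volume (-H) H := by
      apply ContinuousOn.intervalIntegrable
      rw [Set.uIcc_of_le (by linarith)]
      exact continuousOn_vertical hgd
    have i2 : IntervalIntegrable (fun v : ℝ => h ((-1 : ℝ) + v * I)) volume (-H) H := by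
      apply ContinuousOn.intervalIntegrable
      rw [Set.uIcc_of_le (by linarith)]
      exact continuousOn_vertical fun w _ hw => hhd w hw
    rw [← intervalIntegral.integral_add (i1.sub i2) i2]
    simp
  have hleft : ‖∫ v in (-H)..H, h ((-1 : ℝ) + v * I)‖ ≤ ‖∫ v in (-H)..H, h ((0 : ℝ) + v * I)‖ +
      2 * (2 * C₂ * y * Real.exp (5 * T + 1 - T ^ 2 / 4)) * (0 - -1) := by
    have := norm_sub_norm_le (∫ v in (-H)..H, h ((-1 : ℝ) + v * I)) (∫ v in (-H)..H, h ((0 : ℝ) + v * I))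
    rw [norm_sub_rev] at this
    linarith
  change ‖∫ v in (-H)..H, g ((-1 : ℝ) + v * I)‖ ≤ _
  rw [hIntegral]
  refine (norm_add_le _ _).trans ?_
  linarith

/-- Coefficients of `∑_{N' < n} χ(n) n^{-s}`. -/
noncomputable def tailCoeff {q : ℕ} (χ : DirichletCharacter ℂ q) (N' n : ℕ) : ℂ :=
  if N' < n then χ (n : ZMod q) else 0

lemma norm_tailCoeff_le {q : ℕ} (χ : DirichletCharacter ℂ q) (N' n : ℕ) : ‖tailCoeff χ N' n‖ ≤ 1 := by
  unfold tailCoeff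
  split_ifs
  · exact χ.norm_le_one _
  · simp

lemma dirPoly_sub_dirPoly {q : ℕ} (χ : DirichletCharacter ℂ q) {N' N : ℕ} (h : N' ≤ N) (s : ℂ) :
    dirPoly (fun n => χ (n : ZMod q)) N s - dirPoly (fun n => χ (n : ZMod q)) N' s =
      dirPoly (tailCoeff χ N') N s := by
  have e : Finset.Icc 1 N' = (Finset.Icc 1 N).filter (fun n => ¬ N' < n) := by
    ext n; simp; omega
  rw [sub_eq_iff_eq_add, dirPoly, dirPoly, dirPoly, e,
    ← Finset.sum_filter_add_sum_filter_not (Finset.Icc 1 N) (fun n => N' < n)]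
  congr 1
  rw [Finset.sum_filter]
  refine Finset.sum_congr rfl fun n _ => ?_
  unfold tailCoeff
  split_ifs <;> simp

lemma norm_LFunction_sub_dirPoly_le {q : ℕ} [NeZero q] {χ : DirichletCharacter ℂ q}
    (hχ : χ.IsPrimitive) {C₀ C₁ C₂ : ℝ}
    (hC₀ : ∀ χ : DirichletCharacter ℂ q, ∀ s : ℂ, 3/2 ≤ s.re → ∀ N : ℕ,
      ‖DirichletCharacter.LFunction χ s - dirPoly (fun n => χ (n : ZMod q)) N s‖
        ≤ C₀ * ((N : ℝ) + 1) ^ (5/4 - s.re))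
    (hC₀' : 0 ≤ C₀) (hC₁' : 0 ≤ C₁) (hC₂' : 0 ≤ C₂)
    (hC₁ : ∀ s : ℂ, -(1/2) ≤ s.re → s.re ≤ 3/2 → 1 ≤ |s.im| →
      ‖DirichletCharacter.LFunction χ s‖ ≤ C₁ * Real.exp (2 * |s.im|))
    (hC₂ : (∀ u : ℝ, ‖feFactor χ (1/2 + u * Complex.I)‖ ≤ C₂) ∧
      (∀ u : ℝ, ‖feFactor χ (-(1/2) + u * Complex.I)‖ ≤ C₂ * (1 + |u|)) ∧
      (∀ z : ℂ, -(1/2) ≤ z.re → z.re ≤ 1/2 → 1 ≤ |z.im| →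
        ‖feFactor χ z‖ ≤ C₂ * Real.exp (2 * |z.im|)))
    {T t x₁ x₂ L A δ : ℝ} (hT : 4 ≤ T) (ht : T ≤ t) (ht' : t ≤ 2 * T) (hx₁ : 1 ≤ x₁) (hx₂ : 1 ≤ x₂)
    (hL : 0 < L) (hxL : |Real.log x₁ - Real.log x₂| ≤ L) (hA : 1 ≤ A) (hAT : 4 * (A + 1) ≤ T)
    (hδ : 0 < δ) (hδ1 : δ ≤ 1) {N' N : ℕ} (hN : N' ≤ N) (y : ℕ) :
    ‖DirichletCharacter.LFunction χ (1/2 + t * I) - dirPoly (fun n => χ (n : ZMod q)) N' (1/2 + t * I)‖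
      ≤ (∫ v in (-(T/2))..(T/2), 6 * (weight δ⁻¹ v * ‖dirPoly (fun n => (x₁ : ℂ) ^ (δ + v * I : ℂ) *
          (tailCoeff χ N' n * (n : ℂ) ^ (-(δ + v * I : ℂ)))) N (1/2 + t * I)‖)) +
        (∫ v in (-(T/2))..(T/2), 6 * (weight 1 v * ‖dirPoly (fun n => (x₁ : ℂ) ^ ((-1 : ℝ) + v * I : ℂ) *
          (χ (n : ZMod q) * (n : ℂ) ^ (-((-1 : ℝ) + v * I : ℂ)))) N' (1/2 + t * I)‖)) +
        (∫ v in (-(T/2))..(T/2), 3 * C₂ * (weight L v *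
          ‖dirPoly (fun n => χ (n : ZMod q) * (n : ℂ) ^ (-(v * I : ℂ))) y (1/2 + t * I)‖)) +
        (T * (C₀ * ((N : ℝ) + 1) ^ (3/4 - A) * x₁ ^ A * Real.exp (A ^ 2)) +
        4 * (24 * C₂ * C₀ * T * (((y : ℝ) + 1) ^ (-(1/4) : ℝ) * x₁⁻¹ + 2 * x₂⁻¹)) +
        4 * C₂ * y * Real.exp (5 * T + 1 - T ^ 2 / 4) +
        2 * (N * x₁ ^ A * Real.exp (A ^ 2 - T ^ 2 / 4)) * A +
        2 * (((C₁ + C₀) * Real.exp (5 * T) + (N' : ℝ) ^ 2) * x₁ ^ A * Real.exp (A ^ 2 - T ^ 2 / 4)) *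
          (A + 1)) := by
  have q1 := norm_integral_left_LFunction_le hχ hC₀ hC₀' hC₂' hC₂ hT ht ht' hx₁ hx₂ hL hxL y
  set s : ℂ := 1/2 + t * I with hs
  set H : ℝ := T / 2 with hH
  have hre : s.re = 1 / 2 := by simp [hs]
  have him : s.im = t := by simp [hs]
  have hx₁0 : 0 < x₁ := by linarith
  have hHsq : H ^ 2 = T ^ 2 / 4 := by rw [hH]; ring
  set D := dirPoly (fun n => χ (n : ZMod q)) N' with hD
  have hDd : Differentiable ℂ D := differentiable_dirPoly _ _
  set f : ℂ → ℂ := fun w => (DirichletCharacter.LFunction χ (s + w) - D (s + w)) * (x₁ : ℂ) ^ w *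
    Complex.exp (w ^ 2) with hf
  have himw : ∀ w : ℂ, |w.im| ≤ H → 2 ≤ (s + w).im ∧ (s + w).im ≤ 5 / 2 * T := by
    intro w hw
    rw [add_im, him]
    have := abs_le.mp hw
    constructor <;> linarith [this.1, this.2]
  have hLd : ∀ w : ℂ, |w.im| ≤ H →
      DifferentiableAt ℂ (fun w => DirichletCharacter.LFunction χ (s + w)) w := by
    intro w hw
    have h1 : s + w ≠ 1 := by
      intro h
      have := congrArg Complex.im h
      rw [one_im] at this
      linarith [(himw w hw).1]
    exact (DirichletCharacter.differentiableAt_LFunction χ (s + w) (Or.inl h1)).comp w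
        (differentiableAt_id.const_add s)
  have hDd' : Differentiable ℂ fun w => D (s + w) := hDd.comp (differentiable_id.const_add s)
  have hxd := differentiable_ofReal_cpow hx₁0
  have hexd : Differentiable ℂ fun w : ℂ => Complex.exp (w ^ 2) := (differentiable_id.pow 2).cexp
  have hLb : ∀ z : ℂ, -(1/2) ≤ z.re → 1 ≤ z.im → z.im ≤ 5 / 2 * T →
      ‖DirichletCharacter.LFunction χ z‖ ≤ (C₁ + C₀) * Real.exp (5 * T) := by
    intro z h1 h2 h3
    have he : 1 ≤ Real.exp (5 * T) := Real.one_le_exp (by linarith)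
    rcases le_total z.re (3/2) with h | h
    · refine (hC₁ z h1 h (by rw [abs_of_nonneg (by linarith)]; exact h2)).trans ?_
      rw [abs_of_nonneg (by linarith)]
      refine mul_le_mul (by linarith) (Real.exp_le_exp.mpr (by linarith)) (by positivity) (by linarith)
    · have b3 := hC₀ χ z h 0
      have hD0 : dirPoly (fun n => χ (n : ZMod q)) 0 z = 0 := by simp [dirPoly]
      rw [hD0, sub_zero, Nat.cast_zero, zero_add, Real.one_rpow, mul_one] at b3
      nlinarith
  have key := norm_apply_zero_le (f := f) (a := -1) (b := A) (H := H)
    (M := ((C₁ + C₀) * Real.exp (5 * T) + (N' : ℝ) ^ 2) * x₁ ^ A * Real.exp (A ^ 2 - T ^ 2 / 4))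
    (by norm_num) (by linarith) (by linarith)
    (fun w _ _ hw => (((hLd w hw).sub (hDd' w)).mul (hxd w)).mul (hexd w))
    (by
      intro w h1 h2 h3
      have hi := himw w h3.le
      have h4 : (1 : ℝ) ≤ ‖w‖ := by
        have := Complex.abs_im_le_norm w; rw [h3] at this; linarith
      rw [hf]; simp only
      rw [norm_div, norm_mul, norm_mul, norm_ofReal_cpow hx₁0, norm_cexp_sq']
      refine (div_le_self (by positivity) h4).trans ?_
      have b1 := hLb (s + w) (by rw [add_re, hre]; linarith) (by linarith) hi.2
      have b2 : ‖D (s + w)‖ ≤ (N' : ℝ) ^ 2 :=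
        norm_dirPoly_le_sq (fun n => χ.norm_le_one _) N' (by rw [add_re, hre]; linarith)
      have b3 := Real.rpow_le_rpow_of_exponent_le hx₁ h2
      have b4 : Real.exp (w.re ^ 2 - w.im ^ 2) ≤ Real.exp (A ^ 2 - T ^ 2 / 4) := by
        rw [← sq_abs w.im, h3, hHsq]
        exact Real.exp_le_exp.mpr (by nlinarith)
      have b5 := (norm_sub_le (DirichletCharacter.LFunction χ (s + w)) (D (s + w))).trans
        (add_le_add b1 b2)
      gcongr)
  have hf0 : f 0 = DirichletCharacter.LFunction χ s - D s := by simp [hf]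
  rw [hf0] at key
  refine key.trans ?_
  have hvne : ∀ c : ℝ, c ≠ 0 → ∀ w : ℂ, w.re = c → w ≠ 0 := by
    rintro c hc w hw rfl; exact hc (by simpa using hw.symm)
  have hii : ∀ c : ℝ, c ≠ 0 → ∀ g : ℂ → ℂ, (∀ w, |w.im| ≤ H → DifferentiableAt ℂ g w) →
      IntervalIntegrable (fun v : ℝ => g (c + v * I) * (x₁ : ℂ) ^ (c + v * I : ℂ) *
        Complex.exp ((c + v * I) ^ 2) / (c + v * I)) volume (-H) H := by
    intro c hc g hg
    apply ContinuousOn.intervalIntegrable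
    rw [Set.uIcc_of_le (by linarith)]
    exact continuousOn_vertical (f := fun w => g w * (x₁ : ℂ) ^ w * Complex.exp (w ^ 2) / w)
      fun w hw hw' => (((hg w hw').mul (hxd w)).mul (hexd w)).div differentiableAt_id (hvne c hc w hw)
  have hDN : ∀ c N, Differentiable ℂ fun w => dirPoly c N (s + w) := fun c N =>
    (differentiable_dirPoly c N).comp (differentiable_id.const_add s)
  have hright_eq : (∫ v in (-H)..H, f (A + v * I) / (A + v * I)) =
      (∫ v in (-H)..H, (DirichletCharacter.LFunction χ (s + (A + v * I)) -
      dirPoly (fun n => χ (n : ZMod q)) N (s + (A + v * I))) * (x₁ : ℂ) ^ (A + v * I : ℂ) *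
      Complex.exp ((A + v * I) ^ 2) / (A + v * I)) +
      ∫ v in (-H)..H, dirPoly (tailCoeff χ N') N (s + (A + v * I)) * (x₁ : ℂ) ^ (A + v * I : ℂ) *
      Complex.exp ((A + v * I) ^ 2) / (A + v * I) := by
    rw [← intervalIntegral.integral_add
      (hii A (by linarith) (fun w => DirichletCharacter.LFunction χ (s + w) -
          dirPoly (fun n => χ (n : ZMod q)) N (s + w))
          fun w hw => (hLd w hw).sub (hDN (fun n => χ (n : ZMod q)) N w))
      (hii A (by linarith) _ fun w _ => hDN (tailCoeff χ N') N w)]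
    refine intervalIntegral.integral_congr fun v _ => ?_
    simp only [hf]
    rw [← dirPoly_sub_dirPoly χ hN]
    ring
  have hright := (norm_add_le _ _).trans (add_le_add
      (norm_integral_right_tail_le χ (hC₀ χ) hre hA hx₁0 (by linarith : 0 ≤ H) N)
      (norm_integral_right_main_le (A := A) (H := H) (norm_tailCoeff_le χ N') (by rw [hre]; norm_num) hx₁
        (by linarith) hδ hδ1 (by linarith) N))
  rw [← hright_eq] at hright
  have hleft_eq : (∫ v in (-H)..H, f ((-1 : ℝ) + v * I) / ((-1 : ℝ) + v * I)) =
      (∫ v in (-H)..H, DirichletCharacter.LFunction χ (s + ((-1 : ℝ) + v * I)) *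
        (x₁ : ℂ) ^ ((-1 : ℝ) + v * I : ℂ) * Complex.exp (((-1 : ℝ) + v * I) ^ 2) /
        ((-1 : ℝ) + v * I)) -
      ∫ v in (-H)..H, D (s + ((-1 : ℝ) + v * I)) * (x₁ : ℂ) ^ ((-1 : ℝ) + v * I : ℂ) *
      Complex.exp (((-1 : ℝ) + v * I) ^ 2) / ((-1 : ℝ) + v * I) := by
    rw [← intervalIntegral.integral_sub
      (hii (-1) (by norm_num) _ hLd)
      (hii (-1) (by norm_num) (fun w => D (s + w)) fun w _ => hDd' w)]
    refine intervalIntegral.integral_congr fun v _ => ?_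
    simp only [hf]
    ring
  have hleft := (norm_sub_le _ _).trans (add_le_add q1
      (norm_integral_left_dirPoly_le (H := H) (fun n => χ (n : ZMod q)) s hx₁0 (by linarith) N'))
  rw [← hleft_eq] at hleft
  rw [hHsq] at hright
  have h9 : 2 * ((N : ℝ) * x₁ ^ A * Real.exp (A ^ 2 - T ^ 2 / 4)) * (A - δ) ≤
      2 * (N * x₁ ^ A * Real.exp (A ^ 2 - T ^ 2 / 4)) * A := by
    gcongr; linarith
  have h10 : 2 * H = T := by rw [hH]; ring
  rw [h10] at hright
  rw [sub_neg_eq_add]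
  linarith

lemma continuous_uncurry_norm_dirPoly_mul {β : ℝ → ℕ → ℂ} {B : ℕ}
    (hβc : ∀ n ∈ Finset.Icc 1 B, Continuous fun v => β v n) (r : ℕ → ℂ) (Y : ℕ) :
    Continuous (Function.uncurry fun t v : ℝ =>
      ‖dirPoly (β v) B (1/2 + t * I) * dirPoly r Y (1/2 + t * I)‖) := by
  have h1 : Continuous fun p : ℝ × ℝ => (1/2 + p.1 * I : ℂ) := by fun_prop
  have h2 : Continuous fun p : ℝ × ℝ => dirPoly (β p.2) B (1/2 + p.1 * I) := by
    unfold dirPoly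
    refine continuous_finsetSum _ fun n hn => ((hβc n hn).comp continuous_snd).mul ?_
    have hn1 := (Finset.mem_Icc.mp hn).1
    exact h1.neg.const_cpow (Or.inl (by exact_mod_cast (by omega : n ≠ 0)))
  exact (h2.mul ((differentiable_dirPoly r Y).continuous.comp h1)).norm

lemma integral_sq_integral_weight_mul_le {β : ℝ → ℕ → ℂ} {A M L H : ℝ} {B : ℕ} (hA : 0 < A)
    (hAB : A ≤ B) (hM0 : 0 ≤ M) (hβc : ∀ n ∈ Finset.Icc 1 B, Continuous fun v => β v n)
    (hM : ∀ v, ∀ n ∈ Finset.Icc 1 B, ‖β v n‖ ≤ M)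
    (hβ : ∀ v, ∀ n ∈ Finset.Icc 1 B, β v n ≠ 0 → A < n) (r : ℕ → ℂ) (Y : ℕ) {T : ℝ}
    (hT0 : 0 ≤ T) (hT : 4 * (B * Y : ℕ) * (1 + Real.log (B * Y : ℕ)) ≤ T) (hL : 1 ≤ L) (hH : 1 ≤ H) :
    (∫ t in T..(2 * T), (∫ v in (-H)..H, weight L v *
        ‖dirPoly (β v) B (1/2 + t * I) * dirPoly r Y (1/2 + t * I)‖) ^ 2)
      ≤ (2 * (1 + Real.log (1 + L))) ^ 2 * (2 * T * (M ^ 2 * (1 + Real.log (B / A)) * lcmSum r Y)) := by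
  have hL0 : 0 < L := by linarith
  have hw := integral_weight_le hL hH
  have hw0 : 0 ≤ ∫ v in (-H)..H, weight L v :=
    intervalIntegral.integral_nonneg (by linarith) fun v _ => (weight_pos hL0 v).le
  have hlog : 0 ≤ Real.log (B / A) := Real.log_nonneg ((one_le_div hA).mpr hAB)
  have h1 := integral_sq_integral_mul_le (k := weight L)
    (G := fun t v : ℝ => ‖dirPoly (β v) B (1/2 + t * I) * dirPoly r Y (1/2 + t * I)‖)
    (a := T) (b := 2 * T) (H := H) (M := 2 * T * (M ^ 2 * (1 + Real.log (B / A)) * lcmSum r Y))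
    (by linarith) (by linarith) (continuous_weight hL0) (weight_pos hL0)
    (continuous_uncurry_norm_dirPoly_mul hβc r Y)
    (by
      intro v
      set b : ℕ → ℂ := fun n => if n ∈ Finset.Icc 1 B then β v n else 0 with hb
      have e : ∀ s, dirPoly (β v) B s = dirPoly b B s := fun s =>
        Finset.sum_congr rfl fun n hn => by simp only [hb, if_pos hn]
      simp_rw [e]
      refine integral_norm_sq_dirPoly_mul_le hA hAB ?_ ?_ r Y hT0 hT
      · intro n
        simp only [hb]
        split_ifs with hn
        · exact hM v n hn
        · simpa using hM0
      · intro n hn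
        simp only [hb] at hn
        split_ifs at hn with hn'
        · exact ⟨hβ v n hn' hn, (Finset.mem_Icc.mp hn').2⟩
        · exact absurd rfl hn)
  refine h1.trans (mul_le_mul_of_nonneg_right (pow_le_pow_left₀ hw0 hw 2) ?_)
  have := lcmSum_nonneg r Y
  positivity

lemma log_sq_le {T : ℝ} (hT : 1 ≤ T) : Real.log T ^ 2 ≤ 4 * T := by
  have h1 : Real.log T = 2 * Real.log (Real.sqrt T) := by
    rw [Real.log_sqrt (by linarith)]; ring
  have h2 : Real.log (Real.sqrt T) ≤ Real.sqrt T := Real.log_le_self (Real.sqrt_nonneg _)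
  have h3 : 0 ≤ Real.log (Real.sqrt T) := Real.log_nonneg (Real.one_le_sqrt.mpr hT)
  have h4 := Real.sq_sqrt (by linarith : (0 : ℝ) ≤ T)
  rw [h1]
  nlinarith

/-- The size conditions relating the length `Y` of the mollifier to `T`. -/
structure Admissible (T : ℝ) (Y : ℕ) : Prop where
  hundred_le : 100 ≤ T
  two_le : 2 ≤ Y
  pow_le : (Y : ℝ) ^ 40 ≤ T
  log_le : 40 * Real.log T ≤ Real.log Y ^ 2
  le_Y : Real.log T ^ 2 ≤ Y

namespace Admissible

variable {T : ℝ} {Y : ℕ}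

lemma one_le_log (h : Admissible T Y) : 1 ≤ Real.log T := by
  rw [Real.le_log_iff_exp_le (by linarith [h.hundred_le])]
  linarith [Real.exp_one_lt_d9, h.hundred_le]

lemma two_le_logY (h : Admissible T Y) : 2 ≤ Real.log Y := by
  have h1 := h.one_le_log
  have h2 := h.log_le
  have h3 : 0 ≤ Real.log Y := Real.log_natCast_nonneg Y
  nlinarith

lemma logY_le (h : Admissible T Y) : 40 * Real.log Y ≤ Real.log T := by
  have hY : (0 : ℝ) < Y := by exact_mod_cast (by linarith [h.two_le] : 0 < Y)
  have := Real.log_le_log (by positivity) h.pow_le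
  rwa [Real.log_pow] at this

lemma one_le_Y (h : Admissible T Y) : (1 : ℝ) ≤ Y := by exact_mod_cast (by linarith [h.two_le] : 1 ≤ Y)

lemma Y_le (h : Admissible T Y) : (Y : ℝ) ≤ T :=
  (le_self_pow₀ h.one_le_Y (by norm_num)).trans h.pow_le

lemma length_cond (h : Admissible T Y) {B : ℕ} (hB : (B : ℝ) * Y ^ 5 ≤ T) :
    4 * (B * Y : ℕ) * (1 + Real.log (B * Y : ℕ)) ≤ T := by
  have hY := h.one_le_Y
  have hY2 : (2 : ℝ) ≤ Y := by exact_mod_cast h.two_le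
  have hT := h.hundred_le
  have h1 := h.one_le_log
  have h2 := h.le_Y
  have hB0 : (0 : ℝ) ≤ B := B.cast_nonneg
  have h3 : ((B * Y : ℕ) : ℝ) ≤ T := by
    push_cast
    refine le_trans (mul_le_mul_of_nonneg_left (le_self_pow₀ hY (by norm_num : 5 ≠ 0)) hB0) hB
  have h4 : Real.log (B * Y : ℕ) ≤ Real.log T := by
    rcases Nat.eq_zero_or_pos (B * Y) with h0 | h0
    · rw [h0, Nat.cast_zero, Real.log_zero]; linarith
    · exact Real.log_le_log (by exact_mod_cast h0) h3
  have h5 : 4 * (1 + Real.log T) ≤ Y ^ 4 := by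
    have : (Y : ℝ) ^ 4 = Y * Y * (Y * Y) := by ring
    nlinarith [mul_le_mul hY2 hY2 (by norm_num) (by linarith)]
  calc 4 * (B * Y : ℕ) * (1 + Real.log (B * Y : ℕ)) ≤ 4 * (B * Y : ℕ) * (1 + Real.log T) := by gcongr
    _ = (B * Y) * (4 * (1 + Real.log T)) := by push_cast; ring
    _ ≤ (B * Y) * Y ^ 4 := by gcongr
    _ = (B : ℝ) * Y ^ 5 := by ring
    _ ≤ T := hB

lemma exp_neg_le (h : Admissible T Y) {a : ℝ} (ha : a ≤ -T) : Real.exp a ≤ (Y : ℝ)⁻¹ := by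
  have hY := h.one_le_Y
  rw [← Real.exp_log (by positivity : (0 : ℝ) < (Y : ℝ)⁻¹), Real.log_inv]
  refine Real.exp_le_exp.mpr (ha.trans (neg_le_neg ?_))
  exact (Real.log_le_self (by linarith)).trans h.Y_le

lemma remainder_le (h : Admissible T Y) {C₀ C₁ C₂ : ℝ} (hC₀ : 0 ≤ C₀) (hC₁ : 0 ≤ C₁) (hC₂ : 0 ≤ C₂)
    {x₁ x₂ A : ℝ} {N N' y : ℕ} (hx₁ : x₁ = T / Y ^ 6) (hx₂ : x₂ = T * Y) (hA : A = Real.log Y / 2)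
    (hN : x₁ * Y ≤ N + 1) (hNT : (N : ℝ) ≤ T) (hN' : (N' : ℝ) ≤ T) (hy : y = Y ^ 28) :
    (T * (C₀ * ((N : ℝ) + 1) ^ (3/4 - A) * x₁ ^ A * Real.exp (A ^ 2)) +
        4 * (24 * C₂ * C₀ * T * (((y : ℝ) + 1) ^ (-(1/4) : ℝ) * x₁⁻¹ + 2 * x₂⁻¹)) +
        4 * C₂ * y * Real.exp (5 * T + 1 - T ^ 2 / 4) +
        2 * (N * x₁ ^ A * Real.exp (A ^ 2 - T ^ 2 / 4)) * A +
        2 * (((C₁ + C₀) * Real.exp (5 * T) + (N' : ℝ) ^ 2) * x₁ ^ A * Real.exp (A ^ 2 - T ^ 2 / 4)) *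
          (A + 1))
      ≤ (C₀ + 288 * C₂ * C₀ + 4 * C₂ + 2 + 2 * (C₁ + C₀ + 1)) * (Y : ℝ)⁻¹ := by
  have hY := h.one_le_Y
  have hT := h.hundred_le
  have hT0 : 0 < T := by linarith
  have hY0 : (0 : ℝ) < Y := by linarith
  have hlY := h.two_le_logY
  have hlT := h.logY_le
  have hll := h.log_le
  have hlsq := log_sq_le (by linarith : 1 ≤ T)
  have hexpT : T ≤ Real.exp T := by linarith [Real.add_one_le_exp T]
  have hx₁0 : 0 < x₁ := by rw [hx₁]; positivity
  have hlogT : Real.log T ≤ T := Real.log_le_self hT0.le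
  have hlx₁ : Real.log x₁ = Real.log T - 6 * Real.log Y := by
    rw [hx₁, Real.log_div hT0.ne' (by positivity), Real.log_pow]; norm_num
  have hA1 : 1 ≤ A := by rw [hA]; linarith
  have hAT : A ≤ Real.log T := by rw [hA]; linarith
  have hxA : x₁ ^ A = Real.exp (A * (Real.log T - 6 * Real.log Y)) := by
    rw [Real.rpow_def_of_pos hx₁0, hlx₁, mul_comm]
  have hA2 : A ^ 2 ≤ 4 * T := by nlinarith
  have hxA' : x₁ ^ A ≤ Real.exp (4 * T) := by
    rw [hxA]
    refine Real.exp_le_exp.mpr ?_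
    nlinarith
  have hAe : A + 1 ≤ Real.exp T := by linarith [Real.add_one_le_exp T]
  have hTT : 100 * T ≤ T ^ 2 := by nlinarith
  have e1 : T * (C₀ * ((N : ℝ) + 1) ^ (3/4 - A) * x₁ ^ A * Real.exp (A ^ 2)) ≤ C₀ * (Y : ℝ)⁻¹ := by
    have b1 : ((N : ℝ) + 1) ^ (3/4 - A) ≤ (x₁ * Y) ^ (3/4 - A) :=
      Real.rpow_le_rpow_of_nonpos (by positivity) hN (by linarith)
    have b2 : (x₁ * Y) ^ (3/4 - A) = Real.exp ((Real.log T - 5 * Real.log Y) * (3/4 - A)) := by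
      rw [Real.rpow_def_of_pos (by positivity), Real.log_mul hx₁0.ne' hY0.ne', hlx₁]
      ring_nf
    have b3 : T * (((N : ℝ) + 1) ^ (3/4 - A) * x₁ ^ A * Real.exp (A ^ 2)) ≤ (Y : ℝ)⁻¹ := by
      calc T * (((N : ℝ) + 1) ^ (3/4 - A) * x₁ ^ A * Real.exp (A ^ 2))
          ≤ T * ((x₁ * Y) ^ (3/4 - A) * x₁ ^ A * Real.exp (A ^ 2)) := by gcongr
        _ = Real.exp (Real.log T + ((Real.log T - 5 * Real.log Y) * (3/4 - A) +
              A * (Real.log T - 6 * Real.log Y) + A ^ 2)) := by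
            rw [b2, hxA, Real.exp_add, Real.exp_add, Real.exp_add, Real.exp_log hT0]
        _ ≤ Real.exp (-Real.log Y) := by
            refine Real.exp_le_exp.mpr ?_
            have : Real.log Y = 2 * A := by rw [hA]; ring
            rw [this] at hll hlT ⊢
            nlinarith
        _ = (Y : ℝ)⁻¹ := by rw [Real.exp_neg, Real.exp_log hY0]
    calc _ = C₀ * (T * (((N : ℝ) + 1) ^ (3/4 - A) * x₁ ^ A * Real.exp (A ^ 2))) := by ring
      _ ≤ _ := mul_le_mul_of_nonneg_left b3 hC₀
  have e2 : 4 * (24 * C₂ * C₀ * T * (((y : ℝ) + 1) ^ (-(1/4) : ℝ) * x₁⁻¹ + 2 * x₂⁻¹)) ≤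
      288 * C₂ * C₀ * (Y : ℝ)⁻¹ := by
    have b1 : ((y : ℝ) + 1) ^ (-(1/4) : ℝ) ≤ ((Y : ℝ) ^ 7)⁻¹ := by
      calc ((y : ℝ) + 1) ^ (-(1/4) : ℝ) ≤ ((Y : ℝ) ^ 28) ^ (-(1/4) : ℝ) := by
            refine Real.rpow_le_rpow_of_nonpos (by positivity) ?_ (by norm_num)
            rw [hy]; push_cast; linarith
        _ = ((Y : ℝ) ^ 7)⁻¹ := by
            rw [← Real.rpow_natCast, ← Real.rpow_mul hY0.le, ← Real.rpow_natCast, ← Real.rpow_neg hY0.le]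
            norm_num
    have b2 : T * (((Y : ℝ) ^ 7)⁻¹ * x₁⁻¹ + 2 * x₂⁻¹) = 3 * (Y : ℝ)⁻¹ := by
      rw [hx₁, hx₂]; field_simp; norm_num
    calc _ = 96 * C₂ * C₀ * (T * (((y : ℝ) + 1) ^ (-(1/4) : ℝ) * x₁⁻¹ + 2 * x₂⁻¹)) := by ring
      _ ≤ 96 * C₂ * C₀ * (T * (((Y : ℝ) ^ 7)⁻¹ * x₁⁻¹ + 2 * x₂⁻¹)) := by gcongr
      _ = _ := by rw [b2]; ring
  have e3 : 4 * C₂ * y * Real.exp (5 * T + 1 - T ^ 2 / 4) ≤ 4 * C₂ * (Y : ℝ)⁻¹ := by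
    have b1 : (y : ℝ) ≤ Real.exp T := by
      rw [hy]; push_cast
      exact ((pow_le_pow_right₀ hY (by norm_num)).trans h.pow_le).trans hexpT
    calc 4 * C₂ * y * Real.exp (5 * T + 1 - T ^ 2 / 4)
        ≤ 4 * C₂ * Real.exp T * Real.exp (5 * T + 1 - T ^ 2 / 4) := by gcongr
      _ = 4 * C₂ * Real.exp (T + (5 * T + 1 - T ^ 2 / 4)) := by rw [Real.exp_add]; ring
      _ ≤ _ := mul_le_mul_of_nonneg_left (h.exp_neg_le (by linarith)) (by positivity)
  have e4 : 2 * (N * x₁ ^ A * Real.exp (A ^ 2 - T ^ 2 / 4)) * A ≤ 2 * (Y : ℝ)⁻¹ := by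
    have hN0 : (N : ℝ) ≤ Real.exp T := hNT.trans hexpT
    have hA0 : A ≤ Real.exp T := by linarith
    calc 2 * (N * x₁ ^ A * Real.exp (A ^ 2 - T ^ 2 / 4)) * A
        ≤ 2 * (Real.exp T * Real.exp (4 * T) * Real.exp (A ^ 2 - T ^ 2 / 4)) * Real.exp T := by gcongr
      _ = 2 * Real.exp (T + 4 * T + (A ^ 2 - T ^ 2 / 4) + T) := by simp only [Real.exp_add]; ring
      _ ≤ _ := mul_le_mul_of_nonneg_left (h.exp_neg_le (by linarith)) (by norm_num)
  have e5 : 2 * (((C₁ + C₀) * Real.exp (5 * T) + (N' : ℝ) ^ 2) * x₁ ^ A *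
      Real.exp (A ^ 2 - T ^ 2 / 4)) * (A + 1) ≤ 2 * (C₁ + C₀ + 1) * (Y : ℝ)⁻¹ := by
    have b1 : (N' : ℝ) ^ 2 ≤ Real.exp (5 * T) := by
      calc (N' : ℝ) ^ 2 ≤ Real.exp T ^ 2 := by gcongr; exact hN'.trans hexpT
        _ = Real.exp (2 * T) := by rw [← Real.exp_nat_mul]; norm_num
        _ ≤ _ := Real.exp_le_exp.mpr (by linarith)
    calc 2 * (((C₁ + C₀) * Real.exp (5 * T) + (N' : ℝ) ^ 2) * x₁ ^ A *
          Real.exp (A ^ 2 - T ^ 2 / 4)) * (A + 1)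
        ≤ 2 * (((C₁ + C₀) * Real.exp (5 * T) + Real.exp (5 * T)) * Real.exp (4 * T) *
          Real.exp (A ^ 2 - T ^ 2 / 4)) * Real.exp T := by gcongr
      _ = 2 * (C₁ + C₀ + 1) * Real.exp (5 * T + 4 * T + (A ^ 2 - T ^ 2 / 4) + T) := by
          simp only [Real.exp_add]; ring
      _ ≤ _ := mul_le_mul_of_nonneg_left (h.exp_neg_le (by linarith)) (by positivity)
  linarith

end Admissible

/-- `∑_{k ≤ Y} |r(k)| k^{-1/2}`. -/
noncomputable def halfSum (r : ℕ → ℂ) (Y : ℕ) : ℝ := ∑ k ∈ Finset.Icc 1 Y, ‖r k‖ * (k : ℝ) ^ (-(1/2) : ℝ)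

lemma halfSum_nonneg (r : ℕ → ℂ) (Y : ℕ) : 0 ≤ halfSum r Y :=
  Finset.sum_nonneg fun _ _ => by positivity

lemma norm_dirPoly_le_halfSum (r : ℕ → ℂ) (Y : ℕ) (t : ℝ) :
    ‖dirPoly r Y (1/2 + t * I)‖ ≤ halfSum r Y := by
  refine norm_sum_le_of_le _ fun n hn => ?_
  rw [norm_mul, norm_natCast_cpow_neg (by have := (Finset.mem_Icc.mp hn).1; omega)]
  simp

lemma continuous_integral_weight_mul {β : ℝ → ℕ → ℂ} {B : ℕ} {L : ℝ} (hL : 0 < L)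
    (hβc : ∀ n ∈ Finset.Icc 1 B, Continuous fun v => β v n) (r : ℕ → ℂ) (Y : ℕ) (a b : ℝ) :
    Continuous fun t : ℝ => ∫ v in a..b, weight L v *
        ‖dirPoly (β v) B (1/2 + t * I) * dirPoly r Y (1/2 + t * I)‖ := by
  refine intervalIntegral.continuous_parametric_intervalIntegral_of_continuous' ?_ _ _
  exact ((continuous_weight hL).comp continuous_snd).mul
    (continuous_uncurry_norm_dirPoly_mul hβc r Y)

lemma integral_const_mul_weight_mul (c L : ℝ) (β : ℝ → ℕ → ℂ) (B : ℕ) (s R : ℂ) (a b : ℝ) :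
    (∫ v in a..b, c * (weight L v * ‖dirPoly (β v) B s‖)) * ‖R‖ =
      c * ∫ v in a..b, weight L v * ‖dirPoly (β v) B s * R‖ := by
  rw [← intervalIntegral.integral_mul_const, ← intervalIntegral.integral_const_mul]
  refine intervalIntegral.integral_congr fun v _ => ?_
  simp only [norm_mul]
  ring

/-- The length of the Dirichlet polynomial replacing `L(s, χ)`. -/
noncomputable def mainLength (T : ℝ) (Y : ℕ) : ℕ := ⌊T / Y ^ 7⌋₊

lemma continuous_LFunction_half_line {q : ℕ} [NeZero q] (χ : DirichletCharacter ℂ q) {T : ℝ} (hT : 0 < T) :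
    ContinuousOn (fun t : ℝ => DirichletCharacter.LFunction χ (1/2 + t * I)) (Set.uIcc T (2 * T)) := by
  intro t ht
  rw [Set.uIcc_of_le (by linarith)] at ht
  refine ContinuousAt.continuousWithinAt ?_
  have h1 : (1/2 + t * I : ℂ) ≠ 1 := by
    intro h
    have := congrArg Complex.im h
    simp at this
    linarith [ht.1]
  exact (DirichletCharacter.differentiableAt_LFunction χ _ (Or.inl h1)).continuousAt.comp
    (f := fun t : ℝ => (1/2 + t * I : ℂ)) (by fun_prop)

lemma add_add_add_sq_le (a b c d : ℝ) :
    (a + b + c + d) ^ 2 ≤ 4 * (a ^ 2 + b ^ 2 + c ^ 2 + d ^ 2) := by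
  linarith [sq_nonneg (a - b), sq_nonneg (a - c), sq_nonneg (a - d), sq_nonneg (b - c),
    sq_nonneg (b - d), sq_nonneg (c - d)]

set_option maxHeartbeats 1000000 in
theorem exists_integral_norm_sq_sub_dirPoly_le {q : ℕ} [NeZero q] {χ : DirichletCharacter ℂ q}
    (hχ : χ.IsPrimitive) : ∃ K : ℝ, 0 ≤ K ∧ ∀ (T : ℝ) (Y : ℕ), Admissible T Y → ∀ r : ℕ → ℂ,
      (∫ t in T..(2 * T), ‖(DirichletCharacter.LFunction χ (1/2 + t * I) -
          dirPoly (fun n => χ (n : ZMod q)) (mainLength T Y) (1/2 + t * I)) *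
          dirPoly r Y (1/2 + t * I)‖ ^ 2) ≤
        K * T * ((1 + Real.log (1 + 7 * Real.log Y)) ^ 2 * Real.log Y * lcmSum r Y +
          halfSum r Y ^ 2 / Y ^ 2) := by
  obtain ⟨C₀, hC₀', hC₀⟩ := exists_norm_LFunction_sub_dirPoly_le q
  obtain ⟨C₁, hC₁', hC₁⟩ := exists_norm_LFunction_le χ
  obtain ⟨C₂, hC₂', hC₂⟩ := exists_norm_feFactor_le χ
  set E₀ := C₀ + 288 * C₂ * C₀ + 4 * C₂ + 2 + 2 * (C₁ + C₀ + 1) with hE₀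
  refine ⟨4 * (36 * 216 + 36 * 8 + 9 * C₂ ^ 2 * 240 + E₀ ^ 2), by positivity, ?_⟩
  intro T Y h r
  have hY := h.one_le_Y
  have hT := h.hundred_le
  have hT0 : 0 < T := by linarith
  have hY0 : (0 : ℝ) < Y := by linarith
  have hlY := h.two_le_logY
  have hlT := h.logY_le
  set x₁ : ℝ := T / Y ^ 6 with hx₁
  set x₂ : ℝ := T * Y with hx₂
  set A : ℝ := Real.log Y / 2 with hA
  set N : ℕ := ⌊x₁ * Y⌋₊ with hN
  set N' : ℕ := mainLength T Y with hN'
  set y : ℕ := Y ^ 28 with hy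
  set δ : ℝ := (Real.log Y)⁻¹ with hδ
  set L : ℝ := 7 * Real.log Y with hL
  have hpowT : ∀ k ≤ 40, (Y : ℝ) ^ k ≤ T := fun k hk => (pow_le_pow_right₀ hY hk).trans h.pow_le
  have hx₁Y : (Y : ℝ) ^ 34 ≤ x₁ := by
    rw [hx₁, le_div_iff₀ (by positivity), ← pow_add]; exact hpowT _ (by norm_num)
  have hx₁Y2 : (Y : ℝ) ^ 2 ≤ x₁ := (pow_le_pow_right₀ hY (by norm_num)).trans hx₁Y
  have hx₁Y1 : (Y : ℝ) ≤ x₁ := (le_self_pow₀ hY (by norm_num)).trans hx₁Y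
  have hx₁1 : 1 ≤ x₁ := by linarith
  have hx₁0 : 0 < x₁ := by linarith
  have hx₂1 : 1 ≤ x₂ := one_le_mul_of_one_le_of_one_le (by linarith) hY
  have hN'eq : N' = ⌊x₁ / Y⌋₊ := by
    rw [hN', mainLength, hx₁, div_div, ← pow_succ]
  have hN'le : (N' : ℝ) ≤ x₁ / Y := by rw [hN'eq]; exact Nat.floor_le (by positivity)
  have hN'gt : x₁ / Y < N' + 1 := by rw [hN'eq]; exact Nat.lt_floor_add_one _
  have hNle : (N : ℝ) ≤ x₁ * Y := Nat.floor_le (by positivity)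
  have hNgt : x₁ * Y < N + 1 := Nat.lt_floor_add_one _
  have hdY : x₁ / Y ≤ x₁ * Y := by
    rw [div_le_iff₀ hY0]
    rw [mul_assoc]
    exact le_mul_of_one_le_right hx₁0.le (one_le_mul_of_one_le_of_one_le hY hY)
  have hN'N : N' ≤ N := by rw [hN'eq]; exact Nat.floor_mono hdY
  have hN'1 : 1 ≤ N' := by
    rw [hN'eq]
    refine Nat.le_floor ?_
    rw [Nat.cast_one, le_div_iff₀ hY0]; linarith
  have hx1T : x₁ * Y ^ 6 = T := by rw [hx₁]; field_simp
  have hNT : (N : ℝ) * Y ^ 5 ≤ T := by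
    calc (N : ℝ) * Y ^ 5 ≤ x₁ * Y * Y ^ 5 := by gcongr
      _ = T := by rw [← hx1T]; ring
  have hN'T : (N' : ℝ) * Y ^ 5 ≤ T := le_trans (by gcongr) hNT
  have hpow5 : (1 : ℝ) ≤ Y ^ 5 := one_le_pow₀ hY
  have hNT' : (N : ℝ) ≤ T := le_trans (le_mul_of_one_le_right N.cast_nonneg hpow5) hNT
  have hN'T' : (N' : ℝ) ≤ T := le_trans (le_mul_of_one_le_right N'.cast_nonneg hpow5) hN'T
  have hyT : (y : ℝ) * Y ^ 5 ≤ T := by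
    rw [hy]; push_cast; rw [← pow_add]; exact hpowT _ (by norm_num)
  have hδ0 : 0 < δ := inv_pos.mpr (by linarith)
  have hδ1 : δ ≤ 1 := inv_le_one_of_one_le₀ (by linarith)
  have hA1 : 1 ≤ A := by rw [hA]; linarith
  have hlog : Real.log T ≤ T - 1 := Real.log_le_sub_one_of_pos hT0
  have hrem := h.remainder_le hC₀' hC₁' hC₂' hx₁ hx₂ hA hNgt.le hNT' hN'T' hy
  set Er := (T * (C₀ * ((N : ℝ) + 1) ^ (3/4 - A) * x₁ ^ A * Real.exp (A ^ 2)) +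
        4 * (24 * C₂ * C₀ * T * (((y : ℝ) + 1) ^ (-(1/4) : ℝ) * x₁⁻¹ + 2 * x₂⁻¹)) +
        4 * C₂ * y * Real.exp (5 * T + 1 - T ^ 2 / 4) +
        2 * (N * x₁ ^ A * Real.exp (A ^ 2 - T ^ 2 / 4)) * A +
        2 * (((C₁ + C₀) * Real.exp (5 * T) + (N' : ℝ) ^ 2) * x₁ ^ A * Real.exp (A ^ 2 - T ^ 2 / 4)) *
          (A + 1)) with hEr
  have hEr0 : 0 ≤ Er := by rw [hEr]; positivity
  set D := dirPoly (fun n => χ (n : ZMod q)) N' with hD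
  set R := fun t : ℝ => dirPoly r Y (1/2 + t * I) with hR
  set β₁ : ℝ → ℕ → ℂ := fun v n => (x₁ : ℂ) ^ (δ + v * I : ℂ) *
          (tailCoeff χ N' n * (n : ℂ) ^ (-(δ + v * I : ℂ))) with hβ₁
  set β₂ : ℝ → ℕ → ℂ := fun v n => (x₁ : ℂ) ^ ((-1 : ℝ) + v * I : ℂ) *
          (χ (n : ZMod q) * (n : ℂ) ^ (-((-1 : ℝ) + v * I : ℂ))) with hβ₂
  set β₃ : ℝ → ℕ → ℂ := fun v n => χ (n : ZMod q) * (n : ℂ) ^ (-(v * I : ℂ)) with hβ₃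
  set J : ℝ → (ℝ → ℕ → ℂ) → ℕ → ℝ → ℝ := fun L β B t => ∫ v in (-(T/2))..(T/2), weight L v *
        ‖dirPoly (β v) B (1/2 + t * I) * dirPoly r Y (1/2 + t * I)‖ with hJ
  have hcx : (x₁ : ℂ) ≠ 0 := by exact_mod_cast hx₁0.ne'
  have hcn : ∀ B : ℕ, ∀ n ∈ Finset.Icc 1 B, (n : ℂ) ≠ 0 := fun B n hn => by
    have := (Finset.mem_Icc.mp hn).1
    exact_mod_cast (by omega : n ≠ 0)
  have hc₁ : ∀ n ∈ Finset.Icc 1 N, Continuous fun v => β₁ v n := fun n hn =>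
    (Continuous.const_cpow (by fun_prop) (Or.inl hcx)).mul
      (continuous_const.mul (Continuous.const_cpow (by fun_prop) (Or.inl (hcn N n hn))))
  have hc₂ : ∀ n ∈ Finset.Icc 1 N', Continuous fun v => β₂ v n := fun n hn =>
    (Continuous.const_cpow (by fun_prop) (Or.inl hcx)).mul
      (continuous_const.mul (Continuous.const_cpow (by fun_prop) (Or.inl (hcn N' n hn))))
  have hc₃ : ∀ n ∈ Finset.Icc 1 y, Continuous fun v => β₃ v n := fun n hn =>
      (continuous_const.mul (Continuous.const_cpow (by fun_prop) (Or.inl (hcn y n hn))))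
  have hδ' : 1 ≤ δ⁻¹ := one_le_inv₀ hδ0 |>.mpr hδ1
  have hL1 : 1 ≤ L := by rw [hL]; linarith
  have hJc₁ : Continuous (J δ⁻¹ β₁ N) := continuous_integral_weight_mul (by linarith) hc₁ r Y _ _
  have hJc₂ : Continuous (J 1 β₂ N') := continuous_integral_weight_mul (by linarith) hc₂ r Y _ _
  have hJc₃ : Continuous (J L β₃ y) := continuous_integral_weight_mul (by linarith) hc₃ r Y _ _
  have hpt : ∀ t ∈ Set.Icc T (2 * T), ‖(DirichletCharacter.LFunction χ (1/2 + t * I) -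
      D (1/2 + t * I)) * dirPoly r Y (1/2 + t * I)‖ ^ 2 ≤
      4 * (36 * J δ⁻¹ β₁ N t ^ 2 + 36 * J 1 β₂ N' t ^ 2 + 9 * C₂ ^ 2 * J L β₃ y t ^ 2 +
        E₀ ^ 2 * (halfSum r Y ^ 2 / Y ^ 2)) := by
    intro t ht
    have key := norm_LFunction_sub_dirPoly_le hχ hC₀ hC₀' hC₁' hC₂' hC₁ hC₂ (T := T) (t := t)
      (x₁ := x₁) (x₂ := x₂) (L := L) (A := A) (δ := δ) (by linarith) ht.1 ht.2 hx₁1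
      hx₂1 (by linarith)
      (by
        rw [hx₁, hx₂, Real.log_div hT0.ne' (by positivity), Real.log_mul hT0.ne' hY0.ne', Real.log_pow,
          abs_le]
        push_cast
        constructor <;> linarith)
      hA1 (by rw [hA]; linarith) hδ0 hδ1 hN'N y
    have k2 := mul_le_mul_of_nonneg_right key (norm_nonneg (dirPoly r Y (1/2 + t * I)))
    rw [add_mul, add_mul, add_mul, integral_const_mul_weight_mul 6 δ⁻¹ β₁,
      integral_const_mul_weight_mul 6 1 β₂, integral_const_mul_weight_mul (3 * C₂) L β₃,
      ← norm_mul] at k2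
    have hR1 := norm_dirPoly_le_halfSum r Y t
    have k3 : Er * ‖dirPoly r Y (1/2 + t * I)‖ ≤ E₀ * (halfSum r Y / Y) := by
      calc Er * ‖dirPoly r Y (1/2 + t * I)‖ ≤ (E₀ * (Y : ℝ)⁻¹) * halfSum r Y :=
            mul_le_mul hrem hR1 (norm_nonneg _) (hEr0.trans hrem)
        _ = _ := by rw [div_eq_mul_inv]; ring
    have k4 : ‖(DirichletCharacter.LFunction χ (1/2 + t * I) -
      D (1/2 + t * I)) * dirPoly r Y (1/2 + t * I)‖ ≤ 6 * J δ⁻¹ β₁ N t + 6 * J 1 β₂ N' t +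
        3 * C₂ * J L β₃ y t + E₀ * (halfSum r Y / Y) :=
      k2.trans (add_le_add_right k3 _)
    have k5 := pow_le_pow_left₀ (norm_nonneg _) k4 2
    refine k5.trans ?_
    refine (add_add_add_sq_le _ _ _ _).trans_eq ?_
    ring
  set w := (1 + Real.log (1 + L)) ^ 2 with hw
  set S := lcmSum r Y with hS
  have hS0 : 0 ≤ S := lcmSum_nonneg r Y
  have hlogL : ∀ l, 1 ≤ l → l ≤ L → (2 * (1 + Real.log (1 + l))) ^ 2 ≤ 4 * w := by
    intro l h1 h2
    have h3 : Real.log (1 + l) ≤ Real.log (1 + L) := Real.log_le_log (by linarith) (by linarith)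
    have h4 : 0 ≤ Real.log (1 + l) := Real.log_nonneg (by linarith)
    rw [mul_pow, hw]
    have : (1 + Real.log (1 + l)) ^ 2 ≤ (1 + Real.log (1 + L)) ^ 2 := by gcongr
    linarith
  have hfin : ∀ {l m c g : ℝ}, 1 ≤ l → l ≤ L → 0 ≤ m → 0 ≤ g → m * g ≤ c * Real.log Y →
      (2 * (1 + Real.log (1 + l))) ^ 2 * (2 * T * (m * g * S)) ≤ 8 * c * T * (w * Real.log Y * S) := by
    intro l m c g h1 h2 hm hg h3
    have hw0 : 0 ≤ w := sq_nonneg _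
    calc (2 * (1 + Real.log (1 + l))) ^ 2 * (2 * T * (m * g * S))
        ≤ (4 * w) * (2 * T * (c * Real.log Y * S)) :=
          mul_le_mul (hlogL l h1 h2)
            (mul_le_mul_of_nonneg_left (mul_le_mul_of_nonneg_right h3 hS0) (by positivity))
            (by positivity) (by positivity)
      _ = _ := by ring
  have hI₁ : ∫ t in T..(2 * T), J δ⁻¹ β₁ N t ^ 2 ≤ 8 * 27 * T * (w * Real.log Y * S) := by
    have hlogNA : 0 ≤ Real.log (N / (x₁ / Y)) ∧ Real.log (N / (x₁ / Y)) ≤ 2 * Real.log Y := by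
      have hge : x₁ / Y ≤ N := hN'gt.le.trans (by
        have : N' < N := by
          rw [hN'eq, hN, Nat.lt_iff_add_one_le]
          refine Nat.le_floor ?_
          push_cast
          rw [← hN'eq]
          have hY2 : (2 : ℝ) ≤ Y := by exact_mod_cast h.two_le
          have h1 : x₁ / Y ≤ x₁ := div_le_self hx₁0.le hY
          have h2 : x₁ * 2 ≤ x₁ * Y := mul_le_mul_of_nonneg_left hY2 hx₁0.le
          linarith
        exact_mod_cast this)
      have hp : 0 < x₁ / Y := by positivity
      refine ⟨Real.log_nonneg ((one_le_div hp).mpr hge), ?_⟩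
      rw [show 2 * Real.log Y = Real.log ((Y : ℝ) ^ 2) by rw [Real.log_pow]; norm_num]
      refine Real.log_le_log (div_pos (hp.trans_le hge) hp) ?_
      rw [div_le_iff₀ hp]
      refine hNle.trans_eq ?_
      field_simp
    refine (integral_sq_integral_weight_mul_le (A := x₁ / Y) (M := Real.exp 1) (by positivity) ?_
      (Real.exp_pos _).le hc₁ ?_ ?_ r Y hT0.le (h.length_cond hNT) hδ' (by linarith)).trans ?_
    · by_contra hlt
      push Not at hlt
      have hp : 0 < x₁ / Y := by positivity
      have hN1 : (1 : ℝ) ≤ N := by exact_mod_cast hN'1.trans hN'N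
      have : Real.log (N / (x₁ / Y)) < 0 :=
        Real.log_neg (by positivity) ((div_lt_one hp).mpr hlt)
      linarith [hlogNA.1]
    · intro v n hn
      have hn1 := (Finset.mem_Icc.mp hn).1
      have hn0 : (0 : ℝ) < n := by exact_mod_cast hn1
      rcases le_or_gt n N' with hle | hlt
      · simp only [hβ₁, tailCoeff, if_neg (not_lt.mpr hle)]
        simp [Real.exp_nonneg]
      · have hxn : x₁ / Y < n := hN'gt.trans_le (by exact_mod_cast hlt)
        simp only [hβ₁]
        rw [norm_mul, norm_mul, norm_ofReal_cpow hx₁0, norm_natCast_cpow_neg (by omega)]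
        have e1 : ((δ : ℂ) + v * I).re = δ := by simp
        rw [e1]
        calc x₁ ^ δ * (‖tailCoeff χ N' n‖ * (n : ℝ) ^ (-δ)) ≤ x₁ ^ δ * (1 * (n : ℝ) ^ (-δ)) := by
              have := norm_tailCoeff_le χ N' n
              gcongr
          _ = (x₁ / n) ^ δ := by rw [one_mul, Real.rpow_neg hn0.le, Real.div_rpow hx₁0.le hn0.le]; rfl
          _ ≤ (Y : ℝ) ^ δ := by
              refine Real.rpow_le_rpow (by positivity) ?_ hδ0.le
              rw [div_le_iff₀ hn0]
              rw [div_lt_iff₀ hY0] at hxn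
              linarith
          _ = Real.exp 1 := by
              rw [Real.rpow_def_of_pos hY0, hδ, mul_inv_cancel₀ (by linarith)]
    · intro v n hn hne
      have hlt : N' < n := by
        by_contra hle
        refine hne ?_
        simp only [hβ₁, tailCoeff, if_neg hle]
        simp
      exact hN'gt.trans_le (by exact_mod_cast hlt)
    · refine hfin hδ' (by rw [hδ, inv_inv, hL]; linarith) (by positivity) (by linarith [hlogNA.1]) ?_
      have he : Real.exp 1 ^ 2 ≤ 3 ^ 2 :=
        pow_le_pow_left₀ (Real.exp_pos 1).le (by linarith [Real.exp_one_lt_d9]) 2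
      calc Real.exp 1 ^ 2 * (1 + Real.log (N / (x₁ / Y))) ≤ 3 ^ 2 * (3 * Real.log Y) :=
            mul_le_mul he (by linarith [hlogNA.2]) (by linarith [hlogNA.1]) (by norm_num)
        _ = 27 * Real.log Y := by ring
  have hI₂ : ∫ t in T..(2 * T), J 1 β₂ N' t ^ 2 ≤ 8 * 1 * T * (w * Real.log Y * S) := by
    have hN'R : (1 : ℝ) ≤ N' := by exact_mod_cast hN'1
    have hl0 : 0 ≤ Real.log (N' / (1/2)) := Real.log_nonneg (by rw [le_div_iff₀] <;> linarith)
    refine (integral_sq_integral_weight_mul_le (A := 1/2) (M := (Y : ℝ)⁻¹) (by norm_num) (by linarith)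
      (by positivity) hc₂ ?_ ?_ r Y hT0.le (h.length_cond hN'T) le_rfl (by linarith)).trans ?_
    · intro v n hn
      have hn1 := (Finset.mem_Icc.mp hn).1
      have hn0 : (0 : ℝ) < n := by exact_mod_cast hn1
      have hnN : (n : ℝ) ≤ x₁ / Y := le_trans (by exact_mod_cast (Finset.mem_Icc.mp hn).2) hN'le
      simp only [hβ₂]
      rw [norm_mul, norm_mul, norm_ofReal_cpow hx₁0, norm_natCast_cpow_neg (by omega)]
      have e1 : (((-1 : ℝ) : ℂ) + v * I).re = -1 := by simp
      rw [e1, neg_neg, Real.rpow_one, Real.rpow_neg_one]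
      calc x₁⁻¹ * (‖χ (n : ZMod q)‖ * n) ≤ x₁⁻¹ * (1 * (x₁ / Y)) := by
            have := χ.norm_le_one (n : ZMod q)
            gcongr
        _ = (Y : ℝ)⁻¹ := by field_simp
    · intro v n hn _
      have hn1 : (1 : ℝ) ≤ n := by exact_mod_cast (Finset.mem_Icc.mp hn).1
      linarith
    · refine hfin le_rfl hL1 (by positivity) (by linarith) ?_
      have b1 : Real.log (N' / (1/2)) ≤ Real.log 2 + Real.log T := by
        rw [← Real.log_mul (by norm_num) hT0.ne']
        refine Real.log_le_log (by positivity) ?_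
        rw [div_le_iff₀ (by norm_num)]; linarith
      have b2 := Real.log_two_lt_d9
      have b3 := h.le_Y
      have b4 := h.one_le_log
      have hY2 : (2 : ℝ) ≤ Y := by exact_mod_cast h.two_le
      have b5 : Real.log T ≤ Y := (le_self_pow₀ b4 two_ne_zero).trans b3
      have b6 : 2 * (Y : ℝ) ≤ Y ^ 2 := by
        rw [sq]; exact mul_le_mul_of_nonneg_right hY2 hY0.le
      have b7 : (Y : ℝ) ^ 2 * 1 ≤ Y ^ 2 * Real.log Y :=
        mul_le_mul_of_nonneg_left (by linarith) (sq_nonneg _)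
      rw [inv_pow, inv_mul_le_iff₀ (by positivity)]
      linarith
  have hI₃ : ∫ t in T..(2 * T), J L β₃ y t ^ 2 ≤ 8 * 30 * T * (w * Real.log Y * S) := by
    have hy1 : (1 : ℝ) ≤ y := by rw [hy]; push_cast; exact one_le_pow₀ hY
    have hl0 : 0 ≤ Real.log (y / (1/2)) := Real.log_nonneg (by rw [le_div_iff₀] <;> linarith)
    refine (integral_sq_integral_weight_mul_le (A := 1/2) (M := 1) (by norm_num) (by linarith)
      (by positivity) hc₃ ?_ ?_ r Y hT0.le (h.length_cond hyT) hL1 (by linarith)).trans ?_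
    · intro v n hn
      have hn1 := (Finset.mem_Icc.mp hn).1
      simp only [hβ₃]
      rw [norm_mul, norm_natCast_cpow_neg (by omega)]
      simpa using χ.norm_le_one (n : ZMod q)
    · intro v n hn _
      have hn1 : (1 : ℝ) ≤ n := by exact_mod_cast (Finset.mem_Icc.mp hn).1
      linarith
    · refine hfin hL1 le_rfl (by positivity) (by linarith) ?_
      have b1 : Real.log (y / (1/2)) = Real.log 2 + 28 * Real.log Y := by
        rw [div_div_eq_mul_div, div_one, mul_comm, Real.log_mul (by norm_num) (by positivity), hy]
        push_cast
        rw [Real.log_pow]; norm_num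
      have b2 := Real.log_two_lt_d9
      rw [b1]
      linarith
  have hDc : Continuous fun t : ℝ => D (1/2 + t * I) :=
    (differentiable_dirPoly _ _).continuous.comp (by fun_prop)
  have hRc : Continuous fun t : ℝ => dirPoly r Y (1/2 + t * I) :=
    (differentiable_dirPoly _ _).continuous.comp (by fun_prop)
  have hIntegral := intervalIntegral.integral_mono_on (μ := volume) (a := T) (b := 2 * T) (by linarith)
    ((((continuous_LFunction_half_line χ hT0).sub hDc.continuousOn).mul
      hRc.continuousOn).norm.pow 2).intervalIntegrable
    (Continuous.intervalIntegrable (by fun_prop) _ _) hpt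
  refine hIntegral.trans ?_
  have i₁ : IntervalIntegrable (fun t => 36 * J δ⁻¹ β₁ N t ^ 2) volume T (2 * T) :=
    Continuous.intervalIntegrable (by fun_prop) _ _
  have i₂ : IntervalIntegrable (fun t => 36 * J 1 β₂ N' t ^ 2) volume T (2 * T) :=
    Continuous.intervalIntegrable (by fun_prop) _ _
  have i₃ : IntervalIntegrable (fun t => 9 * C₂ ^ 2 * J L β₃ y t ^ 2) volume T (2 * T) :=
    Continuous.intervalIntegrable (by fun_prop) _ _
  rw [intervalIntegral.integral_const_mul, intervalIntegral.integral_add ((i₁.add i₂).add i₃) (by simp),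
    intervalIntegral.integral_add (i₁.add i₂) i₃, intervalIntegral.integral_add i₁ i₂,
    intervalIntegral.integral_const_mul, intervalIntegral.integral_const_mul,
    intervalIntegral.integral_const_mul, intervalIntegral.integral_const, smul_eq_mul]
  have hC2 : 0 ≤ 9 * C₂ ^ 2 := by positivity
  have hWS : 0 ≤ T * (w * Real.log Y * S) := by positivity
  have hHS : 0 ≤ T * (halfSum r Y ^ 2 / Y ^ 2) := by positivity
  have f3 := mul_le_mul_of_nonneg_left hI₃ hC2
  calc 4 * (36 * (∫ t in T..(2 * T), J δ⁻¹ β₁ N t ^ 2) + 36 * (∫ t in T..(2 * T), J 1 β₂ N' t ^ 2) +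
        9 * C₂ ^ 2 * (∫ t in T..(2 * T), J L β₃ y t ^ 2) +
        (2 * T - T) * (E₀ ^ 2 * (halfSum r Y ^ 2 / Y ^ 2)))
      ≤ 4 * (36 * (8 * 27 * T * (w * Real.log Y * S)) + 36 * (8 * 1 * T * (w * Real.log Y * S)) +
        9 * C₂ ^ 2 * (8 * 30 * T * (w * Real.log Y * S)) +
        (2 * T - T) * (E₀ ^ 2 * (halfSum r Y ^ 2 / Y ^ 2))) := by linarith
    _ = 4 * (36 * 216 + 36 * 8 + 9 * C₂ ^ 2 * 240) * (T * (w * Real.log Y * S)) +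
        4 * E₀ ^ 2 * (T * (halfSum r Y ^ 2 / Y ^ 2)) := by ring
    _ ≤ 4 * (36 * 216 + 36 * 8 + 9 * C₂ ^ 2 * 240 + E₀ ^ 2) * (T * (w * Real.log Y * S)) +
        4 * (36 * 216 + 36 * 8 + 9 * C₂ ^ 2 * 240 + E₀ ^ 2) * (T * (halfSum r Y ^ 2 / Y ^ 2)) := by
        have hE2 := sq_nonneg E₀
        refine add_le_add (mul_le_mul_of_nonneg_right (by linarith) hWS)
          (mul_le_mul_of_nonneg_right (by linarith) hHS)
    _ = _ := by ring

/-- The primes up to `N`. -/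
def primesLe (N : ℕ) : Finset ℕ := (Icc 1 N).filter Nat.Prime

lemma mem_primesLe {N p : ℕ} : p ∈ primesLe N ↔ p.Prime ∧ p ≤ N := by
  simp only [primesLe, mem_filter, mem_Icc]
  exact ⟨fun h => ⟨h.2, h.1.2⟩, fun h => ⟨⟨h.1.one_le, h.2⟩, h.1⟩⟩

lemma primesLe_succ (N : ℕ) :
    primesLe (N + 1) = if (N + 1).Prime then insert (N + 1) (primesLe N) else primesLe N := by
  ext p
  split_ifs with h
  · simp only [mem_insert, mem_primesLe]
    constructor
    · rintro ⟨h1, h2⟩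
      rcases Nat.lt_or_ge N p with h3 | h3
      · left; omega
      · exact Or.inr ⟨h1, h3⟩
    · rintro (rfl | h1)
      · exact ⟨h, le_refl _⟩
      · exact ⟨h1.1, by omega⟩
  · simp only [mem_primesLe]
    constructor
    · rintro ⟨h1, h2⟩
      refine ⟨h1, ?_⟩
      rcases Nat.lt_or_ge N p with h3 | h3
      · have : p = N + 1 := by omega
        exact absurd (this ▸ h1) h
      · exact h3
    · rintro ⟨h1, h2⟩
      exact ⟨h1, by omega⟩

lemma sum_primesLe_succ (f : ℕ → ℝ) (N : ℕ) :
    ∑ p ∈ primesLe (N + 1), f p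
      = ∑ p ∈ primesLe N, f p + if (N + 1).Prime then f (N + 1) else 0 := by
  rw [primesLe_succ]
  split_ifs with h
  · rw [sum_insert (by simp [mem_primesLe]), add_comm]
  · simp

lemma log_factorial_eq_sum (N : ℕ) :
    Real.log (N.factorial : ℝ)
      = ∑ p ∈ primesLe N, (N.factorial.factorization p : ℝ) * Real.log p := by
  have h0 := Nat.factorial_ne_zero N
  have h1 : (N.factorial : ℝ) = ∏ p ∈ primesLe N, (p : ℝ) ^ (N.factorial.factorization p) := by
    have h2 := Nat.prod_factorization_pow_eq_self h0
    rw [Finsupp.prod_of_support_subset (s := primesLe N) _ ?_ _ (by simp)] at h2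
    · exact_mod_cast h2.symm
    · intro p hp
      have hp' : p ∈ N.factorial.primeFactors := by simpa using hp
      have hpp := Nat.prime_of_mem_primeFactors hp'
      exact mem_primesLe.2 ⟨hpp, hpp.dvd_factorial.1 (Nat.dvd_of_mem_primeFactors hp')⟩
  rw [h1, Real.log_prod]
  · simp [Real.log_pow]
  · intro p hp
    have := (mem_primesLe.1 hp).1.pos
    positivity

lemma sum_log_div_primesLe_le {N : ℕ} (hN : 1 ≤ N) :
    ∑ p ∈ primesLe N, Real.log p / p ≤ Real.log N + 3 := by
  have hN0 : (0:ℝ) < N := by exact_mod_cast hN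
  have h1 : ∑ p ∈ primesLe N, ((N : ℝ) / p - 1) * Real.log p ≤ N * Real.log N := by
    calc ∑ p ∈ primesLe N, ((N : ℝ) / p - 1) * Real.log p
        ≤ ∑ p ∈ primesLe N, (N.factorial.factorization p : ℝ) * Real.log p := by
          refine sum_le_sum fun p hp => ?_
          obtain ⟨hpp, hpN⟩ := mem_primesLe.1 hp
          refine mul_le_mul_of_nonneg_right ?_ (Real.log_natCast_nonneg p)
          have h2 : N / p ≤ N.factorial.factorization p := by
            rw [Nat.factorization_factorial hpp (Nat.lt_succ_self _)]
            have h3 : 1 ∈ Finset.Ico 1 (Nat.log p N).succ := by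
              rw [Finset.mem_Ico]
              exact ⟨le_refl _, by
                have := Nat.log_pos hpp.one_lt hpN
                omega⟩
            calc N / p = N / p ^ 1 := by rw [pow_one]
              _ ≤ _ := Finset.single_le_sum (f := fun i => N / p ^ i) (fun _ _ => Nat.zero_le _) h3
          have h4 : (N : ℝ) / p - 1 ≤ ((N / p : ℕ) : ℝ) := by
            have := Nat.lt_floor_add_one ((N : ℝ) / p)
            rw [Nat.floor_div_natCast, Nat.floor_natCast] at this
            linarith
          have h5 : ((N / p : ℕ) : ℝ) ≤ N.factorial.factorization p := by exact_mod_cast h2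
          linarith
      _ = Real.log (N.factorial : ℝ) := (log_factorial_eq_sum N).symm
      _ ≤ Real.log ((N : ℝ) ^ N) := by
          refine Real.log_le_log (by exact_mod_cast Nat.factorial_pos N) ?_
          exact_mod_cast Nat.factorial_le_pow N
      _ = N * Real.log N := by rw [Real.log_pow]
  have h2 : ∑ p ∈ primesLe N, Real.log p ≤ 3 * N := by
    have h3 := Chebyshev.theta_le_log4_mul_x (x := N) hN0.le
    rw [Chebyshev.theta_eq_sum_Icc, Nat.floor_natCast] at h3
    have h4 : ∑ p ∈ primesLe N, Real.log p ≤ ∑ p ∈ Finset.Icc 0 N with Nat.Prime p, Real.log p := by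
      refine sum_le_sum_of_subset_of_nonneg ?_ fun p _ _ => Real.log_natCast_nonneg p
      intro p hp
      obtain ⟨h5, h6⟩ := mem_primesLe.1 hp
      exact mem_filter.2 ⟨Finset.mem_Icc.2 ⟨Nat.zero_le _, h6⟩, h5⟩
    have h5 : Real.log 4 ≤ 3 := by
      have := Real.log_le_sub_one_of_pos (x := 4) (by norm_num)
      linarith
    nlinarith
  have h3 : ∑ p ∈ primesLe N, ((N : ℝ) / p - 1) * Real.log p
      = N * ∑ p ∈ primesLe N, Real.log p / p - ∑ p ∈ primesLe N, Real.log p := by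
    rw [mul_sum, ← sum_sub_distrib]
    exact sum_congr rfl fun p _ => by ring
  have h4 : N * ∑ p ∈ primesLe N, Real.log p / p ≤ N * (Real.log N + 3) := by
    rw [h3] at h1
    linarith
  exact le_of_mul_le_mul_left h4 hN0

lemma sum_log_div_mul_sub_one_primesLe_le (N : ℕ) :
    ∑ p ∈ primesLe N, Real.log p / (p * ((p : ℝ) - 1)) ≤ 2 := by
  rcases Nat.eq_zero_or_pos N with rfl | hN
  · simp [primesLe]
  have key : ∀ n : ℕ, ∑ p ∈ primesLe (n + 1), Real.log p / (p * ((p : ℝ) - 1))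
      ≤ 2 - (Real.log ((n + 1 : ℕ) : ℝ) + 2) / ((n + 1 : ℕ) : ℝ) := by
    intro n
    induction n with
    | zero => simp [primesLe, Finset.filter_singleton, Nat.not_prime_one]
    | succ n ih =>
      rw [sum_primesLe_succ]
      have hx : (1 : ℝ) ≤ (n + 1 : ℕ) := by push_cast; linarith [Nat.cast_nonneg (α := ℝ) n]
      have hcast : ((n + 1 + 1 : ℕ) : ℝ) = (n + 1 : ℕ) + 1 := by push_cast; ring
      rw [hcast]
      set x : ℝ := ((n + 1 : ℕ) : ℝ)
      have h1 : (if (n + 1 + 1).Prime then Real.log (x + 1) / ((x + 1) * ((x + 1) - 1)) else 0)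
          ≤ Real.log (x + 1) / ((x + 1) * x) := by
        have h2 : 0 ≤ Real.log (x + 1) := Real.log_nonneg (by linarith)
        split_ifs
        · rw [add_sub_cancel_right]
        · positivity
      have h3 : Real.log (x + 1) - 1 / x ≤ Real.log x := by
        have h4 : Real.log (x + 1) = Real.log x + Real.log (1 + 1 / x) := by
          rw [← Real.log_mul (by positivity) (by positivity)]
          congr 1
          field_simp
        have h5 := Real.log_le_sub_one_of_pos (x := 1 + 1 / x) (by positivity)
        linarith
      have h6 : Real.log (x + 1) / ((x + 1) * x) ≤ (Real.log x + 2) / x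
          - (Real.log (x + 1) + 2) / (x + 1) := by
        have h7 : Real.log (x + 1) / ((x + 1) * x)
            ≤ (Real.log (x + 1) - 1 / x + 2) / x - (Real.log (x + 1) + 2) / (x + 1) := by
          rw [← sub_nonneg]
          have : (Real.log (x + 1) - 1 / x + 2) / x - (Real.log (x + 1) + 2) / (x + 1)
              - Real.log (x + 1) / ((x + 1) * x) = (x - 1) / (x ^ 2 * (x + 1)) := by
            field_simp
            ring
          rw [this]
          exact div_nonneg (by linarith) (by positivity)
        have h8 : (Real.log (x + 1) - 1 / x + 2) / x ≤ (Real.log x + 2) / x := by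
          gcongr
        linarith
      have h9 : (if (n + 1 + 1).Prime then Real.log ((n + 1 + 1 : ℕ) : ℝ)
          / (((n + 1 + 1 : ℕ) : ℝ) * (((n + 1 + 1 : ℕ) : ℝ) - 1)) else 0)
          ≤ Real.log (x + 1) / ((x + 1) * x) := by
        rw [hcast]; exact h1
      linarith
  obtain ⟨n, rfl⟩ : ∃ n, N = n + 1 := ⟨N - 1, by omega⟩
  have h := key n
  have h2 : 0 ≤ (Real.log ((n + 1 : ℕ) : ℝ) + 2) / ((n + 1 : ℕ) : ℝ) := by
    have := Real.log_natCast_nonneg (n + 1)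
    positivity
  linarith

lemma le_sum_log_div_primesLe {N : ℕ} (hN : 1 ≤ N) :
    Real.log N - 3 ≤ ∑ p ∈ primesLe N, Real.log p / p := by
  have hN0 : (0:ℝ) < N := by exact_mod_cast hN
  have h1 : N * Real.log N - N ≤ Real.log (N.factorial : ℝ) := by
    have h2 := Real.pow_div_factorial_le_exp N hN0.le N
    have h3 : (N : ℝ) ^ N ≤ Real.exp N * N.factorial := by
      rwa [div_le_iff₀ (by exact_mod_cast Nat.factorial_pos N)] at h2
    have h4 := Real.log_le_log (by positivity) h3
    rw [Real.log_pow, Real.log_mul (Real.exp_ne_zero _)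
      (by exact_mod_cast Nat.factorial_ne_zero N), Real.log_exp] at h4
    linarith
  have h2 : Real.log (N.factorial : ℝ) ≤ N * (∑ p ∈ primesLe N, Real.log p / p
      + ∑ p ∈ primesLe N, Real.log p / (p * ((p : ℝ) - 1))) := by
    rw [log_factorial_eq_sum, ← sum_add_distrib, mul_sum]
    refine sum_le_sum fun p hp => ?_
    obtain ⟨hpp, hpN⟩ := mem_primesLe.1 hp
    have hp2 : (2:ℝ) ≤ p := by exact_mod_cast hpp.two_le
    have h3 : (N.factorial.factorization p : ℝ) ≤ N / ((p : ℝ) - 1) := by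
      have h4 : ((N.factorial.factorization p : ℕ) : ℝ) ≤ ((N / (p - 1) : ℕ) : ℝ) := by
        exact_mod_cast Nat.factorization_factorial_le_div_pred hpp N
      refine h4.trans (Nat.cast_div_le.trans ?_)
      rw [Nat.cast_sub hpp.one_le, Nat.cast_one]
    have h5 := mul_le_mul_of_nonneg_right h3 (Real.log_natCast_nonneg p)
    refine h5.trans (le_of_eq ?_)
    have : (p : ℝ) - 1 ≠ 0 := by linarith
    field_simp
    ring
  have h3 := sum_log_div_mul_sub_one_primesLe_le N
  have h4 : N * (Real.log N - 3) ≤ N * ∑ p ∈ primesLe N, Real.log p / p := by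
    nlinarith
  exact le_of_mul_le_mul_left h4 hN0

lemma abs_sum_log_div_primesLe_sub_log_le {N : ℕ} (hN : 1 ≤ N) :
    |∑ p ∈ primesLe N, Real.log p / p - Real.log N| ≤ 3 := by
  rw [abs_le]
  constructor <;> linarith [sum_log_div_primesLe_le hN, le_sum_log_div_primesLe hN]

/-- `∑_{p ≤ N} -log (1 - 1/p)`. -/
noncomputable def mertensSum (N : ℕ) : ℝ := ∑ p ∈ primesLe N, -Real.log (1 - 1 / (p : ℝ))

lemma neg_log_one_sub_inv_bounds {x : ℝ} (hx : 1 < x) :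
    1 / x ≤ -Real.log (1 - 1 / x) ∧ -Real.log (1 - 1 / x) ≤ 1 / (x - 1) := by
  have h0 : 0 < 1 - 1 / x := by
    rw [sub_pos, div_lt_one (by linarith)]; exact hx
  constructor
  · have := Real.log_le_sub_one_of_pos h0
    linarith
  · have := Real.one_sub_inv_le_log_of_pos h0
    have h2 : (1 - 1 / x)⁻¹ = 1 + 1 / (x - 1) := by
      have : x - 1 ≠ 0 := by linarith
      have : x ≠ 0 := by linarith
      have h3 : 1 - 1 / x = (x - 1) / x := by field_simp
      rw [h3]
      field_simp
      ring
    rw [h2] at this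
    linarith

lemma mertensSum_succ (N : ℕ) : mertensSum (N + 1)
    = mertensSum N + if (N + 1).Prime then -Real.log (1 - 1 / ((N + 1 : ℕ) : ℝ)) else 0 :=
  sum_primesLe_succ (fun p => -Real.log (1 - 1 / (p : ℝ))) N

lemma log_log_sub_log_log_bounds {a b : ℝ} (ha : 0 < a) (hab : a ≤ b) (hb : b ≤ a + 1) :
    0 ≤ Real.log b - Real.log a - (b - a) / b ∧
      Real.log b - Real.log a - (b - a) / b ≤ 1 / a - 1 / b := by
  have hb0 : 0 < b := ha.trans_le hab
  rw [← Real.log_div hb0.ne' ha.ne']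
  have h1 := Real.one_sub_inv_le_log_of_pos (div_pos hb0 ha)
  have h2 := Real.log_le_sub_one_of_pos (div_pos hb0 ha)
  have h3 : (b - a) / b = 1 - (b / a)⁻¹ := by field_simp
  constructor
  · linarith
  · have h4 : b / a - 1 - (b - a) / b ≤ 1 / a - 1 / b := by
      have h5 : b / a - 1 - (b - a) / b = (b - a) * (1 / a - 1 / b) := by field_simp
      rw [h5]
      have h6 : 0 ≤ 1 / a - 1 / b := sub_nonneg.2 (one_div_le_one_div_of_le ha hab)
      nlinarith
    linarith

/-- The error in Mertens' first theorem. -/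
noncomputable def mertensErr (N : ℕ) : ℝ := ∑ p ∈ primesLe N, Real.log p / p - Real.log N

lemma abs_mertensSum_step {n : ℕ} (hn : 2 ≤ n) :
    |(mertensSum (n + 1) - Real.log (Real.log ((n + 1 : ℕ) : ℝ)))
        - (mertensSum n - Real.log (Real.log n))
        - (mertensErr (n + 1) / Real.log ((n + 1 : ℕ) : ℝ) - mertensErr n / Real.log n)|
      ≤ 4 * (1 / Real.log n - 1 / Real.log ((n + 1 : ℕ) : ℝ))
        + (1 / (n : ℝ) - 1 / ((n + 1 : ℕ) : ℝ)) := by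
  have hn2 : (2:ℝ) ≤ n := by exact_mod_cast hn
  have hR : |mertensErr n| ≤ 3 := abs_sum_log_div_primesLe_sub_log_le (by omega)
  have hstep : mertensErr (n + 1) = mertensErr n
      + (if (n + 1).Prime then Real.log ((n + 1 : ℕ) : ℝ) / ((n + 1 : ℕ) : ℝ) else 0)
      - (Real.log ((n + 1 : ℕ) : ℝ) - Real.log n) := by
    unfold mertensErr
    rw [sum_primesLe_succ (fun p => Real.log p / p)]
    ring
  rw [mertensSum_succ, hstep]
  have hcast : ((n + 1 : ℕ) : ℝ) = n + 1 := by push_cast; ring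
  rw [hcast]
  have ha : 0 < Real.log n := Real.log_pos (by linarith)
  have hab : Real.log n ≤ Real.log (n + 1 : ℝ) := Real.log_le_log (by linarith) (by linarith)
  have hb1 : Real.log (n + 1 : ℝ) ≤ Real.log n + 1 := by
    have h4 : Real.log (n + 1 : ℝ) = Real.log n + Real.log (1 + 1 / n) := by
      rw [← Real.log_mul (by positivity) (by positivity)]
      congr 1
      field_simp
    have h5 := Real.log_le_sub_one_of_pos (x := 1 + 1 / (n : ℝ)) (by positivity)
    have h6 : 1 / (n : ℝ) ≤ 1 := by rw [div_le_one (by linarith)]; linarith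
    linarith
  obtain ⟨h1, h2⟩ := log_log_sub_log_log_bounds ha hab hb1
  obtain ⟨h3, h4⟩ := neg_log_one_sub_inv_bounds (x := (n : ℝ) + 1) (by linarith)
  rw [add_sub_cancel_right] at h4
  set a := Real.log n
  set b := Real.log (n + 1 : ℝ)
  have hb0 : 0 < b := ha.trans_le hab
  set R := mertensErr n
  have hp : ∃ e : ℝ, 0 ≤ e ∧ e ≤ 1 / (n : ℝ) - 1 / ((n : ℝ) + 1) ∧
      (if (n + 1).Prime then -Real.log (1 - 1 / ((n : ℝ) + 1)) else 0)
        = (if (n + 1).Prime then b / ((n : ℝ) + 1) else 0) / b + e := by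
    split_ifs
    · refine ⟨-Real.log (1 - 1 / ((n : ℝ) + 1)) - 1 / ((n : ℝ) + 1), by linarith, by linarith, ?_⟩
      have : b / ((n : ℝ) + 1) / b = 1 / ((n : ℝ) + 1) := by field_simp
      rw [this]; ring
    · exact ⟨0, le_refl _, sub_nonneg.2 (one_div_le_one_div_of_le (by linarith) (by linarith)),
        by simp⟩
  obtain ⟨e, he0, he1, he⟩ := hp
  rw [he]
  set L := (if (n + 1).Prime then b / ((n : ℝ) + 1) else 0)
  have hid : (mertensSum n + (L / b + e) - Real.log b) - (mertensSum n - Real.log a)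
      - ((R + L - (b - a)) / b - R / a)
      = e - (Real.log b - Real.log a - (b - a) / b) + R * (1 / a - 1 / b) := by
    field_simp
    ring
  rw [hid]
  have hg : 0 ≤ 1 / a - 1 / b := sub_nonneg.2 (one_div_le_one_div_of_le ha hab)
  have hRg : |R * (1 / a - 1 / b)| ≤ 3 * (1 / a - 1 / b) := by
    rw [abs_mul, abs_of_nonneg hg]
    exact mul_le_mul_of_nonneg_right hR hg
  rw [abs_le] at hRg ⊢
  constructor <;> linarith [hRg.1, hRg.2]

lemma abs_mertensSum_sub_le {M N : ℕ} (hM : 2 ≤ M) (hMN : M ≤ N) :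
    |(mertensSum N - Real.log (Real.log N)) - (mertensSum M - Real.log (Real.log M))|
      ≤ 11 / Real.log M := by
  have key : ∀ N, M ≤ N →
      |(mertensSum N - Real.log (Real.log N)) - (mertensSum M - Real.log (Real.log M))
        - (mertensErr N / Real.log N - mertensErr M / Real.log M)|
      ≤ 4 * (1 / Real.log M - 1 / Real.log N) + (1 / (M : ℝ) - 1 / N) := by
    intro N hN
    induction N, hN using Nat.le_induction with
    | base => simp
    | succ n hn ih =>
      have h := abs_mertensSum_step (hM.trans hn)
      rw [abs_le] at h ih ⊢
      constructor <;> linarith [h.1, h.2, ih.1, ih.2]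
  have hM2 : (2:ℝ) ≤ M := by exact_mod_cast hM
  have hMN' : (M:ℝ) ≤ N := by exact_mod_cast hMN
  have h := key N hMN
  have ha : 0 < Real.log M := Real.log_pos (by linarith)
  have hab : Real.log M ≤ Real.log N := Real.log_le_log (by linarith) hMN'
  have hinv : 1 / Real.log N ≤ 1 / Real.log M := one_div_le_one_div_of_le ha hab
  have h1 : ∀ k : ℕ, M ≤ k → |mertensErr k / Real.log k| ≤ 3 * (1 / Real.log M) := by
    intro k hk
    have hk' : (M:ℝ) ≤ k := by exact_mod_cast hk
    have hlk : Real.log M ≤ Real.log k := Real.log_le_log (by linarith) hk'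
    have hR : |mertensErr k| ≤ 3 := abs_sum_log_div_primesLe_sub_log_le (by omega)
    rw [abs_div, abs_of_pos (ha.trans_le hlk), div_eq_mul_one_div]
    exact mul_le_mul hR (one_div_le_one_div_of_le ha hlk)
      (by have := ha.trans_le hlk; positivity) (by norm_num)
  have h2 := h1 N hMN
  have h3 := h1 M le_rfl
  have h4 : 1 / (M : ℝ) ≤ 1 / Real.log M :=
    one_div_le_one_div_of_le ha (Real.log_le_self (by linarith))
  have h5 : 0 < 1 / (N : ℝ) := by have : (0:ℝ) < N := by linarith
                                  positivity
  have h6 : 0 < 1 / Real.log N := by have := ha.trans_le hab; positivity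
  have h7 : 11 / Real.log M = 11 * (1 / Real.log M) := by ring
  rw [h7]
  rw [abs_le] at h h2 h3 ⊢
  constructor <;> linarith [h.1, h.2, h2.1, h2.2, h3.1, h3.2]

lemma tendsto_log_natCast_atTop : Tendsto (fun N : ℕ => Real.log N) atTop atTop :=
  Real.tendsto_log_atTop.comp tendsto_natCast_atTop_atTop

lemma exists_mertens_limit : ∃ c : ℝ,
    Tendsto (fun N : ℕ => mertensSum N - Real.log (Real.log N)) atTop (nhds c) ∧
    ∀ M : ℕ, 2 ≤ M → |mertensSum M - Real.log (Real.log M) - c| ≤ 11 / Real.log M := by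
  have hlim : Tendsto (fun N : ℕ => 11 / Real.log N) atTop (nhds 0) :=
    Tendsto.div_atTop tendsto_const_nhds tendsto_log_natCast_atTop
  have hc : CauchySeq (fun N : ℕ => mertensSum N - Real.log (Real.log N)) := by
    rw [Metric.cauchySeq_iff']
    intro δ hδ
    have h1 := (hlim.eventually (gt_mem_nhds hδ)).and (eventually_ge_atTop 2)
    obtain ⟨M, hM⟩ := h1.exists
    exact ⟨M, fun n hn => by
      rw [Real.dist_eq]
      exact (abs_mertensSum_sub_le hM.2 hn).trans_lt hM.1⟩
  obtain ⟨c, hc⟩ := cauchySeq_tendsto_of_complete hc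
  refine ⟨c, hc, fun M hM => ?_⟩
  have h1 : Tendsto (fun N : ℕ => |(mertensSum N - Real.log (Real.log N))
      - (mertensSum M - Real.log (Real.log M))|) atTop
      (nhds |c - (mertensSum M - Real.log (Real.log M))|) := (hc.sub_const _).abs
  rw [abs_sub_comm]
  exact le_of_tendsto h1 (eventually_atTop.2 ⟨M, fun N hN => abs_mertensSum_sub_le hM hN⟩)

lemma neg_log_one_sub_bounds {y : ℝ} (hy1 : y < 1) :
    y ≤ -Real.log (1 - y) ∧ -Real.log (1 - y) ≤ y / (1 - y) := by
  have h0 : 0 < 1 - y := by linarith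
  constructor
  · have := Real.log_le_sub_one_of_pos h0
    linarith
  · have := Real.one_sub_inv_le_log_of_pos h0
    have h2 : (1 - y)⁻¹ = 1 + y / (1 - y) := by
      field_simp
      ring
    linarith

/-- The terms of `∑_p -log (1 - 1/p) p^(-σ)`, extended by zero to all naturals. -/
noncomputable def mertensTerm (σ : ℝ) : ℕ → ℝ :=
  Set.indicator {n | n.Prime} fun n => -Real.log (1 - 1 / (n : ℝ)) * (n : ℝ) ^ (-σ)

/-- The terms of `∑_p -log (1 - p^(-1-σ))`, extended by zero to all naturals. -/
noncomputable def logZetaTerm (σ : ℝ) : ℕ → ℝ :=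
  Set.indicator {n | n.Prime} fun n => -Real.log (1 - (n : ℝ) ^ (-(1 + σ)))

lemma mertensTerm_nonneg (σ : ℝ) (n : ℕ) : 0 ≤ mertensTerm σ n := by
  refine Set.indicator_nonneg (fun n hn => ?_) n
  have hn2 : (2:ℝ) ≤ n := by exact_mod_cast Nat.Prime.two_le hn
  have := (neg_log_one_sub_inv_bounds (x := (n:ℝ)) (by linarith)).1
  have h2 : 0 ≤ -Real.log (1 - 1 / (n : ℝ)) := le_trans (by positivity) this
  positivity

lemma mertensTerm_le {σ : ℝ} (n : ℕ) : mertensTerm σ n ≤ 2 * (n : ℝ) ^ (-(1 + σ)) := by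
  by_cases hn : n.Prime
  · rw [mertensTerm, Set.indicator_of_mem (by exact hn)]
    have hn2 : (2:ℝ) ≤ n := by exact_mod_cast Nat.Prime.two_le hn
    have h1 := (neg_log_one_sub_inv_bounds (x := (n:ℝ)) (by linarith)).2
    have h2 : 1 / ((n:ℝ) - 1) ≤ 2 * (n:ℝ)⁻¹ := by
      rw [div_le_iff₀ (by linarith)]
      field_simp
      linarith
    have h3 : (n : ℝ) ^ (-(1 + σ)) = (n:ℝ)⁻¹ * (n : ℝ) ^ (-σ) := by
      rw [neg_add, Real.rpow_add (by linarith), Real.rpow_neg_one]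
    rw [h3, ← mul_assoc]
    exact mul_le_mul_of_nonneg_right (h1.trans h2) (by positivity)
  · rw [mertensTerm, Set.indicator_of_notMem (by exact hn)]
    positivity

lemma summable_mertensTerm {σ : ℝ} (hσ : 0 < σ) : Summable (mertensTerm σ) :=
  Summable.of_nonneg_of_le (mertensTerm_nonneg σ) mertensTerm_le
    ((Real.summable_nat_rpow.2 (by linarith)).mul_left 2)

lemma rpow_neg_one_add_le_half {σ : ℝ} (hσ : 0 < σ) {n : ℕ} (hn : n.Prime) :
    (n : ℝ) ^ (-(1 + σ)) ≤ 1 / 2 := by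
  have hn2 : (2:ℝ) ≤ n := by exact_mod_cast Nat.Prime.two_le hn
  calc (n : ℝ) ^ (-(1 + σ)) ≤ (n : ℝ) ^ (-1 : ℝ) :=
        Real.rpow_le_rpow_of_exponent_le (by linarith) (by linarith)
    _ = 1 / (n:ℝ) := by rw [Real.rpow_neg_one, one_div]
    _ ≤ 1 / 2 := one_div_le_one_div_of_le (by norm_num) hn2

lemma logZetaTerm_nonneg {σ : ℝ} (hσ : 0 < σ) (n : ℕ) : 0 ≤ logZetaTerm σ n := by
  refine Set.indicator_nonneg (fun n hn => ?_) n
  have h0 : (0:ℝ) ≤ (n : ℝ) ^ (-(1 + σ)) := by positivity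
  exact h0.trans (neg_log_one_sub_bounds
    (by linarith [rpow_neg_one_add_le_half hσ hn])).1

lemma summable_logZetaTerm {σ : ℝ} (hσ : 0 < σ) : Summable (logZetaTerm σ) := by
  refine Summable.of_nonneg_of_le (logZetaTerm_nonneg hσ) (fun n => ?_)
    ((Real.summable_nat_rpow.2 (show -(1 + σ) < -1 by linarith)).mul_left 2)
  by_cases hn : n.Prime
  · rw [logZetaTerm, Set.indicator_of_mem (by exact hn)]
    have h0 : (0:ℝ) ≤ (n : ℝ) ^ (-(1 + σ)) := by positivity
    have h1 := rpow_neg_one_add_le_half hσ hn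
    refine (neg_log_one_sub_bounds (by linarith)).2.trans ?_
    rw [div_le_iff₀ (by linarith)]
    nlinarith
  · rw [logZetaTerm, Set.indicator_of_notMem (by exact hn)]
    positivity

lemma exp_tsum_logZetaTerm {σ : ℝ} (hσ : 0 < σ) :
    Real.exp (∑' n, logZetaTerm σ n) = ∑' n : ℕ, 1 / (n : ℝ) ^ (1 + σ) := by
  let f : ℕ →*₀ ℝ :=
    { toFun := fun n => (n : ℝ) ^ (-(1 + σ))
      map_zero' := by
        rw [Nat.cast_zero, Real.zero_rpow (by linarith)]
      map_one' := by simp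
      map_mul' := fun m n => by
        rw [Nat.cast_mul, Real.mul_rpow (Nat.cast_nonneg _) (Nat.cast_nonneg _)] }
  have hf : ∀ n : ℕ, f n = (n : ℝ) ^ (-(1 + σ)) := fun n => rfl
  have hsum : Summable fun n => ‖f n‖ := by
    refine (Real.summable_nat_rpow.2 (show -(1 + σ) < -1 by linarith)).congr fun n => ?_
    rw [hf, Real.norm_of_nonneg (by positivity)]
  have h1 := EulerProduct.eulerProduct_completely_multiplicative_tprod hsum
  have hlog : ∀ p : Nat.Primes, Real.log ((1 - f p)⁻¹) = -Real.log (1 - (p : ℝ) ^ (-(1 + σ))) := by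
    intro p
    rw [Real.log_inv, hf]
  have hind : ∀ p : Nat.Primes, logZetaTerm σ p = Real.log ((1 - f p)⁻¹) := by
    intro p
    rw [hlog, logZetaTerm, Set.indicator_of_mem (by exact p.2)]
  have hs : Summable fun p : Nat.Primes => Real.log ((1 - f p)⁻¹) := by
    refine ((summable_logZetaTerm hσ).comp_injective
      (i := fun p : Nat.Primes => (p : ℕ)) Subtype.val_injective).congr fun p => ?_
    exact hind p
  have h2 := Real.rexp_tsum_eq_tprod (f := fun p : Nat.Primes => (1 - f p)⁻¹) (fun p => by
    have := rpow_neg_one_add_le_half hσ p.2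
    rw [inv_pos, hf]
    linarith) hs
  rw [h1] at h2
  have h3 : ∑' n, logZetaTerm σ n = ∑' p : Nat.Primes, Real.log ((1 - f p)⁻¹) := by
    have h4 := tsum_subtype {n : ℕ | n.Prime} (fun n : ℕ => -Real.log (1 - (n : ℝ) ^ (-(1 + σ))))
    rw [show logZetaTerm σ = Set.indicator {n | n.Prime}
      fun n : ℕ => -Real.log (1 - (n : ℝ) ^ (-(1 + σ))) from rfl, ← h4]
    exact tsum_congr fun p => (hlog p).symm
  rw [h3, h2]
  refine tsum_congr fun n => ?_
  rw [hf, Real.rpow_neg (Nat.cast_nonneg _), one_div]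

lemma tendsto_tsum_logZetaTerm_add_log :
    Tendsto (fun σ : ℝ => ∑' n, logZetaTerm σ n + Real.log σ)
      (nhdsWithin 0 (Set.Ioi 0)) (nhds 0) := by
  have h1 : Tendsto (fun σ : ℝ => 1 + σ) (nhdsWithin 0 (Set.Ioi 0))
      (nhdsWithin 1 (Set.Ioi 1)) := by
    refine tendsto_nhdsWithin_of_tendsto_nhds_of_eventually_within _ ?_ ?_
    · have : Tendsto (fun σ : ℝ => 1 + σ) (nhds 0) (nhds (1 + 0)) := by
        exact (continuous_const.add continuous_id).tendsto 0
      rw [add_zero] at this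
      exact this.mono_left nhdsWithin_le_nhds
    · filter_upwards [self_mem_nhdsWithin] with σ hσ
      simp only [Set.mem_Ioi] at hσ ⊢
      linarith
  have h2 := tendsto_sub_mul_tsum_nat_rpow.comp h1
  have h3 := h2.log one_ne_zero
  rw [Real.log_one] at h3
  refine h3.congr' ?_
  filter_upwards [self_mem_nhdsWithin] with σ hσ
  simp only [Set.mem_Ioi] at hσ
  simp only [Function.comp, add_sub_cancel_left]
  rw [← exp_tsum_logZetaTerm hσ, Real.log_mul hσ.ne' (Real.exp_ne_zero _), Real.log_exp, add_comm]

lemma abs_mertensTerm_sub_logZetaTerm_le {σ : ℝ} (hσ : 0 < σ) (n : ℕ) :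
    |mertensTerm σ n - logZetaTerm σ n| ≤ 2 * (n : ℝ) ^ (-2 : ℝ) := by
  by_cases hn : n.Prime
  · rw [mertensTerm, logZetaTerm, Set.indicator_of_mem (by exact hn),
      Set.indicator_of_mem (by exact hn)]
    have hn2 : (2:ℝ) ≤ n := by exact_mod_cast Nat.Prime.two_le hn
    have hsplit : (n : ℝ) ^ (-(1 + σ)) = 1 / (n:ℝ) * (n : ℝ) ^ (-σ) := by
      rw [neg_add, Real.rpow_add (by linarith), Real.rpow_neg_one, one_div]
    have hsq : (n : ℝ) ^ (-2 : ℝ) = (1 / (n:ℝ)) ^ 2 := by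
      rw [Real.rpow_neg (by linarith), one_div, inv_pow]
      norm_cast
    have hy : 1 / (n : ℝ) ≤ 1 / 2 := one_div_le_one_div_of_le (by norm_num) hn2
    have hw1 : (n : ℝ) ^ (-σ) ≤ 1 :=
      Real.rpow_le_one_of_one_le_of_nonpos (by linarith) (by linarith)
    have hw0 : 0 ≤ (n : ℝ) ^ (-σ) := by positivity
    rw [hsplit, hsq]
    have hy0 : 0 ≤ 1 / (n : ℝ) := by positivity
    generalize 1 / (n : ℝ) = y at *
    generalize (n : ℝ) ^ (-σ) = w at *
    have hyw : y * w ≤ y := mul_le_of_le_one_right hy0 hw1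
    have hyw0 : 0 ≤ y * w := mul_nonneg hy0 hw0
    obtain ⟨h1, h2⟩ := neg_log_one_sub_bounds (y := y) (by linarith)
    obtain ⟨h3, h4⟩ := neg_log_one_sub_bounds (y := y * w) (by linarith)
    have h5 : y / (1 - y) ≤ y + 2 * y ^ 2 := by
      rw [div_le_iff₀ (by linarith)]
      nlinarith [mul_nonneg (sq_nonneg y) (by linarith : 0 ≤ 1 - 2 * y)]
    have h6 : y * w / (1 - y * w) ≤ y * w + 2 * y ^ 2 := by
      have h7 : y * w / (1 - y * w) ≤ y * w + 2 * (y * w) ^ 2 := by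
        rw [div_le_iff₀ (by linarith)]
        nlinarith [mul_nonneg (sq_nonneg (y * w)) (by linarith : 0 ≤ 1 - 2 * (y * w))]
      have h8 : (y * w) ^ 2 ≤ y ^ 2 := pow_le_pow_left₀ hyw0 hyw 2
      linarith
    have h9 := mul_le_mul_of_nonneg_right h1 hw0
    have h10 : -Real.log (1 - y) * w ≤ y * w + 2 * y ^ 2 := by
      have := mul_le_mul_of_nonneg_right (h2.trans h5) hw0
      nlinarith [sq_nonneg y]
    rw [abs_le]
    constructor <;> linarith
  · rw [mertensTerm, logZetaTerm, Set.indicator_of_notMem (by exact hn),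
      Set.indicator_of_notMem (by exact hn), sub_zero, abs_zero]
    positivity

lemma tendsto_tsum_mertensTerm_sub :
    Tendsto (fun σ : ℝ => ∑' n, mertensTerm σ n - ∑' n, logZetaTerm σ n)
      (nhdsWithin 0 (Set.Ioi 0)) (nhds 0) := by
  have h1 : Tendsto (fun σ : ℝ => ∑' n, (mertensTerm σ n - logZetaTerm σ n))
      (nhdsWithin 0 (Set.Ioi 0)) (nhds (∑' _ : ℕ, (0:ℝ))) := by
    refine tendsto_tsum_of_dominated_convergence
      (bound := fun n : ℕ => 2 * (n : ℝ) ^ (-2 : ℝ))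
      ((Real.summable_nat_rpow.2 (by norm_num)).mul_left 2) (fun n => ?_) ?_
    · refine Tendsto.mono_left ?_ nhdsWithin_le_nhds
      by_cases hn : n.Prime
      · have hn2 : (2:ℝ) ≤ n := by exact_mod_cast Nat.Prime.two_le hn
        simp only [mertensTerm, logZetaTerm]
        simp only [Set.indicator_of_mem (show n ∈ {n : ℕ | n.Prime} from hn)]
        have hc : ContinuousAt (fun σ : ℝ => -Real.log (1 - 1 / (n : ℝ)) * (n : ℝ) ^ (-σ)
            - -Real.log (1 - (n : ℝ) ^ (-(1 + σ)))) 0 := by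
          have hn0 : (n : ℝ) ≠ 0 := by linarith
          have e1 : ContinuousAt (fun σ : ℝ => (n : ℝ) ^ (-σ)) 0 :=
            ContinuousAt.rpow continuousAt_const continuousAt_id.neg (Or.inl hn0)
          have e2 : ContinuousAt (fun σ : ℝ => (n : ℝ) ^ (-(1 + σ))) 0 :=
            ContinuousAt.rpow continuousAt_const
              (continuousAt_const.add continuousAt_id).neg (Or.inl hn0)
          refine (continuousAt_const.mul e1).sub
            ((continuousAt_const.sub e2).log ?_).neg
          change 1 - (n : ℝ) ^ (-(1 + (0:ℝ))) ≠ 0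
          rw [add_zero, Real.rpow_neg_one]
          have : (n:ℝ)⁻¹ < 1 := inv_lt_one_of_one_lt₀ (by linarith)
          linarith
        have h2 := hc.tendsto
        simpa [Real.rpow_neg_one] using h2
      · simp only [mertensTerm, logZetaTerm]
        simp only [Set.indicator_of_notMem (show n ∉ {n : ℕ | n.Prime} from hn), sub_zero]
        exact tendsto_const_nhds
    · filter_upwards [self_mem_nhdsWithin] with σ hσ n
      rw [Real.norm_eq_abs]
      exact abs_mertensTerm_sub_logZetaTerm_le hσ n
  rw [tsum_zero] at h1
  refine h1.congr' ?_
  filter_upwards [self_mem_nhdsWithin] with σ hσ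
  exact (summable_mertensTerm hσ).tsum_sub (summable_logZetaTerm hσ)

/-- The part of `∑_p -log (1 - 1/p)` with `⌈log p⌉ = k`. -/
noncomputable def mertensBlock (k : ℕ) : ℝ :=
  ∑ p ∈ (primesLe ⌊Real.exp k⌋₊).filter (fun p : ℕ => ⌈Real.log p⌉₊ = k), -Real.log (1 - 1 / (p : ℝ))

lemma mem_primesLe_floor_exp {p m : ℕ} :
    p ∈ primesLe ⌊Real.exp m⌋₊ ↔ p.Prime ∧ ⌈Real.log p⌉₊ ≤ m := by
  rw [mem_primesLe]
  refine and_congr_right fun hp => ?_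
  have hp0 : (0:ℝ) < p := by exact_mod_cast hp.pos
  rw [Nat.le_floor_iff (Real.exp_pos _).le, Nat.ceil_le, Real.log_le_iff_le_exp hp0]

lemma sum_mertensBlock (m : ℕ) :
    ∑ k ∈ range (m + 1), mertensBlock k = mertensSum ⌊Real.exp m⌋₊ := by
  unfold mertensSum
  rw [← Finset.sum_fiberwise_of_maps_to (s := primesLe ⌊Real.exp m⌋₊) (t := range (m + 1))
    (g := fun p : ℕ => ⌈Real.log p⌉₊) ?_ (fun p : ℕ => -Real.log (1 - 1 / (p : ℝ)))]
  · refine sum_congr rfl fun k hk => ?_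
    have hkm : k ≤ m := by simpa [Nat.lt_succ_iff] using hk
    have hs : (primesLe ⌊Real.exp k⌋₊).filter (fun p : ℕ => ⌈Real.log p⌉₊ = k)
        = (primesLe ⌊Real.exp m⌋₊).filter (fun p : ℕ => ⌈Real.log p⌉₊ = k) := by
      ext p
      simp only [mem_filter, mem_primesLe_floor_exp]
      constructor
      · rintro ⟨⟨h1, h2⟩, h3⟩
        exact ⟨⟨h1, by omega⟩, h3⟩
      · rintro ⟨⟨h1, h2⟩, h3⟩
        exact ⟨⟨h1, by omega⟩, h3⟩
    rw [mertensBlock, hs]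
  · intro p hp
    have := (mem_primesLe_floor_exp.1 hp).2
    exact mem_range.2 (by omega)

/-- The terms of `∑_p -log (1 - 1/p) e^(-σ⌈log p⌉)`, extended by zero to all naturals. -/
noncomputable def ceilTerm (σ : ℝ) : ℕ → ℝ :=
  Set.indicator {n | n.Prime} fun n => -Real.log (1 - 1 / (n : ℝ)) *
    Real.exp (-σ) ^ ⌈Real.log n⌉₊

lemma ceilTerm_bounds {σ : ℝ} (hσ : 0 < σ) (n : ℕ) :
    Real.exp (-σ) * mertensTerm σ n ≤ ceilTerm σ n ∧ ceilTerm σ n ≤ mertensTerm σ n := by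
  by_cases hn : n.Prime
  · rw [ceilTerm, mertensTerm, Set.indicator_of_mem (by exact hn),
      Set.indicator_of_mem (by exact hn)]
    have hn2 : (2:ℝ) ≤ n := by exact_mod_cast Nat.Prime.two_le hn
    have ha : 0 ≤ -Real.log (1 - 1 / (n : ℝ)) :=
      le_trans (by positivity) (neg_log_one_sub_inv_bounds (x := (n:ℝ)) (by linarith)).1
    have hl : 0 ≤ Real.log n := Real.log_natCast_nonneg n
    have h1 := Nat.le_ceil (Real.log n)
    have h2 := (Nat.ceil_lt_add_one hl).le
    have h3 : (n : ℝ) ^ (-σ) = Real.exp (-σ * Real.log n) := by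
      rw [Real.rpow_def_of_pos (by linarith), mul_comm]
    rw [h3, ← Real.exp_nat_mul]
    constructor
    · rw [mul_left_comm, ← Real.exp_add]
      refine mul_le_mul_of_nonneg_left (Real.exp_le_exp.2 ?_) ha
      nlinarith
    · refine mul_le_mul_of_nonneg_left (Real.exp_le_exp.2 ?_) ha
      nlinarith
  · rw [ceilTerm, mertensTerm, Set.indicator_of_notMem (by exact hn),
      Set.indicator_of_notMem (by exact hn), mul_zero]
    exact ⟨le_refl _, le_refl _⟩

lemma summable_ceilTerm {σ : ℝ} (hσ : 0 < σ) : Summable (ceilTerm σ) :=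
  Summable.of_nonneg_of_le
    (fun n => le_trans (mul_nonneg (Real.exp_pos _).le (mertensTerm_nonneg σ n))
      (ceilTerm_bounds hσ n).1)
    (fun n => (ceilTerm_bounds hσ n).2) (summable_mertensTerm hσ)

lemma mertensBlock_mul_eq_tsum (σ : ℝ) (k : ℕ) : mertensBlock k * Real.exp (-σ) ^ k
    = ∑' b : ((fun n : ℕ => ⌈Real.log n⌉₊) ⁻¹' {k}), ceilTerm σ b := by
  rw [tsum_subtype ((fun n : ℕ => ⌈Real.log n⌉₊) ⁻¹' {k}) (ceilTerm σ),
    tsum_eq_sum (s := (primesLe ⌊Real.exp k⌋₊).filter (fun p : ℕ => ⌈Real.log p⌉₊ = k))]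
  · rw [mertensBlock, sum_mul]
    refine Finset.sum_congr rfl ?_
    intro p hp
    obtain ⟨h1, h2⟩ := mem_filter.1 hp
    rw [Set.indicator_of_mem (by exact h2), ceilTerm,
      Set.indicator_of_mem (by exact (mem_primesLe.1 h1).1), h2]
  · intro p hp
    by_cases h1 : ⌈Real.log p⌉₊ = k
    · rw [Set.indicator_of_mem (by exact h1), ceilTerm]
      refine Set.indicator_of_notMem ?_ _
      intro h2
      exact hp (mem_filter.2 ⟨mem_primesLe_floor_exp.2 ⟨h2, h1.le⟩, h1⟩)
    · exact Set.indicator_of_notMem (by exact h1) _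

lemma hasSum_mertensBlock {σ : ℝ} (hσ : 0 < σ) :
    HasSum (fun k => mertensBlock k * Real.exp (-σ) ^ k) (∑' n, ceilTerm σ n) := by
  have h := (summable_ceilTerm hσ).hasSum.tsum_fiberwise (fun n : ℕ => ⌈Real.log n⌉₊)
  have hk : (fun k => mertensBlock k * Real.exp (-σ) ^ k)
      = fun k => ∑' b : ((fun n : ℕ => ⌈Real.log n⌉₊) ⁻¹' {k}), ceilTerm σ b := by
    funext k
    exact mertensBlock_mul_eq_tsum σ k
  rw [hk]
  exact h

lemma hasSum_inv_mul_pow {x : ℝ} (hx : |x| < 1) :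
    HasSum (fun k : ℕ => (k : ℝ)⁻¹ * x ^ k) (-Real.log (1 - x)) := by
  have h := Real.hasSum_pow_div_log_of_abs_lt_one hx
  rw [← hasSum_nat_add_iff' 1]
  simp only [range_one, sum_singleton, Nat.cast_zero, inv_zero, zero_mul, sub_zero]
  have hk : (fun n : ℕ => ((n + 1 : ℕ) : ℝ)⁻¹ * x ^ (n + 1))
      = fun n : ℕ => x ^ (n + 1) / ((n : ℝ) + 1) := by
    funext k
    push_cast
    rw [div_eq_inv_mul]
  rw [hk]
  exact h

lemma tendsto_sum_mertensBlock_sub {c : ℝ}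
    (hc : Tendsto (fun N : ℕ => mertensSum N - Real.log (Real.log N)) atTop (nhds c)) :
    Tendsto (fun n => ∑ k ∈ range n, (mertensBlock k - (k : ℝ)⁻¹)) atTop
      (nhds (c - Real.eulerMascheroniConstant)) := by
  rw [← tendsto_add_atTop_iff_nat 1]
  have hfl : Tendsto (fun m : ℕ => ⌊Real.exp m⌋₊) atTop atTop :=
    tendsto_nat_floor_atTop.comp (Real.tendsto_exp_atTop.comp tendsto_natCast_atTop_atTop)
  have h1 := hc.comp hfl
  have hratio : Tendsto (fun m : ℕ => Real.log (⌊Real.exp m⌋₊ : ℝ) / m) atTop (nhds 1) := by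
    have hlow : Tendsto (fun m : ℕ => 1 - 1 / (m : ℝ)) atTop (nhds (1 - 0)) :=
      tendsto_const_nhds.sub tendsto_one_div_atTop_nhds_zero_nat
    rw [sub_zero] at hlow
    refine tendsto_of_tendsto_of_tendsto_of_le_of_le' hlow tendsto_const_nhds ?_ ?_
    · filter_upwards [eventually_ge_atTop 1] with m hm
      have hm1 : (1:ℝ) ≤ m := by exact_mod_cast hm
      rw [le_div_iff₀ (by linarith)]
      have e1 : (1 - 1 / (m:ℝ)) * m = m - 1 := by field_simp
      rw [e1]
      have e2 : Real.exp ((m:ℝ) - 1) ≤ ⌊Real.exp m⌋₊ := by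
        have e3 := (Nat.lt_floor_add_one (Real.exp (m:ℝ))).le
        have e4 : Real.exp (m:ℝ) = Real.exp ((m:ℝ) - 1) * Real.exp 1 := by
          rw [← Real.exp_add]; congr 1; ring
        have e5 : 2 ≤ Real.exp 1 := by linarith [Real.add_one_le_exp (1:ℝ)]
        have e6 : 1 ≤ Real.exp ((m:ℝ) - 1) := Real.one_le_exp (by linarith)
        nlinarith
      calc (m:ℝ) - 1 = Real.log (Real.exp ((m:ℝ) - 1)) := (Real.log_exp _).symm
        _ ≤ _ := Real.log_le_log (Real.exp_pos _) e2
    · filter_upwards [eventually_ge_atTop 1] with m hm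
      have hm1 : (1:ℝ) ≤ m := by exact_mod_cast hm
      rw [div_le_one (by linarith)]
      have e1 : (0:ℝ) < ⌊Real.exp m⌋₊ := by
        have : 0 < ⌊Real.exp m⌋₊ := Nat.floor_pos.2 (Real.one_le_exp (by linarith))
        exact_mod_cast this
      rw [Real.log_le_iff_le_exp e1]
      exact Nat.floor_le (Real.exp_pos _).le
  have h2 := hratio.log one_ne_zero
  rw [Real.log_one] at h2
  have h3 := Real.tendsto_harmonic_sub_log
  have h4 := (h1.add h2).sub h3
  rw [add_zero] at h4
  refine h4.congr' ?_
  filter_upwards [eventually_ge_atTop 2] with m hm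
  have hm2 : (2:ℝ) ≤ m := by exact_mod_cast hm
  simp only [Function.comp]
  have h5 : ∑ k ∈ range (m + 1), (k : ℝ)⁻¹ = (harmonic m : ℝ) := by
    rw [sum_range_succ', harmonic]
    push_cast
    simp
  have h6 : 0 < Real.log (⌊Real.exp m⌋₊ : ℝ) := by
    refine Real.log_pos ?_
    have e1 : 2 ≤ ⌊Real.exp m⌋₊ := Nat.le_floor (by
      push_cast
      linarith [Real.add_one_le_exp (m:ℝ)])
    have e2 : (2:ℝ) ≤ ⌊Real.exp m⌋₊ := by exact_mod_cast e1
    linarith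
  rw [sum_sub_distrib, sum_mertensBlock, h5, Real.log_div h6.ne' (by linarith)]
  ring

lemma tendsto_exp_neg_nhdsLT_one :
    Tendsto (fun σ : ℝ => Real.exp (-σ)) (nhdsWithin 0 (Set.Ioi 0)) (nhdsWithin 1 (Set.Iio 1)) := by
  refine tendsto_nhdsWithin_of_tendsto_nhds_of_eventually_within _ ?_ ?_
  · have h : Continuous fun σ : ℝ => Real.exp (-σ) := by fun_prop
    have h2 := h.tendsto 0
    rw [neg_zero, Real.exp_zero] at h2
    exact h2.mono_left nhdsWithin_le_nhds
  · filter_upwards [self_mem_nhdsWithin] with σ hσ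
    exact Real.exp_lt_one_iff.2 (neg_lt_zero.2 hσ)

lemma tendsto_log_one_sub_exp_neg_sub_log :
    Tendsto (fun σ : ℝ => Real.log (1 - Real.exp (-σ)) - Real.log σ)
      (nhdsWithin 0 (Set.Ioi 0)) (nhds 0) := by
  have h1 : HasDerivAt (fun σ : ℝ => 1 - Real.exp (-σ)) 1 0 := by
    have := ((hasDerivAt_neg (0:ℝ)).exp).const_sub 1
    simpa using this
  have h2 := (hasDerivAt_iff_tendsto_slope.1 h1).mono_left
    (nhdsWithin_mono 0 (fun x (hx : 0 < x) => hx.ne' : Set.Ioi (0:ℝ) ⊆ {0}ᶜ))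
  have h3 := h2.log one_ne_zero
  rw [Real.log_one] at h3
  refine h3.congr' ?_
  filter_upwards [self_mem_nhdsWithin] with σ hσ
  have hσ : 0 < σ := hσ
  have : Real.exp (-σ) < 1 := Real.exp_lt_one_iff.2 (by linarith)
  rw [slope_def_field, neg_zero, Real.exp_zero, sub_self, sub_zero, sub_zero,
    Real.log_div (by linarith) hσ.ne']

lemma tendsto_tsum_ceilTerm_add_log :
    Tendsto (fun σ : ℝ => ∑' n, ceilTerm σ n + Real.log (1 - Real.exp (-σ)))
      (nhdsWithin 0 (Set.Ioi 0)) (nhds 0) := by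
  have h1 := tendsto_tsum_mertensTerm_sub
  have h2 := tendsto_tsum_logZetaTerm_add_log
  have h3 := tendsto_log_one_sub_exp_neg_sub_log
  have hσ0 : Tendsto (fun σ : ℝ => σ) (nhdsWithin 0 (Set.Ioi 0)) (nhds 0) :=
    tendsto_id.mono_left nhdsWithin_le_nhds
  have hlog : Tendsto (fun σ : ℝ => σ * Real.log σ) (nhdsWithin 0 (Set.Ioi 0)) (nhds 0) := by
    have := Real.continuous_mul_log.tendsto 0
    simp only [zero_mul] at this
    exact this.mono_left nhdsWithin_le_nhds
  have h4 : Tendsto (fun σ : ℝ => σ * ∑' n, mertensTerm σ n) (nhdsWithin 0 (Set.Ioi 0))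
      (nhds 0) := by
    have h5 := (hσ0.mul (h1.add h2)).sub hlog
    rw [add_zero, mul_zero, sub_zero] at h5
    refine h5.congr fun σ => ?_
    ring
  have h6 : Tendsto (fun σ : ℝ => ∑' n, ceilTerm σ n - ∑' n, mertensTerm σ n)
      (nhdsWithin 0 (Set.Ioi 0)) (nhds 0) := by
    have h4' := h4.neg
    rw [neg_zero] at h4'
    refine tendsto_of_tendsto_of_tendsto_of_le_of_le' h4' tendsto_const_nhds ?_ ?_
    · filter_upwards [self_mem_nhdsWithin] with σ hσ
      simp only [Set.mem_Ioi] at hσ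
      have e1 : Real.exp (-σ) * ∑' n, mertensTerm σ n ≤ ∑' n, ceilTerm σ n := by
        rw [← tsum_mul_left]
        exact Summable.tsum_le_tsum (fun n => (ceilTerm_bounds hσ n).1)
          ((summable_mertensTerm hσ).mul_left _) (summable_ceilTerm hσ)
      have e2 : 0 ≤ ∑' n, mertensTerm σ n := tsum_nonneg (mertensTerm_nonneg σ)
      have e3 := Real.add_one_le_exp (-σ)
      nlinarith
    · filter_upwards [self_mem_nhdsWithin] with σ hσ
      simp only [Set.mem_Ioi] at hσ
      rw [sub_nonpos]
      exact Summable.tsum_le_tsum (fun n => (ceilTerm_bounds hσ n).2)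
        (summable_ceilTerm hσ) (summable_mertensTerm hσ)
  have h7 := ((h6.add h1).add h2).add h3
  simp only [add_zero] at h7
  refine h7.congr fun σ => ?_
  ring

/-- **Mertens' second theorem** in product form, with the value of the constant. -/
theorem abs_mertensSum_sub_le_div_log {M : ℕ} (hM : 2 ≤ M) :
    |mertensSum M - Real.log (Real.log M) - Real.eulerMascheroniConstant| ≤ 11 / Real.log M := by
  obtain ⟨c, hc, hbound⟩ := exists_mertens_limit
  have h1 := (Real.tendsto_tsum_powerSeries_nhdsWithin_lt (tendsto_sum_mertensBlock_sub hc)).comp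
    tendsto_exp_neg_nhdsLT_one
  have h2 : c - Real.eulerMascheroniConstant = 0 := by
    refine tendsto_nhds_unique h1 (tendsto_tsum_ceilTerm_add_log.congr' ?_)
    filter_upwards [self_mem_nhdsWithin] with σ hσ
    simp only [Set.mem_Ioi] at hσ
    have hx : |Real.exp (-σ)| < 1 := by
      rw [abs_of_pos (Real.exp_pos _)]
      exact Real.exp_lt_one_iff.2 (by linarith)
    have h3 := (hasSum_mertensBlock hσ).sub (hasSum_inv_mul_pow hx)
    rw [sub_neg_eq_add] at h3
    rw [← h3.tsum_eq]
    simp only [Function.comp]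
    exact tsum_congr fun k => by ring
  rw [← sub_eq_zero.1 h2]
  exact hbound M hM

/-- The coefficient of `χ(p)² p^(-2s)` in the Euler factor of `Q_X` at `p`. -/
noncomputable def tailWeight (X : ℝ) (p : ℕ) : ℝ := if Real.sqrt X < p then 1 / 2 else 0

lemma tailWeight_nonneg (X : ℝ) (p : ℕ) : 0 ≤ tailWeight X p := by
  unfold tailWeight; split_ifs <;> norm_num

lemma tailWeight_le_one (X : ℝ) (p : ℕ) : tailWeight X p ≤ 1 := by
  unfold tailWeight; split_ifs <;> norm_num

lemma exp_neg_mertensSum (N : ℕ) :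
    Real.exp (-mertensSum N) = ∏ p ∈ primesLe N, (1 - 1 / (p : ℝ)) := by
  rw [mertensSum, ← sum_neg_distrib, Real.exp_sum]
  refine prod_congr rfl fun p hp => ?_
  have hp2 : (2:ℝ) ≤ p := by exact_mod_cast (mem_primesLe.1 hp).1.two_le
  have : 1 / (p:ℝ) ≤ 1 / 2 := one_div_le_one_div_of_le (by norm_num) hp2
  rw [neg_neg, Real.exp_log (by linarith)]

lemma abs_exp_sub_one_le_mul_exp (w : ℝ) : |Real.exp w - 1| ≤ |w| * Real.exp |w| := by
  have h1 := Real.add_one_le_exp w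
  have h2 := Real.add_one_le_exp (-w)
  have h3 : Real.exp w * Real.exp (-w) = 1 := by rw [← Real.exp_add]; simp
  have h4 : 1 ≤ Real.exp |w| := Real.one_le_exp (abs_nonneg w)
  have h5 : Real.exp w ≤ Real.exp |w| := Real.exp_le_exp.2 (le_abs_self w)
  have h6 := Real.exp_pos w
  rw [abs_le]
  constructor
  · have h7 : |w| ≤ |w| * Real.exp |w| := le_mul_of_one_le_right (abs_nonneg w) h4
    linarith [neg_abs_le w]
  · have h7 : Real.exp w - 1 ≤ w * Real.exp w := by nlinarith
    have h8 : w * Real.exp w ≤ |w| * Real.exp w :=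
      mul_le_mul_of_nonneg_right (le_abs_self w) h6.le
    have h9 : |w| * Real.exp w ≤ |w| * Real.exp |w| :=
      mul_le_mul_of_nonneg_left h5 (abs_nonneg w)
    linarith

lemma floor_log_bounds {X : ℝ} (hX : 2 ≤ X) :
    2 ≤ ⌊X⌋₊ ∧ Real.log ⌊X⌋₊ ≤ Real.log X ∧ Real.log X ≤ Real.log ⌊X⌋₊ + 1 ∧
      Real.log X ≤ 2 * Real.log ⌊X⌋₊ := by
  have h1 : 2 ≤ ⌊X⌋₊ := Nat.le_floor (by exact_mod_cast hX)
  have h2 : (2:ℝ) ≤ ⌊X⌋₊ := by exact_mod_cast h1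
  have h3 := Nat.floor_le (show 0 ≤ X by linarith)
  have h4 := (Nat.lt_floor_add_one X).le
  set N : ℝ := (⌊X⌋₊ : ℝ)
  refine ⟨h1, Real.log_le_log (by linarith) h3, ?_, ?_⟩
  · have h5 : X ≤ N * Real.exp 1 := by
      have : 2 ≤ Real.exp 1 := by linarith [Real.add_one_le_exp (1:ℝ)]
      nlinarith
    have h6 := Real.log_le_log (by linarith) h5
    rwa [Real.log_mul (by linarith) (Real.exp_ne_zero _), Real.log_exp] at h6
  · have h5 : X ≤ N ^ 2 := by nlinarith
    have h6 := Real.log_le_log (by linarith) h5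
    rw [Real.log_pow] at h6
    exact_mod_cast h6

lemma prod_correction_bounds {X : ℝ} (hX : 2 ≤ X) :
    1 ≤ ∏ p ∈ primesLe ⌊X⌋₊, (1 + tailWeight X p ^ 2 / (p * ((p:ℝ) - 1))) ∧
      ∏ p ∈ primesLe ⌊X⌋₊, (1 + tailWeight X p ^ 2 / (p * ((p:ℝ) - 1)))
        ≤ Real.exp (1 / Real.log X) := by
  have hlX : 0 < Real.log X := Real.log_pos (by linarith)
  have hnn : ∀ p ∈ primesLe ⌊X⌋₊, 0 ≤ tailWeight X p ^ 2 / (p * ((p:ℝ) - 1)) := by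
    intro p hp
    have hp2 : (2:ℝ) ≤ p := by exact_mod_cast (mem_primesLe.1 hp).1.two_le
    have : 0 ≤ (p:ℝ) - 1 := by linarith
    positivity
  constructor
  · exact Finset.one_le_prod fun p hp => by linarith [hnn p hp]
  · calc ∏ p ∈ primesLe ⌊X⌋₊, (1 + tailWeight X p ^ 2 / (p * ((p:ℝ) - 1)))
        ≤ ∏ p ∈ primesLe ⌊X⌋₊, Real.exp (tailWeight X p ^ 2 / (p * ((p:ℝ) - 1))) :=
          prod_le_prod (fun p hp => by linarith [hnn p hp])
            (fun p _ => by linarith [Real.add_one_le_exp (tailWeight X p ^ 2 / (p * ((p:ℝ) - 1)))])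
      _ = Real.exp (∑ p ∈ primesLe ⌊X⌋₊, tailWeight X p ^ 2 / (p * ((p:ℝ) - 1))) :=
          (Real.exp_sum _ _).symm
      _ ≤ _ := by
          rw [Real.exp_le_exp]
          calc ∑ p ∈ primesLe ⌊X⌋₊, tailWeight X p ^ 2 / (p * ((p:ℝ) - 1))
              ≤ ∑ p ∈ primesLe ⌊X⌋₊, 1 / (2 * Real.log X) *
                  (Real.log p / (p * ((p:ℝ) - 1))) := by
                refine sum_le_sum fun p hp => ?_
                have hp2 : (2:ℝ) ≤ p := by exact_mod_cast (mem_primesLe.1 hp).1.two_le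
                have hd : 0 < p * ((p:ℝ) - 1) := mul_pos (by linarith) (by linarith)
                rw [← mul_div_assoc]
                refine div_le_div_of_nonneg_right ?_ hd.le
                have hlp := Real.log_natCast_nonneg p
                unfold tailWeight
                split_ifs with h
                · have h1 : Real.log (Real.sqrt X) ≤ Real.log p :=
                    Real.log_le_log (Real.sqrt_pos.2 (by linarith)) h.le
                  rw [Real.log_sqrt (by linarith)] at h1
                  rw [div_mul_eq_mul_div, one_mul, le_div_iff₀ (by linarith)]
                  linarith
                · have : 0 ≤ 1 / (2 * Real.log X) * Real.log p := by positivity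
                  simpa using this
            _ ≤ 1 / (2 * Real.log X) * 2 := by
                rw [← mul_sum]
                exact mul_le_mul_of_nonneg_left (sum_log_div_mul_sub_one_primesLe_le _)
                  (by positivity)
            _ = 1 / Real.log X := by field_simp

lemma primesLe_floor_of_lt_two {X : ℝ} (h1 : X < 2) : primesLe ⌊X⌋₊ = ∅ := by
  ext p
  simp only [mem_primesLe, notMem_empty, iff_false, not_and]
  intro hp hpX
  have h2 : ⌊X⌋₊ < 2 := by
    rcases le_or_gt 0 X with h0 | h0
    · exact (Nat.floor_lt h0).2 (by exact_mod_cast h1)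
    · rw [Nat.floor_of_nonpos h0.le]; norm_num
  have := hp.two_le
  omega

theorem exists_mollifierProd_bound : ∃ C, 0 ≤ C ∧ ∀ X : ℝ, 1 < X →
    |(∏ p ∈ primesLe ⌊X⌋₊, (1 - 1 / (p : ℝ) + tailWeight X p ^ 2 / (p : ℝ) ^ 2))
      * (Real.exp Real.eulerMascheroniConstant * Real.log X) - 1| ≤ C / Real.log X := by
  set γ := Real.eulerMascheroniConstant
  refine ⟨max (Real.exp γ + 1) (25 * Real.exp 50), le_max_of_le_right (by positivity),
    fun X hX => ?_⟩
  have hlX : 0 < Real.log X := Real.log_pos hX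
  rcases lt_or_ge X 2 with h2 | h2
  · rw [primesLe_floor_of_lt_two h2, prod_empty, one_mul]
    have h3 : Real.log X ≤ 1 := by
      have := Real.log_le_sub_one_of_pos (show 0 < X by linarith)
      linarith
    have h4 : Real.exp γ + 1 ≤ (Real.exp γ + 1) / Real.log X := by
      rw [le_div_iff₀ hlX]
      exact mul_le_of_le_one_right (by positivity) h3
    have h5 : (Real.exp γ + 1) / Real.log X
        ≤ max (Real.exp γ + 1) (25 * Real.exp 50) / Real.log X :=
      div_le_div_of_nonneg_right (le_max_left _ _) hlX.le
    refine le_trans ?_ (h4.trans h5)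
    have h6 : 0 ≤ Real.exp γ * Real.log X := by positivity
    have h7 : Real.exp γ * Real.log X ≤ Real.exp γ :=
      mul_le_of_le_one_right (Real.exp_pos γ).le h3
    rw [abs_le]
    constructor <;> linarith
  · obtain ⟨hN2, hN3, hN4, hN5⟩ := floor_log_bounds h2
    have hM := abs_mertensSum_sub_le_div_log hN2
    obtain ⟨hE1, hE2⟩ := prod_correction_bounds h2
    set N := ⌊X⌋₊
    set E := ∏ p ∈ primesLe N, (1 + tailWeight X p ^ 2 / (p * ((p:ℝ) - 1)))
    have hN0 : 0 < Real.log N := by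
      refine Real.log_pos ?_
      have : (2:ℝ) ≤ N := by exact_mod_cast hN2
      linarith
    have hfac : ∏ p ∈ primesLe N, (1 - 1 / (p : ℝ) + tailWeight X p ^ 2 / (p : ℝ) ^ 2)
        = Real.exp (-mertensSum N) * E := by
      rw [exp_neg_mertensSum, ← prod_mul_distrib]
      refine prod_congr rfl fun p hp => ?_
      have hp2 : (2:ℝ) ≤ p := by exact_mod_cast (mem_primesLe.1 hp).1.two_le
      have : (p:ℝ) - 1 ≠ 0 := by linarith
      field_simp
    have hll0 : Real.log (Real.log N) ≤ Real.log (Real.log X) := Real.log_le_log hN0 hN3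
    have hll1 : Real.log (Real.log X) - Real.log (Real.log N) ≤ 1 / Real.log N := by
      rw [← Real.log_div hlX.ne' hN0.ne']
      refine (Real.log_le_sub_one_of_pos (div_pos hlX hN0)).trans ?_
      rw [div_sub_one hN0.ne']
      exact div_le_div_of_nonneg_right (by linarith) hN0.le
    have hlE0 : 0 ≤ Real.log E := Real.log_nonneg hE1
    have hlE1 : Real.log E ≤ 1 / Real.log X := by
      have := Real.log_le_log (by linarith) hE2
      rwa [Real.log_exp] at this
    have hinv : 1 / Real.log N ≤ 2 * (1 / Real.log X) := by
      rw [← mul_div_assoc, mul_one, div_le_div_iff₀ hN0 hlX]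
      linarith
    have hval : Real.exp (-mertensSum N) * E * (Real.exp γ * Real.log X)
        = Real.exp (-mertensSum N + Real.log E + γ + Real.log (Real.log X)) := by
      rw [Real.exp_add, Real.exp_add, Real.exp_add, Real.exp_log (by linarith),
        Real.exp_log hlX]
      ring
    rw [hfac, hval]
    set w := -mertensSum N + Real.log E + γ + Real.log (Real.log X) with hw
    have hM' : 11 / Real.log N = 11 * (1 / Real.log N) := by ring
    rw [hM', abs_le] at hM
    have hwb : |w| ≤ 25 * (1 / Real.log X) := by
      rw [abs_le]
      constructor <;> linarith [hM.1, hM.2]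
    have hw50 : |w| ≤ 50 := by
      refine hwb.trans ?_
      have h3 : 1 / 2 ≤ Real.log X := by
        have := Real.log_two_gt_d9
        have := Real.log_le_log (by norm_num) h2
        linarith
      rw [← mul_div_assoc, mul_one, div_le_iff₀ hlX]
      linarith
    calc |Real.exp w - 1| ≤ |w| * Real.exp |w| := abs_exp_sub_one_le_mul_exp w
      _ ≤ 25 * (1 / Real.log X) * Real.exp 50 :=
          mul_le_mul hwb (Real.exp_le_exp.2 hw50) (Real.exp_pos _).le (by positivity)
      _ = 25 * Real.exp 50 / Real.log X := by ring
      _ ≤ _ := div_le_div_of_nonneg_right (le_max_right _ _) hlX.le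

theorem exists_prod_inv_le : ∃ C, 1 ≤ C ∧ ∀ X : ℝ, 1 < X →
    ∏ p ∈ primesLe ⌊X⌋₊, (1 - 1 / (p : ℝ))⁻¹ ≤ C * (1 + Real.log X) := by
  set γ := Real.eulerMascheroniConstant
  refine ⟨max 1 (Real.exp (γ + 22)), le_max_left _ _, fun X hX => ?_⟩
  have hlX : 0 < Real.log X := Real.log_pos hX
  rcases lt_or_ge X 2 with h2 | h2
  · rw [primesLe_floor_of_lt_two h2, prod_empty]
    have h3 : (1:ℝ) ≤ max 1 (Real.exp (γ + 22)) := le_max_left _ _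
    nlinarith
  · obtain ⟨hN2, hN3, hN4, hN5⟩ := floor_log_bounds h2
    have hM := abs_mertensSum_sub_le_div_log hN2
    rw [prod_inv_distrib, ← exp_neg_mertensSum, ← Real.exp_neg, neg_neg]
    have hN1 : 1 / 2 ≤ Real.log (⌊X⌋₊ : ℝ) := by
      have h4 : (2:ℝ) ≤ ⌊X⌋₊ := by exact_mod_cast hN2
      have := Real.log_two_gt_d9
      have := Real.log_le_log (by norm_num) h4
      linarith
    have h5 : 11 / Real.log (⌊X⌋₊ : ℝ) ≤ 22 := by
      rw [div_le_iff₀ (by linarith)]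
      linarith
    have h6 : mertensSum ⌊X⌋₊ ≤ (γ + 22) + Real.log (Real.log ⌊X⌋₊) := by
      have := (abs_le.1 hM).2
      linarith
    calc Real.exp (mertensSum ⌊X⌋₊) ≤ Real.exp ((γ + 22) + Real.log (Real.log ⌊X⌋₊)) :=
          Real.exp_le_exp.2 h6
      _ = Real.exp (γ + 22) * Real.log ⌊X⌋₊ := by
          rw [Real.exp_add, Real.exp_log (by linarith)]
      _ ≤ max 1 (Real.exp (γ + 22)) * (1 + Real.log X) :=
          mul_le_mul (le_max_right _ _) (by linarith) (by linarith) (by positivity)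

lemma primesUpTo_eq {X : ℝ} (hX : 0 ≤ X) : primesUpTo X = primesLe ⌊X⌋₊ := by
  ext p
  rw [mem_primesLe, primesUpTo, Finset.mem_filter, Finset.mem_range, Nat.lt_succ_iff]
  constructor
  · rintro ⟨h1, h2, -⟩
    exact ⟨h2, h1⟩
  · rintro ⟨h1, h2⟩
    exact ⟨h2, h1, (Nat.le_floor_iff hX).mp h2⟩

lemma QX_eq_prod {q : ℕ} {X : ℝ} (hX : 0 ≤ X) (χ : DirichletCharacter ℂ q) (s : ℂ) :
    QX X χ s = ∏ p ∈ primesLe ⌊X⌋₊, (1 - χ (p : ZMod q) * (p : ℂ) ^ (-s)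
      + (tailWeight X p : ℂ) * (χ (p : ZMod q) * (p : ℂ) ^ (-s)) ^ 2) := by
  have hsplit := Finset.prod_filter_mul_prod_filter_not (primesLe ⌊X⌋₊)
    (fun p : ℕ => (p : ℝ) ≤ √X) (fun p : ℕ => 1 - χ (p : ZMod q) * (p : ℂ) ^ (-s)
      + (tailWeight X p : ℂ) * (χ (p : ZMod q) * (p : ℂ) ^ (-s)) ^ 2)
  rw [← hsplit, QX, primesUpTo_eq hX]
  congr 1
  · refine Finset.prod_congr rfl fun p hp => ?_
    have hp' := (Finset.mem_filter.mp hp).2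
    simp [tailWeight, not_lt.mpr hp']
  · refine Finset.prod_congr (by ext; simp) fun p hp => ?_
    have hp' := (Finset.mem_filter.mp hp).2
    have : (p : ℂ) ^ (2 * s) = ((p : ℂ) ^ s) ^ 2 := by
      have := Complex.cpow_nat_mul (p : ℂ) 2 s
      exact_mod_cast this
    simp only [tailWeight, if_pos (not_le.mp hp'), this, Complex.cpow_neg]
    push_cast
    rw [mul_pow, inv_pow, div_eq_mul_inv, mul_inv]
    ring

lemma locFactor_sq {c : ℕ → ℝ} (P : Finset ℕ) (n : ℕ) :
    locFactor (fun p => c p ^ 2) P n = locFactor c P n ^ 2 := by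
  rw [locFactor, locFactor, ← Finset.prod_pow]
  refine Finset.prod_congr rfl fun p _ => ?_
  by_cases h2 : p ^ 2 ∣ n
  · have h1 : p ∣ n := dvd_trans (dvd_pow_self p two_ne_zero) h2
    simp [h1, h2]
  · by_cases h1 : p ∣ n <;> simp [h1, h2]

lemma norm_char_mul_locFactor_sq {q : ℕ} [NeZero q] (χ : DirichletCharacter ℂ q) {X : ℝ}
    (hX : (q : ℝ) ^ 2 < X) (n : ℕ) :
    ‖χ (n : ZMod q) * locFactor (tailWeight X) (primesLe ⌊X⌋₊) n‖ ^ 2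
      = locFactor (fun p => tailWeight X p ^ 2) (primesLe ⌊X⌋₊) n := by
  rw [locFactor_sq, norm_mul, mul_pow, Complex.norm_real, Real.norm_eq_abs, sq_abs]
  by_cases h : n.Coprime q
  · have hu : IsUnit (n : ZMod q) := (ZMod.isUnit_iff_coprime n q).mpr h
    have : ‖χ (n : ZMod q)‖ = 1 := by
      obtain ⟨u, hu⟩ := hu
      rw [← hu]
      exact DirichletCharacter.unit_norm_eq_one χ u
    rw [this]; ring
  · obtain ⟨p, hp, hpn, hpq⟩ := Nat.Prime.not_coprime_iff_dvd.mp h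
    have hq : 0 < q := NeZero.pos q
    have hq1 : (1 : ℝ) ≤ q := by exact_mod_cast hq
    have hpq' : (p : ℝ) ≤ q := by exact_mod_cast Nat.le_of_dvd hq hpq
    have hX0 : 0 ≤ X := by nlinarith
    have hqs : (q : ℝ) ≤ √X := Real.le_sqrt_of_sq_le hX.le
    have hmem : p ∈ primesLe ⌊X⌋₊ := by
      rw [mem_primesLe]
      refine ⟨hp, Nat.le_floor ?_⟩
      nlinarith
    have : locFactor (tailWeight X) (primesLe ⌊X⌋₊) n = 0 := by
      refine Finset.prod_eq_zero hmem ?_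
      have : ¬ (√X < (p : ℝ)) := not_lt.mpr (hpq'.trans hqs)
      simp [tailWeight, this, hpn]
    rw [this]; ring

lemma lcmSum_le_halfSum_sq (r : ℕ → ℂ) (Y : ℕ) : lcmSum r Y ≤ halfSum r Y ^ 2 := by
  rw [lcmSum, halfSum, sq, Finset.sum_mul_sum]
  refine Finset.sum_le_sum fun k hk => Finset.sum_le_sum fun h hh => ?_
  have hk1 : 1 ≤ k := (Finset.mem_Icc.mp hk).1
  have hh1 : 1 ≤ h := (Finset.mem_Icc.mp hh).1
  have hk0 : (0 : ℝ) < k := by exact_mod_cast hk1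
  have hh0 : (0 : ℝ) < h := by exact_mod_cast hh1
  have hkl : (k : ℝ) ≤ (Nat.lcm k h : ℕ) := by
    exact_mod_cast Nat.le_of_dvd (Nat.lcm_pos hk1 hh1) (Nat.dvd_lcm_left k h)
  have hhl : (h : ℝ) ≤ (Nat.lcm k h : ℕ) := by
    exact_mod_cast Nat.le_of_dvd (Nat.lcm_pos hk1 hh1) (Nat.dvd_lcm_right k h)
  have key : (1 : ℝ) / (Nat.lcm k h : ℕ) ≤ (k : ℝ) ^ (-(1 / 2) : ℝ) * (h : ℝ) ^ (-(1 / 2) : ℝ) := by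
    rw [Real.rpow_neg hk0.le, Real.rpow_neg hh0.le, ← mul_inv, ← Real.sqrt_eq_rpow,
      ← Real.sqrt_eq_rpow, one_div]
    refine inv_anti₀ (by positivity) ?_
    calc √(k : ℝ) * √h ≤ √(Nat.lcm k h : ℕ) * √(Nat.lcm k h : ℕ) := by gcongr
      _ = _ := Real.mul_self_sqrt (by positivity)
  calc _ ≤ ‖r k‖ * ‖r h‖ * ((k : ℝ) ^ (-(1 / 2) : ℝ) * (h : ℝ) ^ (-(1 / 2) : ℝ)) := by
        gcongr
    _ = _ := by ring

/-- The restriction of a coefficient sequence to indices exceeding `Y`. -/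
noncomputable def tailPart (r : ℕ → ℂ) (Y n : ℕ) : ℂ := if Y < n then r n else 0

lemma halfSum_eq_sum_filter (r : ℕ → ℂ) (K : ℕ) :
    halfSum r K = ∑ k ∈ (Icc 1 K).filter (fun k => r k ≠ 0), ‖r k‖ * (k : ℝ) ^ (-(1 / 2) : ℝ) := by
  rw [halfSum, Finset.sum_filter]
  refine Finset.sum_congr rfl fun k _ => ?_
  by_cases h : r k = 0 <;> simp [h]

lemma halfSum_le_prod {P : Finset ℕ} (hP : ∀ p ∈ P, p.Prime) {r : ℕ → ℂ} (hr : ∀ k, ‖r k‖ ≤ 1)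
    (hsupp : ∀ k, r k ≠ 0 → k ∈ Nat.factoredNumbers P) {σ : ℝ} (hσ0 : 0 ≤ σ) (hσ : σ < 1 / 2) (K : ℕ) :
    halfSum r K ≤ ∏ p ∈ P, (1 - (p : ℝ) ^ (-(1 / 2 - σ)))⁻¹ := by
  refine le_trans ?_ (sum_factoredNumbers_rpow_le hP (σ := 1 / 2 - σ) (by linarith)
    (F := (Icc 1 K).filter (fun k => r k ≠ 0)) fun n hn => hsupp n (Finset.mem_filter.mp hn).2)
  rw [halfSum_eq_sum_filter]
  refine Finset.sum_le_sum fun k hk => ?_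
  have hk1 : (1 : ℝ) ≤ k := by exact_mod_cast (Finset.mem_Icc.mp (Finset.mem_filter.mp hk).1).1
  calc ‖r k‖ * (k : ℝ) ^ (-(1 / 2) : ℝ) ≤ 1 * (k : ℝ) ^ (-(1 / 2 - σ)) := by
        refine mul_le_mul (hr k) (Real.rpow_le_rpow_of_exponent_le hk1 (by linarith)) (by positivity)
          zero_le_one
    _ = _ := one_mul _

lemma halfSum_tailPart_le_prod {P : Finset ℕ} (hP : ∀ p ∈ P, p.Prime) {r : ℕ → ℂ}
    (hr : ∀ k, ‖r k‖ ≤ 1) (hsupp : ∀ k, r k ≠ 0 → k ∈ Nat.factoredNumbers P) {σ : ℝ} (hσ0 : 0 ≤ σ)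
    (hσ : σ < 1 / 2) {Y : ℕ} (hY : 0 < Y) (K : ℕ) :
    halfSum (tailPart r Y) K ≤ (Y : ℝ) ^ (-σ) * ∏ p ∈ P, (1 - (p : ℝ) ^ (-(1 / 2 - σ)))⁻¹ := by
  have hY0 : (0 : ℝ) < Y := by exact_mod_cast hY
  have hsub : ∀ k, tailPart r Y k ≠ 0 → Y < k ∧ r k ≠ 0 := by
    intro k hk
    rw [tailPart] at hk
    split_ifs at hk with h
    · exact ⟨h, hk⟩
    · exact absurd rfl hk
  refine le_trans ?_ (mul_le_mul_of_nonneg_left (sum_factoredNumbers_rpow_le hP (σ := 1 / 2 - σ)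
    (by linarith) (F := (Icc 1 K).filter (fun k => tailPart r Y k ≠ 0))
    fun n hn => hsupp n (hsub n (Finset.mem_filter.mp hn).2).2) (by positivity))
  rw [halfSum_eq_sum_filter, Finset.mul_sum]
  refine Finset.sum_le_sum fun k hk => ?_
  obtain ⟨hYk, -⟩ := hsub k (Finset.mem_filter.mp hk).2
  have hk0 : (0 : ℝ) < k := by exact_mod_cast hY.trans hYk
  have hn : ‖tailPart r Y k‖ ≤ 1 := by
    rw [tailPart, if_pos hYk]; exact hr k
  have hs : (k : ℝ) ^ (-σ) ≤ (Y : ℝ) ^ (-σ) :=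
    Real.rpow_le_rpow_of_nonpos hY0 (by exact_mod_cast hYk.le) (by linarith)
  calc ‖tailPart r Y k‖ * (k : ℝ) ^ (-(1 / 2) : ℝ)
      ≤ 1 * ((k : ℝ) ^ (-σ) * (k : ℝ) ^ (-(1 / 2 - σ))) := by
        rw [← Real.rpow_add hk0]
        refine mul_le_mul hn (le_of_eq ?_) (by positivity) zero_le_one
        congr 1; ring
    _ ≤ (Y : ℝ) ^ (-σ) * (k : ℝ) ^ (-(1 / 2 - σ)) := by
        rw [one_mul]; gcongr

lemma prod_inv_one_sub_rpow_le {X a : ℝ} (hX : 1 ≤ X) (ha : 1 / 4 ≤ a) (ha1 : a ≤ 1) :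
    ∏ p ∈ primesLe ⌊X⌋₊, (1 - (p : ℝ) ^ (-a))⁻¹ ≤ Real.exp (8 * (X ^ (1 - a) * (1 + Real.log X))) := by
  have h2 : (2 : ℝ) ^ (-(1 / 4) : ℝ) ≤ 7 / 8 := by
    have h : (8 / 7 : ℝ) ≤ 2 ^ (1 / 4 : ℝ) := by
      have h1 : (8 / 7 : ℝ) = ((8 / 7 : ℝ) ^ (4 : ℕ)) ^ (1 / 4 : ℝ) := by
        rw [← Real.rpow_natCast, ← Real.rpow_mul (by norm_num)]; norm_num
      rw [h1]
      exact Real.rpow_le_rpow (by norm_num) (by norm_num) (by norm_num)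
    rw [Real.rpow_neg (by norm_num)]
    calc ((2 : ℝ) ^ (1 / 4 : ℝ))⁻¹ ≤ (8 / 7)⁻¹ := inv_anti₀ (by norm_num) h
      _ = 7 / 8 := by norm_num
  have hfac : ∀ p ∈ primesLe ⌊X⌋₊, (1 - (p : ℝ) ^ (-a))⁻¹ ≤ Real.exp (8 * (p : ℝ) ^ (-a)) := by
    intro p hp
    have hp2 : (2 : ℝ) ≤ p := by exact_mod_cast (mem_primesLe.mp hp).1.two_le
    set y := (p : ℝ) ^ (-a) with hy
    have hy0 : 0 ≤ y := by positivity
    have hy1 : y ≤ 7 / 8 := by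
      calc y ≤ (2 : ℝ) ^ (-a) := Real.rpow_le_rpow_of_nonpos (by norm_num) hp2 (by linarith)
        _ ≤ (2 : ℝ) ^ (-(1 / 4) : ℝ) := Real.rpow_le_rpow_of_exponent_le (by norm_num) (by linarith)
        _ ≤ 7 / 8 := h2
    have h3 : (1 - y)⁻¹ ≤ 8 * y + 1 := by
      rw [inv_le_iff_one_le_mul₀ (by linarith)]
      nlinarith
    exact h3.trans (Real.add_one_le_exp _)
  calc ∏ p ∈ primesLe ⌊X⌋₊, (1 - (p : ℝ) ^ (-a))⁻¹ ≤ ∏ p ∈ primesLe ⌊X⌋₊, Real.exp (8 * (p : ℝ) ^ (-a)) := by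
        refine Finset.prod_le_prod (fun p hp => ?_) hfac
        have hp1 : (1 : ℝ) ≤ p := by exact_mod_cast (mem_primesLe.mp hp).1.one_le
        exact inv_nonneg.mpr (by
          linarith [Real.rpow_le_one_of_one_le_of_nonpos hp1 (by linarith : -a ≤ 0)])
    _ = Real.exp (8 * ∑ p ∈ primesLe ⌊X⌋₊, (p : ℝ) ^ (-a)) := by
        rw [← Real.exp_sum, Finset.mul_sum]
    _ ≤ _ := by
        refine Real.exp_le_exp.mpr (mul_le_mul_of_nonneg_left ?_ (by norm_num))
        have hN : 1 ≤ ⌊X⌋₊ := Nat.le_floor (by simpa using hX)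
        have hNX : (⌊X⌋₊ : ℝ) ≤ X := Nat.floor_le (by linarith)
        calc ∑ p ∈ primesLe ⌊X⌋₊, (p : ℝ) ^ (-a) ≤ ∑ n ∈ Icc 1 ⌊X⌋₊, (n : ℝ) ^ (-a) :=
              Finset.sum_le_sum_of_subset_of_nonneg (Finset.filter_subset _ _) fun _ _ _ => by positivity
          _ ≤ ∑ n ∈ Icc 1 ⌊X⌋₊, X ^ (1 - a) * ((1 : ℝ) / n) := by
              refine Finset.sum_le_sum fun n hn => ?_
              rw [Finset.mem_Icc] at hn
              have hn0 : (0 : ℝ) < n := by exact_mod_cast hn.1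
              have hnX : (n : ℝ) ≤ X := le_trans (by exact_mod_cast hn.2) hNX
              have e : (n : ℝ) ^ (-a) = (n : ℝ) ^ (1 - a) * (1 / n) := by
                rw [one_div, ← Real.rpow_neg_one, ← Real.rpow_add hn0]; congr 1; ring
              rw [e]
              exact mul_le_mul_of_nonneg_right
                (Real.rpow_le_rpow hn0.le hnX (by linarith)) (by positivity)
          _ = X ^ (1 - a) * ∑ n ∈ Icc 1 ⌊X⌋₊, (1 : ℝ) / n := by rw [Finset.mul_sum]
          _ ≤ X ^ (1 - a) * (1 + Real.log X) := by
              refine mul_le_mul_of_nonneg_left ((sum_inv_nat_le _).trans ?_) (by positivity)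
              have := Real.log_le_log (by exact_mod_cast hN) hNX
              linarith

lemma sum_norm_div_mul_one_add_log_le {P : Finset ℕ} (hP : ∀ p ∈ P, p.Prime) {r : ℕ → ℂ}
    (hr : ∀ k, ‖r k‖ ≤ 1) (hsupp : ∀ k, r k ≠ 0 → k ∈ Nat.factoredNumbers P) (Y K : ℕ) :
    ∑ k ∈ Icc 1 K, ‖r k‖ / k * (1 + Real.log k) ≤
      (1 + Real.log Y) * ∏ p ∈ P, (1 - 1 / (p : ℝ))⁻¹ + 2 * halfSum (tailPart r Y) K := by
  have hlY : 0 ≤ Real.log Y := Real.log_natCast_nonneg Y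
  have h1 : ∑ k ∈ (Icc 1 K).filter (fun k => r k ≠ 0), (1 : ℝ) / k ≤ ∏ p ∈ P, (1 - 1 / (p : ℝ))⁻¹ := by
    have := sum_factoredNumbers_rpow_le hP one_pos
      (F := (Icc 1 K).filter (fun k => r k ≠ 0)) fun n hn => hsupp n (Finset.mem_filter.mp hn).2
    simpa only [Real.rpow_neg_one, one_div] using this
  refine le_trans ?_ (add_le_add (mul_le_mul_of_nonneg_left h1 (by linarith)) le_rfl)
  rw [halfSum, Finset.sum_filter, Finset.mul_sum, Finset.mul_sum, ← Finset.sum_add_distrib]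
  refine Finset.sum_le_sum fun k hk => ?_
  have hk1 : (1 : ℝ) ≤ k := by exact_mod_cast (Finset.mem_Icc.mp hk).1
  have hk0 : (0 : ℝ) < k := by linarith
  have hlk : 0 ≤ Real.log k := Real.log_nonneg hk1
  by_cases h0 : r k = 0
  · simp [h0, tailPart]
  rw [if_pos h0]
  rcases le_or_gt k Y with h | h
  · have h2 : Real.log k ≤ Real.log Y := Real.log_le_log hk0 (by exact_mod_cast h)
    rw [tailPart, if_neg (not_lt.mpr h), norm_zero, zero_mul, mul_zero, add_zero]
    calc ‖r k‖ / k * (1 + Real.log k) ≤ 1 / k * (1 + Real.log Y) := by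
          have := hr k
          gcongr
      _ = _ := mul_comm _ _
  · rw [tailPart, if_pos h]
    have hsq : Real.log k ≤ 2 * √k - 1 := by
      have h3 : Real.log k = 2 * Real.log (√k) := by
        rw [Real.log_sqrt hk0.le]; ring
      have h4 := Real.log_le_sub_one_of_pos (Real.sqrt_pos.mpr hk0)
      linarith
    have h5 : ‖r k‖ / k * (1 + Real.log k) ≤ ‖r k‖ / k * (2 * √k) := by
      refine mul_le_mul_of_nonneg_left (by linarith) (by positivity)
    have h6 : ‖r k‖ / k * (2 * √k) = 2 * (‖r k‖ * (k : ℝ) ^ (-(1 / 2) : ℝ)) := by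
      rw [Real.rpow_neg hk0.le, ← Real.sqrt_eq_rpow]
      have : (k : ℝ) = √k * √k := (Real.mul_self_sqrt hk0.le).symm
      have h7 : √(k : ℝ) ≠ 0 := (Real.sqrt_pos.mpr hk0).ne'
      nth_rewrite 1 [this]
      field_simp
    have h8 : 0 ≤ (1 + Real.log Y) * (1 / (k : ℝ)) := by positivity
    linarith

/-- The restriction of a coefficient sequence to indices in `(A, B]`. -/
noncomputable def windowPart (β : ℕ → ℂ) (A B : ℝ) (n : ℕ) : ℂ := if A < n ∧ (n : ℝ) ≤ B then β n else 0

lemma norm_windowPart_le {β : ℕ → ℂ} {M : ℝ} (hM : 0 ≤ M) (hβ : ∀ n, ‖β n‖ ≤ M) (A B : ℝ) (n : ℕ) :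
    ‖windowPart β A B n‖ ≤ M := by
  rw [windowPart]; split_ifs
  · exact hβ n
  · simpa using hM

lemma windowPart_ne_zero {β : ℕ → ℂ} {A B : ℝ} {n : ℕ} (h : windowPart β A B n ≠ 0) :
    A < n ∧ (n : ℝ) ≤ B := by
  rw [windowPart] at h; split_ifs at h with h'
  · exact h'
  · exact absurd rfl h

lemma dirPoly_add_tailPart {r : ℕ → ℂ} {Y K : ℕ} (hYK : Y ≤ K) (s : ℂ) :
    dirPoly r K s = dirPoly r Y s + dirPoly (tailPart r Y) K s := by
  have e : Icc 1 Y = (Icc 1 K).filter (fun n => ¬ Y < n) := by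
    ext n; simp; omega
  rw [dirPoly, ← Finset.sum_filter_add_sum_filter_not (Icc 1 K) (fun n => ¬ Y < n), ← e, dirPoly]
  congr 1
  rw [dirPoly, Finset.sum_filter]
  refine Finset.sum_congr rfl fun n _ => ?_
  by_cases h : Y < n <;> simp [tailPart, h]

lemma dirPoly_eq_of_le {c : ℕ → ℂ} {B B' : ℕ} (h : B ≤ B') (s : ℂ) :
    dirPoly c B s = dirPoly (fun n => if n ≤ B then c n else 0) B' s := by
  have e : Icc 1 B = (Icc 1 B').filter (fun n => n ≤ B) := by
    ext n; simp; omega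
  rw [dirPoly, e, dirPoly, Finset.sum_filter]
  refine Finset.sum_congr rfl fun n _ => ?_
  split_ifs <;> simp

lemma dirPoly_sub (c d : ℕ → ℂ) (B : ℕ) (s : ℂ) :
    dirPoly c B s - dirPoly d B s = dirPoly (fun n => c n - d n) B s := by
  rw [dirPoly, dirPoly, dirPoly, ← Finset.sum_sub_distrib]
  exact Finset.sum_congr rfl fun n _ => by ring

lemma dconv_congr {β β' r : ℕ → ℂ} {Y N : ℕ} (h : ∀ k ∈ Icc 1 Y, k ∣ N → β (N / k) = β' (N / k)) :
    dconv β r Y N = dconv β' r Y N := by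
  refine Finset.sum_congr rfl fun k hk => ?_
  rw [Finset.mem_filter] at hk
  rw [h k hk.1 hk.2]

lemma dconv_add_tailPart {β r : ℕ → ℂ} {Y K N : ℕ} (hYK : Y ≤ K) :
    dconv β r K N = dconv β r Y N + dconv β (tailPart r Y) K N := by
  have e : (Icc 1 Y).filter (fun k => k ∣ N) = ((Icc 1 K).filter (fun k => k ∣ N)).filter (fun n => ¬ Y < n) := by
    ext n; simp; omega
  rw [dconv, ← Finset.sum_filter_add_sum_filter_not ((Icc 1 K).filter (fun k => k ∣ N)) (fun n => ¬ Y < n),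
    ← e, dconv]
  congr 1
  rw [dconv, Finset.sum_filter]
  refine Finset.sum_congr rfl fun n _ => ?_
  by_cases h : Y < n <;> simp [tailPart, h]

lemma dconv_eq_sum_divisors {β r : ℕ → ℂ} {K N : ℕ} (hN : N ≠ 0) (hr : ∀ n, K < n → r n = 0) :
    dconv β r K N = ∑ k ∈ N.divisors, β (N / k) * r k := by
  rw [dconv]
  refine Finset.sum_subset ?_ ?_
  · intro k hk
    rw [Finset.mem_filter] at hk
    exact Nat.mem_divisors.mpr ⟨hk.2, hN⟩
  · intro k hk hk'
    have hkd := (Nat.mem_divisors.mp hk).1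
    have hk1 : 1 ≤ k := Nat.pos_of_dvd_of_pos hkd (Nat.pos_of_ne_zero hN)
    have : K < k := by
      by_contra hle
      exact hk' (Finset.mem_filter.mpr ⟨Finset.mem_Icc.mpr ⟨hk1, not_lt.mp hle⟩, hkd⟩)
    rw [hr k this, mul_zero]

/-- The mean square norm of the difference between the product of two truncated Dirichlet polynomials
and the truncated product, measured on coefficients. -/
theorem exists_dirPoly_mul_sub_eq {β r G : ℕ → ℂ} {Y K B : ℕ} (hβ : ∀ n, ‖β n‖ ≤ 1) (hY : 1 ≤ Y)
    (hYK : Y ≤ K) (hB : 1 ≤ B) (hr : ∀ n, K < n → r n = 0)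
    (hG : ∀ N, N ≠ 0 → ∑ k ∈ N.divisors, β (N / k) * r k = G N) :
    ∃ e : ℕ → ℂ, (∀ s, dirPoly β B s * dirPoly r Y s - dirPoly G B s = dirPoly e (B * Y) s) ∧
      ∑ N ∈ Icc 1 (B * Y), ‖e N‖ ^ 2 / N ≤ (1 + Real.log (2 * B)) * lcmSum (tailPart r Y) K
        + (1 + Real.log Y) * lcmSum r Y := by
  have hB0 : (1 : ℝ) ≤ B := by exact_mod_cast hB
  have hY0 : (1 : ℝ) ≤ Y := by exact_mod_cast hY
  set β₁ := windowPart β (1 / 2) B with hβ₁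
  set β₂ := windowPart β (B / Y) B with hβ₂
  have hβB : ∀ n, B < n → β₁ n = 0 := by
    intro n hn
    by_contra h
    have := (windowPart_ne_zero h).2
    have : n ≤ B := by exact_mod_cast this
    omega
  have hββ₁ : ∀ s, dirPoly β B s = dirPoly β₁ B s := by
    intro s
    refine Finset.sum_congr rfl fun n hn => ?_
    rw [Finset.mem_Icc] at hn
    have h1 : (1 : ℝ) ≤ n := by exact_mod_cast hn.1
    have h2 : (n : ℝ) ≤ B := by exact_mod_cast hn.2
    rw [hβ₁, windowPart, if_pos ⟨by linarith, h2⟩]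
  set e : ℕ → ℂ := fun N => dconv β₁ r Y N - (if N ≤ B then G N else 0) with he
  refine ⟨e, fun s => ?_, ?_⟩
  · rw [hββ₁, dirPoly_mul hβB, dirPoly_eq_of_le (Nat.le_mul_of_pos_right B hY) (c := G), dirPoly_sub]
  have hbound : ∀ N ∈ Icc 1 (B * Y), ‖e N‖ ^ 2 / N ≤
      ‖dconv β₁ (tailPart r Y) K N‖ ^ 2 / N + ‖dconv β₂ r Y N‖ ^ 2 / N := by
    intro N hN
    have hN1 := (Finset.mem_Icc.mp hN).1
    have hN0 : N ≠ 0 := by omega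
    rcases le_or_gt N B with h | h
    · have h1 : dconv β r K N = G N := by rw [dconv_eq_sum_divisors hN0 hr, hG N hN0]
      have h2 : dconv β r K N = dconv β₁ r K N := by
        refine dconv_congr fun k hk hkN => ?_
        have hk1 := (Finset.mem_Icc.mp hk).1
        have h3 : 1 ≤ N / k := Nat.div_pos (Nat.le_of_dvd (by omega) hkN) (by omega)
        have h4 : N / k ≤ B := (Nat.div_le_self _ _).trans h
        have h3' : (1 : ℝ) ≤ (N / k : ℕ) := by exact_mod_cast h3
        have h4' : ((N / k : ℕ) : ℝ) ≤ B := by exact_mod_cast h4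
        rw [hβ₁, windowPart, if_pos ⟨by linarith, h4'⟩]
      have h5 : e N = - dconv β₁ (tailPart r Y) K N := by
        rw [he]; simp only [if_pos h]
        rw [← h1, h2, dconv_add_tailPart hYK]; ring
      rw [h5, norm_neg]
      have : 0 ≤ ‖dconv β₂ r Y N‖ ^ 2 / N := by positivity
      linarith
    · have h1 : e N = dconv β₂ r Y N := by
        rw [he]; simp only [if_neg (not_le.mpr h), sub_zero]
        refine dconv_congr fun k hk hkN => ?_
        rw [Finset.mem_Icc] at hk
        have hk0 : (0 : ℝ) < k := by exact_mod_cast hk.1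
        have e1 : ((N / k : ℕ) : ℝ) = N / k := Nat.cast_div hkN hk0.ne'
        have h3 : (B / Y : ℝ) < (N / k : ℕ) := by
          rw [e1, div_lt_div_iff₀ (by linarith) hk0]
          have hkY : (k : ℝ) ≤ Y := by exact_mod_cast hk.2
          have hBN : (B : ℝ) < N := by exact_mod_cast h
          nlinarith
        have h4 : 1 ≤ N / k := Nat.div_pos (Nat.le_of_dvd (by omega) hkN) (by omega)
        have h4' : (1 / 2 : ℝ) < (N / k : ℕ) := by
          have : (1 : ℝ) ≤ (N / k : ℕ) := by exact_mod_cast h4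
          linarith
        simp only [hβ₁, hβ₂, windowPart, h3, h4', true_and]
      rw [h1]
      have : 0 ≤ ‖dconv β₁ (tailPart r Y) K N‖ ^ 2 / N := by positivity
      linarith
  refine (Finset.sum_le_sum hbound).trans ?_
  rw [Finset.sum_add_distrib]
  refine add_le_add ?_ ?_
  · have := sum_norm_sq_dconv_le (A := 1 / 2) (B := B) (by norm_num) (by linarith)
      (norm_windowPart_le zero_le_one hβ (1 / 2) B) (fun n h => windowPart_ne_zero h) (tailPart r Y) K
      (Icc 1 (B * Y))
    rw [one_pow, one_mul, show (B : ℝ) / (1 / 2) = 2 * B by ring] at this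
    exact this
  · have := sum_norm_sq_dconv_le (A := B / Y) (B := B) (by positivity)
      (div_le_self (by linarith) hY0)
      (norm_windowPart_le zero_le_one hβ (B / Y) B) (fun n h => windowPart_ne_zero h) r Y
      (Icc 1 (B * Y))
    rw [one_pow, one_mul, show (B : ℝ) / (B / Y) = Y by field_simp] at this
    exact this

lemma continuous_dirPoly_half_line (c : ℕ → ℂ) (N : ℕ) :
    Continuous fun t : ℝ => dirPoly c N (1 / 2 + t * I) :=
  (differentiable_dirPoly c N).continuous.comp (by fun_prop)

section mainLength

variable {T : ℝ} {Y : ℕ}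

lemma mainLength_le (h : Admissible T Y) : (mainLength T Y : ℝ) ≤ T / Y ^ 7 :=
  Nat.floor_le (by have := h.hundred_le; positivity)

lemma one_le_div_pow (h : Admissible T Y) : 1 ≤ T / (Y : ℝ) ^ 7 := by
  have hY := h.one_le_Y
  rw [one_le_div (by positivity)]
  exact (pow_le_pow_right₀ hY (by norm_num)).trans h.pow_le

lemma one_le_mainLength (h : Admissible T Y) : 1 ≤ mainLength T Y :=
  Nat.le_floor (by simpa using one_le_div_pow h)

lemma mainLength_mul_le (h : Admissible T Y) : (mainLength T Y : ℝ) * Y ^ 5 ≤ T := by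
  have hY := h.one_le_Y
  calc (mainLength T Y : ℝ) * Y ^ 5 ≤ mainLength T Y * Y ^ 7 := by
        have := pow_le_pow_right₀ hY (by norm_num : 5 ≤ 7)
        gcongr
    _ ≤ T / Y ^ 7 * Y ^ 7 := by gcongr; exact mainLength_le h
    _ = T := by field_simp

lemma abs_log_mainLength_sub_le (h : Admissible T Y) :
    |Real.log (mainLength T Y) - Real.log T| ≤ 8 * Real.log Y := by
  have hY := h.one_le_Y
  have hT := h.hundred_le
  have hl2 := h.two_le_logY
  have h1 : (1 : ℝ) ≤ mainLength T Y := by exact_mod_cast one_le_mainLength h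
  have h2 := mainLength_le h
  have h3 : T / (Y : ℝ) ^ 7 ≤ 2 * mainLength T Y := by
    have := (Nat.lt_floor_add_one (T / (Y : ℝ) ^ 7)).le
    rw [← mainLength] at this
    linarith
  have h4 : Real.log (T / (Y : ℝ) ^ 7) = Real.log T - 7 * Real.log Y := by
    rw [Real.log_div (by positivity) (by positivity), Real.log_pow]; norm_num
  have h5 := Real.log_le_log (by linarith) h2
  have h6 := Real.log_le_log (by positivity) h3
  rw [Real.log_mul (by norm_num) (by positivity)] at h6
  have h7 : Real.log 2 ≤ 1 := by linarith [Real.log_two_lt_d9]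
  rw [abs_le]
  constructor <;> linarith

lemma log_mainLength_le (h : Admissible T Y) : Real.log (mainLength T Y) ≤ Real.log T := by
  have hY := h.one_le_Y
  have h1 : (1 : ℝ) ≤ mainLength T Y := by exact_mod_cast one_le_mainLength h
  refine Real.log_le_log (by linarith) ((mainLength_le h).trans (div_le_self ?_ ?_))
  · linarith [h.hundred_le]
  · exact one_le_pow₀ hY

end mainLength

lemma sum_norm_sq_char_div_le {q : ℕ} (χ : DirichletCharacter ℂ q) (N : ℕ) :
    ∑ n ∈ Icc 1 N, ‖χ (n : ZMod q)‖ ^ 2 / n ≤ 1 + Real.log N := by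
  refine le_trans (Finset.sum_le_sum fun n _ => ?_) (sum_inv_nat_le N)
  have h1 : ‖χ (n : ZMod q)‖ ^ 2 ≤ 1 := pow_le_one₀ (norm_nonneg _) (χ.norm_le_one _)
  gcongr

lemma norm_add_sq_le_two (a b : ℂ) : ‖a + b‖ ^ 2 ≤ 2 * (‖a‖ ^ 2 + ‖b‖ ^ 2) := by
  have h := norm_add_le a b
  have h2 : ‖a + b‖ ^ 2 ≤ (‖a‖ + ‖b‖) ^ 2 := by gcongr
  linarith [sq_nonneg (‖a‖ - ‖b‖)]

lemma norm_add_add_sq_le (a b c : ℂ) : ‖a + b + c‖ ^ 2 ≤ 3 * (‖a‖ ^ 2 + ‖b‖ ^ 2 + ‖c‖ ^ 2) := by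
  have h := norm_add₃_le (a := a) (b := b) (c := c)
  have h2 : ‖a + b + c‖ ^ 2 ≤ (‖a‖ + ‖b‖ + ‖c‖) ^ 2 := by gcongr
  linarith [sq_nonneg (‖a‖ - ‖b‖), sq_nonneg (‖a‖ - ‖c‖), sq_nonneg (‖b‖ - ‖c‖)]

lemma Admissible.one_add_log_le {T : ℝ} {Y : ℕ} (h : Admissible T Y) :
    1 + Real.log (1 + 7 * Real.log Y) ≤ Real.log T := by
  have h1 := h.two_le_logY
  have h2 := h.logY_le
  have h3 := Real.log_le_sub_one_of_pos (by linarith : 0 < 1 + 7 * Real.log Y)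
  linarith

lemma Admissible.one_le_one_add_log {T : ℝ} {Y : ℕ} (h : Admissible T Y) :
    1 ≤ 1 + Real.log (1 + 7 * Real.log Y) := by
  have h1 := h.two_le_logY
  linarith [Real.log_nonneg (by linarith : 1 ≤ 1 + 7 * Real.log Y)]

/-- A crude bound for the second moment of `L` on the critical line. -/
theorem exists_integral_norm_sq_LFunction_le {q : ℕ} [NeZero q] {χ : DirichletCharacter ℂ q}
    (hχ : χ.IsPrimitive) : ∃ K : ℝ, 0 ≤ K ∧ ∀ (T : ℝ) (Y : ℕ), Admissible T Y →
      (∫ t in T..(2 * T), ‖DirichletCharacter.LFunction χ (1 / 2 + t * I)‖ ^ 2) ≤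
        K * T * Real.log T ^ 3 := by
  obtain ⟨K, hK0, hK⟩ := exists_integral_norm_sq_sub_dirPoly_le hχ
  refine ⟨4 * K + 8, by positivity, fun T Y h => ?_⟩
  have hT := h.hundred_le
  have hTT : T ≤ 2 * T := by linarith
  set δ : ℕ → ℂ := fun n => if n = 1 then 1 else 0 with hδ
  have hY1 : 1 ∈ Icc 1 Y := Finset.mem_Icc.mpr ⟨le_rfl, by have := h.two_le; omega⟩
  have hdir : ∀ s, dirPoly δ Y s = 1 := by
    intro s
    rw [dirPoly, Finset.sum_eq_single 1]
    · simp [hδ]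
    · intro b _ hb; simp [hδ, hb]
    · intro h'; exact absurd hY1 h'
  have hhalf : halfSum δ Y = 1 := by
    rw [halfSum, Finset.sum_eq_single 1]
    · simp [hδ]
    · intro b _ hb; simp [hδ, hb]
    · intro h'; exact absurd hY1 h'
  have hlcm : lcmSum δ Y ≤ 1 := by
    have := lcmSum_le_halfSum_sq δ Y
    rwa [hhalf, one_pow] at this
  have hKδ := hK T Y h δ
  simp only [hdir, mul_one, hhalf, one_pow] at hKδ
  set D : ℝ → ℂ := fun t => dirPoly (fun n => χ (n : ZMod q)) (mainLength T Y) (1 / 2 + t * I) with hD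
  have hDc : Continuous D := continuous_dirPoly_half_line _ _
  have hLc := continuous_LFunction_half_line χ (by linarith : 0 < T)
  have hlY := h.two_le_logY
  have hlT := h.logY_le
  have hℓ0 : 80 ≤ Real.log T := by linarith
  have hw1 := h.one_add_log_le
  have hw0 := h.one_le_one_add_log
  have hY := h.one_le_Y
  have hDint : ∫ t in T..(2 * T), ‖D t‖ ^ 2 ≤ 2 * T * (1 + Real.log T) := by
    have hcond : 4 * (mainLength T Y : ℝ) * (1 + Real.log (mainLength T Y)) ≤ T := by
      have h1 := h.length_cond (mainLength_mul_le h)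
      have h2 : mainLength T Y ≤ mainLength T Y * Y := Nat.le_mul_of_pos_right _ (by have := h.two_le; omega)
      have h3 : (mainLength T Y : ℝ) ≤ (mainLength T Y * Y : ℕ) := by exact_mod_cast h2
      have h4 : (1 : ℝ) ≤ mainLength T Y := by exact_mod_cast one_le_mainLength h
      have h5 := Real.log_le_log (by linarith) h3
      have h6 := Real.log_nonneg h4
      refine le_trans ?_ h1
      gcongr
    refine (integral_norm_sq_dirPoly_le _ _ hcond).trans ?_
    have h1 := sum_norm_sq_char_div_le χ (mainLength T Y)
    have h2 := log_mainLength_le h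
    gcongr
    linarith
  have hmono : (∫ t in T..(2 * T), ‖DirichletCharacter.LFunction χ (1 / 2 + t * I)‖ ^ 2) ≤
      ∫ t in T..(2 * T), (2 * ‖DirichletCharacter.LFunction χ (1 / 2 + t * I) - D t‖ ^ 2 + 2 * ‖D t‖ ^ 2) := by
    refine intervalIntegral.integral_mono_on hTT ?_ ?_ ?_
    · exact (hLc.norm.pow 2).intervalIntegrable
    · exact ((((hLc.sub hDc.continuousOn).norm.pow 2).const_smul (2 : ℝ)).add
        (((hDc.continuousOn).norm.pow 2).const_smul (2 : ℝ))).intervalIntegrable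
    · intro t _
      have := norm_add_sq_le_two (DirichletCharacter.LFunction χ (1 / 2 + t * I) - D t) (D t)
      rw [sub_add_cancel] at this
      linarith
  rw [intervalIntegral.integral_add, intervalIntegral.integral_const_mul,
    intervalIntegral.integral_const_mul] at hmono
  rotate_left
  · exact (((hLc.sub hDc.continuousOn).norm.pow 2).const_smul (2 : ℝ)).intervalIntegrable
  · exact (((hDc.continuousOn).norm.pow 2).const_smul (2 : ℝ)).intervalIntegrable
  set ℓ := Real.log T with hℓ
  have hmain : (1 + Real.log (1 + 7 * Real.log Y)) ^ 2 * Real.log Y * lcmSum δ Y + 1 / (Y : ℝ) ^ 2 ≤ ℓ ^ 3 + 1 := by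
    have h0 := lcmSum_nonneg δ Y
    have h1 : (1 + Real.log (1 + 7 * Real.log Y)) ^ 2 ≤ ℓ ^ 2 := by gcongr
    have h2 : (1 + Real.log (1 + 7 * Real.log Y)) ^ 2 * Real.log Y * lcmSum δ Y ≤ ℓ ^ 2 * ℓ * 1 := by
      gcongr
      linarith
    have h3 : 1 / (Y : ℝ) ^ 2 ≤ 1 := div_le_one_of_le₀ (one_le_pow₀ hY) (by positivity)
    linarith [pow_succ ℓ 2]
  have h3 : (1 : ℝ) ≤ ℓ ^ 3 := one_le_pow₀ (by linarith)
  have h4 : 1 + ℓ ≤ 2 * ℓ ^ 3 := by nlinarith [le_self_pow₀ (by linarith : 1 ≤ ℓ) (by norm_num : 3 ≠ 0)]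
  calc (∫ t in T..(2 * T), ‖DirichletCharacter.LFunction χ (1 / 2 + t * I)‖ ^ 2)
      ≤ 2 * (K * T * (ℓ ^ 3 + 1)) + 2 * (2 * T * (1 + ℓ)) := by
        refine hmono.trans (add_le_add (mul_le_mul_of_nonneg_left (hKδ.trans ?_) (by norm_num))
          (mul_le_mul_of_nonneg_left hDint (by norm_num)))
        exact mul_le_mul_of_nonneg_left hmain (by positivity)
    _ ≤ 2 * (K * T * (2 * ℓ ^ 3)) + 2 * (2 * T * (2 * ℓ ^ 3)) := by
        have : ℓ ^ 3 + 1 ≤ 2 * ℓ ^ 3 := by linarith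
        gcongr
    _ = (4 * K + 8) * T * ℓ ^ 3 := by ring

/-- Approximation of the mollified `L`-function by the mollified Dirichlet polynomial, in mean square. -/
theorem exists_integral_norm_sq_mollified_sub_le {q : ℕ} [NeZero q] {χ : DirichletCharacter ℂ q}
    (hχ : χ.IsPrimitive) : ∃ C : ℝ, 0 ≤ C ∧ ∀ (T : ℝ) (Y : ℕ), Admissible T Y →
      ∀ (r G : ℕ → ℂ) (K : ℕ), Y ≤ K → (∀ n, K < n → r n = 0) →
      (∀ N : ℕ, N ≠ 0 → ∑ k ∈ N.divisors, χ ((N / k : ℕ) : ZMod q) * r k = G N) →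
      (∫ t in T..(2 * T), ‖DirichletCharacter.LFunction χ (1 / 2 + t * I) *
          dirPoly r K (1 / 2 + t * I) - dirPoly G (mainLength T Y) (1 / 2 + t * I)‖ ^ 2) ≤
        C * T * ((1 + Real.log (1 + 7 * Real.log Y)) ^ 2 * Real.log Y * lcmSum r Y
          + halfSum r Y ^ 2 / Y ^ 2 + halfSum (tailPart r Y) K ^ 2 * Real.log T ^ 3) := by
  obtain ⟨K₁, hK₁0, hK₁⟩ := exists_integral_norm_sq_sub_dirPoly_le hχ
  obtain ⟨K₂, hK₂0, hK₂⟩ := exists_integral_norm_sq_LFunction_le hχ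
  refine ⟨3 * (K₁ + K₂ + 4), by positivity, fun T Y h r G K hYK hr hG => ?_⟩
  have hT := h.hundred_le
  have hTT : T ≤ 2 * T := by linarith
  have hT0 : 0 < T := by linarith
  have hlY := h.two_le_logY
  have hlT := h.logY_le
  have hw0 := h.one_le_one_add_log
  have hE1 := hK₁ T Y h r
  have hE2 := hK₂ T Y h
  obtain ⟨e, he, hesum⟩ := exists_dirPoly_mul_sub_eq (β := fun n => χ (n : ZMod q)) (r := r) (G := G)
    (Y := Y) (K := K) (B := mainLength T Y) (fun n => χ.norm_le_one _) (by have := h.two_le; omega) hYK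
    (one_le_mainLength h) hr hG
  have hE3 := integral_norm_sq_dirPoly_le e _ (h.length_cond (mainLength_mul_le h))
  set x := mainLength T Y with hx
  set S := lcmSum r Y with hS
  set H := halfSum r Y with hH
  set τ := halfSum (tailPart r Y) K with hτ
  set w := 1 + Real.log (1 + 7 * Real.log Y) with hw
  set ℓ := Real.log T with hℓ
  have hS0 : 0 ≤ S := lcmSum_nonneg r Y
  have hτ0 : 0 ≤ τ := halfSum_nonneg _ _
  have hSt : lcmSum (tailPart r Y) K ≤ τ ^ 2 := lcmSum_le_halfSum_sq _ _
  set L : ℝ → ℂ := fun t => DirichletCharacter.LFunction χ (1 / 2 + t * I) with hL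
  set D : ℝ → ℂ := fun t => dirPoly (fun n => χ (n : ZMod q)) x (1 / 2 + t * I) with hD
  set R : ℝ → ℂ := fun t => dirPoly r Y (1 / 2 + t * I) with hR
  set U : ℝ → ℂ := fun t => dirPoly (tailPart r Y) K (1 / 2 + t * I) with hU
  set E : ℝ → ℂ := fun t => dirPoly e (x * Y) (1 / 2 + t * I) with hE
  have hLc : ContinuousOn L (Set.uIcc T (2 * T)) := continuous_LFunction_half_line χ hT0
  have hDc : Continuous D := continuous_dirPoly_half_line _ _
  have hRc : Continuous R := continuous_dirPoly_half_line _ _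
  have hUc : Continuous U := continuous_dirPoly_half_line _ _
  have hEc : Continuous E := continuous_dirPoly_half_line _ _
  have hUb : ∀ t, ‖U t‖ ≤ τ := fun t => norm_dirPoly_le_halfSum _ _ _
  have hid : ∀ t : ℝ, L t * dirPoly r K (1 / 2 + t * I) - dirPoly G x (1 / 2 + t * I)
      = (L t - D t) * R t + L t * U t + E t := by
    intro t
    rw [dirPoly_add_tailPart hYK]
    have := he (1 / 2 + t * I)
    simp only [hE, ← this, hD, hR, hU]
    ring
  have h1c : ContinuousOn (fun t => ‖(L t - D t) * R t‖ ^ 2) (Set.uIcc T (2 * T)) :=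
    ((hLc.sub hDc.continuousOn).mul hRc.continuousOn).norm.pow 2
  have h2c : ContinuousOn (fun t => ‖L t‖ ^ 2) (Set.uIcc T (2 * T)) := hLc.norm.pow 2
  have h3c : ContinuousOn (fun t => ‖E t‖ ^ 2) (Set.uIcc T (2 * T)) := hEc.continuousOn.norm.pow 2
  have i1 : IntervalIntegrable (fun t => 3 * ‖(L t - D t) * R t‖ ^ 2) volume T (2 * T) :=
    h1c.intervalIntegrable.const_mul 3
  have i2 : IntervalIntegrable (fun t => 3 * τ ^ 2 * ‖L t‖ ^ 2) volume T (2 * T) :=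
    h2c.intervalIntegrable.const_mul (3 * τ ^ 2)
  have i3 : IntervalIntegrable (fun t => 3 * ‖E t‖ ^ 2) volume T (2 * T) :=
    h3c.intervalIntegrable.const_mul 3
  have hmono : (∫ t in T..(2 * T), ‖L t * dirPoly r K (1 / 2 + t * I) - dirPoly G x (1 / 2 + t * I)‖ ^ 2) ≤
      ∫ t in T..(2 * T), (3 * ‖(L t - D t) * R t‖ ^ 2 + 3 * τ ^ 2 * ‖L t‖ ^ 2 + 3 * ‖E t‖ ^ 2) := by
    refine intervalIntegral.integral_mono_on hTT ?_ ?_ ?_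
    · exact ((((hLc.mul (continuous_dirPoly_half_line r K).continuousOn).sub
        (continuous_dirPoly_half_line G x).continuousOn).norm.pow 2)).intervalIntegrable
    · exact (i1.add i2).add i3
    · intro t _
      rw [hid t]
      have h1 := norm_add_add_sq_le ((L t - D t) * R t) (L t * U t) (E t)
      have h2 : ‖L t * U t‖ ^ 2 ≤ τ ^ 2 * ‖L t‖ ^ 2 := by
        rw [norm_mul, mul_pow, mul_comm]
        have := hUb t
        gcongr
      linarith
  rw [intervalIntegral.integral_add, intervalIntegral.integral_add, intervalIntegral.integral_const_mul,
    intervalIntegral.integral_const_mul, intervalIntegral.integral_const_mul] at hmono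
  rotate_left
  · exact i1
  · exact i2
  · exact i1.add i2
  · exact i3
  have hA : 1 + Real.log (2 * x) ≤ 2 * ℓ ^ 3 := by
    have hx1 : (1 : ℝ) ≤ x := by exact_mod_cast one_le_mainLength h
    have h1 : Real.log x ≤ ℓ := log_mainLength_le h
    rw [Real.log_mul (by norm_num) (by linarith)]
    have h2 : Real.log 2 ≤ 1 := by linarith [Real.log_two_lt_d9]
    have h3 : ℓ ≤ ℓ ^ 3 := le_self_pow₀ (by linarith : 1 ≤ ℓ) (by norm_num)
    linarith
  have hB : 1 + Real.log Y ≤ 2 * (w ^ 2 * Real.log Y) := by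
    have : 1 ≤ w ^ 2 := one_le_pow₀ hw0
    nlinarith
  have hℓ3 : 0 ≤ ℓ ^ 3 := pow_nonneg (by linarith) 3
  set a := w ^ 2 * Real.log Y * S with ha
  set b := H ^ 2 / (Y : ℝ) ^ 2 with hb
  set c := τ ^ 2 * ℓ ^ 3 with hc
  have hb0 : 0 ≤ b := by positivity
  have ha0 : 0 ≤ a := by have : 0 ≤ Real.log Y := by linarith
                         positivity
  have hc0 : 0 ≤ c := by positivity
  have hes : ∑ N ∈ Icc 1 (x * Y), ‖e N‖ ^ 2 / N ≤ 2 * c + 2 * a := by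
    refine hesum.trans (add_le_add ?_ ?_)
    · calc (1 + Real.log (2 * x)) * lcmSum (tailPart r Y) K ≤ 2 * ℓ ^ 3 * τ ^ 2 :=
            mul_le_mul hA hSt (lcmSum_nonneg _ _) (by positivity)
        _ = 2 * c := by rw [hc]; ring
    · calc (1 + Real.log Y) * S ≤ 2 * (w ^ 2 * Real.log Y) * S := by gcongr
        _ = 2 * a := by rw [ha]; ring
  calc _ ≤ 3 * (∫ t in T..(2 * T), ‖(L t - D t) * R t‖ ^ 2) + 3 * τ ^ 2 * (∫ t in T..(2 * T), ‖L t‖ ^ 2)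
        + 3 * ∫ t in T..(2 * T), ‖E t‖ ^ 2 := hmono
    _ ≤ 3 * (K₁ * T * (a + b)) + 3 * τ ^ 2 * (K₂ * T * ℓ ^ 3) + 3 * (2 * T * (2 * c + 2 * a)) := by
        refine add_le_add (add_le_add (mul_le_mul_of_nonneg_left hE1 (by norm_num))
          (mul_le_mul_of_nonneg_left hE2 (by positivity))) (mul_le_mul_of_nonneg_left ?_ (by norm_num))
        exact hE3.trans (mul_le_mul_of_nonneg_left hes (by positivity))
    _ = 3 * T * (K₁ * (a + b) + K₂ * c + 4 * (a + c)) := by rw [hc]; ring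
    _ ≤ 3 * T * ((K₁ + K₂ + 4) * (a + b + c)) := by
        refine mul_le_mul_of_nonneg_left ?_ (by positivity)
        nlinarith [mul_nonneg hK₁0 hc0, mul_nonneg hK₂0 ha0, mul_nonneg hK₂0 hb0]
    _ = _ := by ring

lemma abs_norm_sq_sub_norm_sq_le (a b : ℂ) {δ : ℝ} (hδ : 0 < δ) (hδ1 : δ ≤ 1) :
    |‖a‖ ^ 2 - ‖b‖ ^ 2| ≤ 2 / δ * ‖a - b‖ ^ 2 + δ * ‖b‖ ^ 2 := by
  have h1 : |‖a‖ - ‖b‖| ≤ ‖a - b‖ := abs_norm_sub_norm_le a b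
  have h2 : ‖a‖ ≤ ‖a - b‖ + ‖b‖ := by
    have := norm_add_le (a - b) b
    rwa [sub_add_cancel] at this
  set d := ‖a - b‖ with hd
  have hd0 : 0 ≤ d := norm_nonneg _
  have e : ‖a‖ ^ 2 - ‖b‖ ^ 2 = (‖a‖ - ‖b‖) * (‖a‖ + ‖b‖) := by ring
  rw [e, abs_mul, abs_of_nonneg (by positivity : 0 ≤ ‖a‖ + ‖b‖)]
  have h3 : |‖a‖ - ‖b‖| * (‖a‖ + ‖b‖) ≤ d * (d + 2 * ‖b‖) := by
    refine mul_le_mul h1 (by linarith) (by positivity) hd0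
  have h4 : 2 * d * ‖b‖ ≤ d ^ 2 / δ + δ * ‖b‖ ^ 2 := by
    have e2 : d ^ 2 / δ + δ * ‖b‖ ^ 2 - 2 * d * ‖b‖ = (d - δ * ‖b‖) ^ 2 / δ := by
      field_simp; ring
    have : 0 ≤ (d - δ * ‖b‖) ^ 2 / δ := by positivity
    linarith
  have h5 : d ^ 2 ≤ d ^ 2 / δ := by
    rw [le_div_iff₀ hδ]; nlinarith [sq_nonneg d]
  have e3 : 2 / δ * d ^ 2 = d ^ 2 / δ + d ^ 2 / δ := by ring
  nlinarith

lemma abs_integral_norm_sq_sub_le {f m : ℝ → ℂ} {T δ : ℝ} (hT : 0 ≤ T) (hδ : 0 < δ) (hδ1 : δ ≤ 1)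
    (hf : ContinuousOn f (Set.uIcc T (2 * T))) (hm : ContinuousOn m (Set.uIcc T (2 * T))) :
    |(∫ t in T..(2 * T), ‖f t‖ ^ 2) - ∫ t in T..(2 * T), ‖m t‖ ^ 2| ≤
      2 / δ * (∫ t in T..(2 * T), ‖f t - m t‖ ^ 2) + δ * ∫ t in T..(2 * T), ‖m t‖ ^ 2 := by
  have i1 : IntervalIntegrable (fun t => ‖f t‖ ^ 2) volume T (2 * T) := (hf.norm.pow 2).intervalIntegrable
  have i2 : IntervalIntegrable (fun t => ‖m t‖ ^ 2) volume T (2 * T) := (hm.norm.pow 2).intervalIntegrable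
  have i3 : IntervalIntegrable (fun t => ‖f t - m t‖ ^ 2) volume T (2 * T) :=
    ((hf.sub hm).norm.pow 2).intervalIntegrable
  rw [← intervalIntegral.integral_sub i1 i2, ← intervalIntegral.integral_const_mul,
    ← intervalIntegral.integral_const_mul,
    ← intervalIntegral.integral_add (i3.const_mul _) (i2.const_mul _)]
  refine (intervalIntegral.abs_integral_le_integral_abs (by linarith)).trans ?_
  exact intervalIntegral.integral_mono_on (by linarith) (i1.sub i2).abs
    ((i3.const_mul _).add (i2.const_mul _)) fun t _ => abs_norm_sq_sub_norm_sq_le _ _ hδ hδ1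

lemma dirPoly_eq_of_eq_zero {c : ℕ → ℂ} {K K' : ℕ} (hc : ∀ n, K < n → c n = 0) (h : K ≤ K') (s : ℂ) :
    dirPoly c K s = dirPoly c K' s := by
  refine Finset.sum_subset (Finset.Icc_subset_Icc_right h) fun n hn hn' => ?_
  have : K < n := by
    by_contra hle
    exact hn' (Finset.mem_Icc.mpr ⟨(Finset.mem_Icc.mp hn).1, not_lt.mp hle⟩)
  rw [hc n this, zero_mul]

/-- The Euler product giving the leading constant of the mollified second moment. -/
noncomputable def mollifierProd (X : ℝ) : ℝ :=
  ∏ p ∈ primesLe ⌊X⌋₊, (1 - 1 / (p : ℝ) + tailWeight X p ^ 2 / (p : ℝ) ^ 2)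

lemma mollifierProd_factor_mem {X : ℝ} {p : ℕ} (hp : p ∈ primesLe ⌊X⌋₊) :
    0 ≤ 1 - 1 / (p : ℝ) + tailWeight X p ^ 2 / (p : ℝ) ^ 2 ∧
      1 - 1 / (p : ℝ) + tailWeight X p ^ 2 / (p : ℝ) ^ 2 ≤ 1 := by
  have hp1 : (1 : ℝ) ≤ p := by exact_mod_cast (mem_primesLe.mp hp).1.one_le
  have h1 : 1 / (p : ℝ) ≤ 1 := div_le_one_of_le₀ hp1 (by positivity)
  have h2 : tailWeight X p ^ 2 ≤ 1 := pow_le_one₀ (tailWeight_nonneg X p) (tailWeight_le_one X p)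
  have h3 : tailWeight X p ^ 2 / (p : ℝ) ^ 2 ≤ 1 / p := by
    rw [div_le_div_iff₀ (by positivity) (by linarith)]
    nlinarith
  have h4 : 0 ≤ tailWeight X p ^ 2 / (p : ℝ) ^ 2 := by positivity
  constructor <;> linarith

lemma mollifierProd_nonneg (X : ℝ) : 0 ≤ mollifierProd X :=
  Finset.prod_nonneg fun _ hp => (mollifierProd_factor_mem hp).1

lemma mollifierProd_le_one (X : ℝ) : mollifierProd X ≤ 1 :=
  Finset.prod_le_one (fun _ hp => (mollifierProd_factor_mem hp).1) fun _ hp => (mollifierProd_factor_mem hp).2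

lemma abs_sum_locFactor_div_sub_le {X σ : ℝ} (hσ0 : 0 ≤ σ) (hσ : σ < 1 / 2) {x Y : ℕ} (hx : 1 ≤ x)
    (hY : 0 < Y) :
    |∑ N ∈ Icc 1 x, locFactor (fun p => tailWeight X p ^ 2) (primesLe ⌊X⌋₊) N / N
        - mollifierProd X * Real.log x| ≤
      (1 + Real.log Y) * ∏ p ∈ primesLe ⌊X⌋₊, (1 - 1 / (p : ℝ))⁻¹
        + 2 * ((Y : ℝ) ^ (-σ) * ∏ p ∈ primesLe ⌊X⌋₊, (1 - (p : ℝ) ^ (-(1 / 2 - σ)))⁻¹) := by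
  have hP : ∀ p ∈ primesLe ⌊X⌋₊, p.Prime := fun p hp => (mem_primesLe.mp hp).1
  obtain ⟨lam, K, h1, h2, h3, h4, h5⟩ := exists_mollifier_coeffs (χ := fun _ => 1) (by simp) (by simp)
    (c := fun p => tailWeight X p ^ 2) (fun p => sq_nonneg _)
    (fun p => pow_le_one₀ (tailWeight_nonneg X p) (tailWeight_le_one X p)) (primesLe ⌊X⌋₊) hP
  have h6 := norm_sum_div_sub_le (lam := lam) (K := K) h3
    (G := fun n => (locFactor (fun p => tailWeight X p ^ 2) (primesLe ⌊X⌋₊) n : ℂ))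
    (fun n hn => by simpa using h5 n hn) hx
  have h7 : ∑ k ∈ Icc 1 K, lam k / k = (mollifierProd X : ℂ) := by
    have := h4 1
    rw [dirPoly] at this
    simp only [Complex.cpow_neg_one, one_mul] at this
    simp_rw [div_eq_mul_inv]
    rw [← this, mollifierProd]
    push_cast
    refine Finset.prod_congr rfl fun p _ => ?_
    rw [inv_pow, one_div, div_eq_mul_inv]
  rw [h7] at h6
  have h8 : (∑ N ∈ Icc 1 x, (locFactor (fun p => tailWeight X p ^ 2) (primesLe ⌊X⌋₊) N : ℂ) / N
      - mollifierProd X * Real.log x) = ((∑ N ∈ Icc 1 x,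
        locFactor (fun p => tailWeight X p ^ 2) (primesLe ⌊X⌋₊) N / N
        - mollifierProd X * Real.log x : ℝ) : ℂ) := by push_cast; rfl
  rw [h8, Complex.norm_real, Real.norm_eq_abs] at h6
  refine h6.trans ((sum_norm_div_mul_one_add_log_le hP h1 h2 Y K).trans ?_)
  have := halfSum_tailPart_le_prod hP h1 h2 hσ0 hσ hY K
  linarith

set_option maxHeartbeats 1000000 in
theorem exists_abs_integral_norm_sq_sub_le {q : ℕ} [NeZero q] {χ : DirichletCharacter ℂ q}
    (hχ : χ.IsPrimitive) : ∃ C : ℝ, 0 ≤ C ∧ ∀ (T : ℝ) (Y : ℕ), Admissible T Y →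
      ∀ X σ δ V Z R : ℝ, (q : ℝ) ^ 2 < X → 0 ≤ σ → σ < 1 / 2 → 0 < δ → δ ≤ 1 →
      V = ∏ p ∈ primesLe ⌊X⌋₊, (1 - 1 / (p : ℝ))⁻¹ →
      Z = ∏ p ∈ primesLe ⌊X⌋₊, (1 - (p : ℝ) ^ (-(1 / 2 - σ)))⁻¹ →
      R = (1 + Real.log Y) * V + 2 * ((Y : ℝ) ^ (-σ) * Z) →
      |(∫ t in T..(2 * T), ‖DirichletCharacter.LFunction χ (1 / 2 + t * I) *
          QX X χ (1 / 2 + t * I)‖ ^ 2) - T * (mollifierProd X * Real.log T)| ≤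
        2 / δ * (C * T * ((1 + Real.log (1 + 7 * Real.log Y)) ^ 2 * Real.log Y * V ^ 3
          + Z ^ 2 / Y ^ 2 + ((Y : ℝ) ^ (-σ) * Z) ^ 2 * Real.log T ^ 3))
          + δ * (2 * T * (Real.log T + R)) + T * (2 * R + 9 * Real.log Y) := by
  obtain ⟨C, hC0, hC⟩ := exists_integral_norm_sq_mollified_sub_le hχ
  refine ⟨C, hC0, fun T Y h X σ δ V Z R hX hσ0 hσ hδ hδ1 hV hZ hR => ?_⟩
  have hP : ∀ p ∈ primesLe ⌊X⌋₊, p.Prime := fun p hp => (mem_primesLe.mp hp).1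
  obtain ⟨r, K₀, hr1, hr2, hr3, hr4, hr5⟩ := exists_mollifier_coeffs
    (χ := fun n => χ (n : ZMod q)) (by intro a b; push_cast; exact map_mul χ _ _)
    (fun n => χ.norm_le_one _) (c := tailWeight X) (tailWeight_nonneg X) (tailWeight_le_one X)
    (primesLe ⌊X⌋₊) hP
  set K := max K₀ Y with hK
  have hT := h.hundred_le
  have hT0 : 0 < T := by linarith
  have hY1 : 0 < Y := by have := h.two_le; omega
  have hY := h.one_le_Y
  have hlY := h.two_le_logY
  have hlT := h.logY_le
  have hX0 : 0 ≤ X := le_trans (by positivity) hX.le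
  set G : ℕ → ℂ := fun n => χ (n : ZMod q) * locFactor (tailWeight X) (primesLe ⌊X⌋₊) n with hG
  have hQ : ∀ s, QX X χ s = dirPoly r K s := by
    intro s
    rw [QX_eq_prod hX0, hr4, dirPoly_eq_of_eq_zero hr3 (le_max_left K₀ Y)]
  have hrK : ∀ n, K < n → r n = 0 := fun n hn => hr3 n ((le_max_left K₀ Y).trans_lt hn)
  have hdiff := hC T Y h r G K (le_max_right K₀ Y) hrK hr5
  simp_rw [hQ]
  set x := mainLength T Y with hx
  set ℓ := Real.log T with hℓ
  set w := 1 + Real.log (1 + 7 * Real.log Y) with hw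
  have hx1 : 1 ≤ x := one_le_mainLength h
  have hZ0 : 0 ≤ Z := by
    refine le_trans (halfSum_nonneg r Y) ?_
    rw [hZ]; exact halfSum_le_prod hP hr1 hr2 hσ0 hσ Y
  have hH : halfSum r Y ≤ Z := by rw [hZ]; exact halfSum_le_prod hP hr1 hr2 hσ0 hσ Y
  have hτ : halfSum (tailPart r Y) K ≤ (Y : ℝ) ^ (-σ) * Z := by
    rw [hZ]; exact halfSum_tailPart_le_prod hP hr1 hr2 hσ0 hσ hY1 K
  have hS : lcmSum r Y ≤ V ^ 3 := by rw [hV]; exact lcmSum_le_pow_three hP hr1 hr2 Y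
  set M := ∑ N ∈ Icc 1 x, ‖G N‖ ^ 2 / N with hM
  have hMeq : M = ∑ N ∈ Icc 1 x, locFactor (fun p => tailWeight X p ^ 2) (primesLe ⌊X⌋₊) N / N :=
    Finset.sum_congr rfl fun N _ => by rw [hG]; simp only; rw [norm_char_mul_locFactor_sq χ hX]
  have hMR : |M - mollifierProd X * Real.log x| ≤ R := by
    rw [hMeq, hR, hV, hZ]
    exact abs_sum_locFactor_div_sub_le hσ0 hσ hx1 hY1
  have hM0 : 0 ≤ M := Finset.sum_nonneg fun _ _ => by positivity
  have hpr0 := mollifierProd_nonneg X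
  have hpr1 := mollifierProd_le_one X
  have hlx := abs_log_mainLength_sub_le h
  have hlx' := log_mainLength_le h
  have hlx0 : 0 ≤ Real.log x := Real.log_natCast_nonneg x
  have hMub : M ≤ ℓ + R := by
    have h1 := (abs_le.mp hMR).2
    have h2 : mollifierProd X * Real.log x ≤ 1 * ℓ := mul_le_mul hpr1 hlx' hlx0 zero_le_one
    linarith
  have hcond := h.length_cond (mainLength_mul_le h)
  have hx1' : (1 : ℝ) ≤ x := by exact_mod_cast hx1
  have hcond1 : 4 * (x : ℝ) * (1 + Real.log x) * Y ≤ T := by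
    refine le_trans ?_ hcond
    push_cast
    rw [← hx]
    have : Real.log x ≤ Real.log (x * Y) := Real.log_le_log (by linarith) (by nlinarith)
    calc 4 * (x : ℝ) * (1 + Real.log x) * Y = 4 * (x * Y) * (1 + Real.log x) := by ring
      _ ≤ 4 * (x * Y) * (1 + Real.log (x * Y)) := by gcongr
  have hmean := abs_integral_norm_sq_dirPoly_sub_le G x T
  rw [← hM] at hmean
  set J := ∫ t in T..(2 * T), ‖dirPoly G x (1 / 2 + t * I)‖ ^ 2 with hJ
  have hc0 : 0 ≤ 4 * (x : ℝ) * (1 + Real.log x) := by positivity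
  have hcT : 4 * (x : ℝ) * (1 + Real.log x) ≤ T := by
    refine le_trans ?_ hcond1
    nlinarith
  have hR0 : 0 ≤ R := (abs_nonneg _).trans hMR
  have hJub : J ≤ 2 * T * (ℓ + R) := by
    have h1 := (abs_le.mp hmean).2
    have h2 : 4 * (x : ℝ) * (1 + Real.log x) * M ≤ T * M := by gcongr
    have h3 : T * M ≤ T * (ℓ + R) := by gcongr
    linarith
  have hℓY : ℓ ≤ Y := by
    have := h.le_Y
    have h1 := h.one_le_log
    rw [← hℓ] at this h1
    nlinarith
  have herr : 4 * (x : ℝ) * (1 + Real.log x) * M ≤ T * (1 + R) := by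
    have h1 : 4 * (x : ℝ) * (1 + Real.log x) * M ≤ 4 * (x : ℝ) * (1 + Real.log x) * (Y + R) := by
      refine mul_le_mul_of_nonneg_left ?_ hc0
      linarith
    have h2 : 4 * (x : ℝ) * (1 + Real.log x) * R ≤ T * R := by gcongr
    linarith
  have hJmain : |J - T * (mollifierProd X * ℓ)| ≤ T * (2 * R + 9 * Real.log Y) := by
    have e : J - T * (mollifierProd X * ℓ) = (J - T * M) + T * (M - mollifierProd X * Real.log x)
        + T * (mollifierProd X * (Real.log x - ℓ)) := by ring
    rw [e]
    refine (abs_add_three _ _ _).trans ?_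
    rw [abs_mul T, abs_mul T, abs_mul (mollifierProd X), abs_of_pos hT0, abs_of_nonneg hpr0]
    have h1 : T * |M - mollifierProd X * Real.log x| ≤ T * R := by gcongr
    have h2 : mollifierProd X * |Real.log x - ℓ| ≤ 1 * (8 * Real.log Y) :=
      mul_le_mul hpr1 hlx (abs_nonneg _) zero_le_one
    have h3 := mul_le_mul_of_nonneg_left h2 hT0.le
    have h4 : T * 1 ≤ T * Real.log Y := by
      refine mul_le_mul_of_nonneg_left ?_ hT0.le
      linarith
    linarith
  have hfc : ContinuousOn (fun t : ℝ => DirichletCharacter.LFunction χ (1 / 2 + t * I) *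
      dirPoly r K (1 / 2 + t * I)) (Set.uIcc T (2 * T)) :=
    (continuous_LFunction_half_line χ hT0).mul (continuous_dirPoly_half_line r K).continuousOn
  have hcmp := abs_integral_norm_sq_sub_le hT0.le hδ hδ1 hfc (continuous_dirPoly_half_line G x).continuousOn
  rw [← hJ] at hcmp
  have hdiff' : (∫ t in T..(2 * T), ‖DirichletCharacter.LFunction χ (1 / 2 + t * I) *
      dirPoly r K (1 / 2 + t * I) - dirPoly G x (1 / 2 + t * I)‖ ^ 2) ≤
      C * T * (w ^ 2 * Real.log Y * V ^ 3 + Z ^ 2 / Y ^ 2 + ((Y : ℝ) ^ (-σ) * Z) ^ 2 * ℓ ^ 3) := by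
    refine hdiff.trans (mul_le_mul_of_nonneg_left ?_ (by positivity))
    have h1 : 0 ≤ w ^ 2 * Real.log Y := mul_nonneg (sq_nonneg _) (by linarith)
    have h2 : halfSum r Y ^ 2 ≤ Z ^ 2 := pow_le_pow_left₀ (halfSum_nonneg _ _) hH 2
    have h3 : halfSum (tailPart r Y) K ^ 2 ≤ ((Y : ℝ) ^ (-σ) * Z) ^ 2 :=
      pow_le_pow_left₀ (halfSum_nonneg _ _) hτ 2
    have h4 : 0 ≤ ℓ ^ 3 := pow_nonneg (by linarith) 3
    exact add_le_add (add_le_add (mul_le_mul_of_nonneg_left hS h1)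
      (div_le_div_of_nonneg_right h2 (by positivity))) (mul_le_mul_of_nonneg_right h3 h4)
  refine (abs_sub_le _ J _).trans (add_le_add (hcmp.trans (add_le_add ?_ ?_)) hJmain)
  · exact mul_le_mul_of_nonneg_left hdiff' (by positivity)
  · exact mul_le_mul_of_nonneg_left hJub hδ.le

lemma eventually_mul_log_pow_le (c : ℝ) (k : ℕ) {s : ℝ} (hs : 0 < s) :
    ∀ᶠ l : ℝ in atTop, c * Real.log l ^ k ≤ l ^ s := by
  have h := (isLittleO_log_rpow_rpow_atTop (k : ℝ) hs).bound (c := 1 / (|c| + 1)) (by positivity)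
  filter_upwards [h, eventually_ge_atTop (1 : ℝ)] with l hl hl1
  have hlog : 0 ≤ Real.log l := Real.log_nonneg hl1
  rw [Real.rpow_natCast, Real.norm_of_nonneg (by positivity), Real.norm_of_nonneg (by positivity),
    div_mul_eq_mul_div, one_mul, le_div_iff₀ (by positivity)] at hl
  have h1 : c * Real.log l ^ k ≤ |c| * Real.log l ^ k := by
    have := le_abs_self c
    gcongr
  have h2 : 0 ≤ Real.log l ^ k := by positivity
  linarith

/-- The length of the truncated mollifier. -/
noncomputable def mollifierLength (l : ℝ) : ℕ := ⌊Real.exp (l / Real.log l ^ 10)⌋₊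

/-- Growth conditions satisfied by all sufficiently large `l`. -/
structure LargeLog (ε l : ℝ) : Prop where
  le_log_l : 5 ≤ Real.log l
  le_l : 80 ≤ l
  pow_le : 160 * Real.log l ^ 20 ≤ l
  pow_le_eps : 48 / ε * Real.log l ^ 11 ≤ l
  pow_le_rpow : 768 / ε * Real.log l ^ 11 ≤ l ^ (ε / 4)

lemma eventually_largeLog {ε : ℝ} (hε : 0 < ε) : ∀ᶠ l : ℝ in atTop, LargeLog ε l := by
  have h1 := eventually_mul_log_pow_le 160 20 one_pos
  have h2 := eventually_mul_log_pow_le (48 / ε) 11 one_pos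
  have h3 := eventually_mul_log_pow_le (768 / ε) 11 (by positivity : 0 < ε / 4)
  simp only [Real.rpow_one] at h1 h2
  filter_upwards [h1, h2, h3, eventually_ge_atTop (80 : ℝ),
    Real.tendsto_log_atTop.eventually_ge_atTop 5] with l h1 h2 h3 h4 h5
  exact ⟨h5, h4, h1, h2, h3⟩

namespace LargeLog

variable {ε l : ℝ}

lemma log_mollifierLength_le (h : LargeLog ε l) :
    Real.log (mollifierLength l) ≤ l / Real.log l ^ 10 := by
  have hl := h.le_l
  have hu := h.le_log_l
  have h0 : 0 ≤ l / Real.log l ^ 10 := by positivity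
  have h1 : (1 : ℝ) ≤ mollifierLength l := by
    exact_mod_cast Nat.le_floor (by simpa using Real.one_le_exp h0)
  calc Real.log (mollifierLength l) ≤ Real.log (Real.exp (l / Real.log l ^ 10)) :=
        Real.log_le_log (by linarith) (Nat.floor_le (Real.exp_nonneg _))
    _ = _ := Real.log_exp _

lemma le_log_mollifierLength (h : LargeLog ε l) :
    l / (2 * Real.log l ^ 10) ≤ Real.log (mollifierLength l) := by
  have hl := h.le_l
  have hu := h.le_log_l
  have h0 : 0 ≤ l / Real.log l ^ 10 := by positivity
  have h1 : (1 : ℝ) ≤ mollifierLength l := by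
    exact_mod_cast Nat.le_floor (by simpa using Real.one_le_exp h0)
  have h2 : Real.exp (l / Real.log l ^ 10) ≤ 2 * mollifierLength l := by
    have := (Nat.lt_floor_add_one (Real.exp (l / Real.log l ^ 10))).le
    rw [← mollifierLength] at this
    linarith
  have h3 := Real.log_le_log (Real.exp_pos _) h2
  rw [Real.log_exp, Real.log_mul (by norm_num) (by linarith)] at h3
  have h4 : Real.log 2 ≤ 1 := by linarith [Real.log_two_lt_d9]
  have h5 : 2 ≤ l / Real.log l ^ 10 := by
    rw [le_div_iff₀ (by positivity)]
    have h6 : Real.log l ^ 10 ≤ Real.log l ^ 20 := pow_le_pow_right₀ (by linarith) (by norm_num)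
    have h7 : 0 ≤ Real.log l ^ 20 := by positivity
    linarith [h.pow_le]
  have h6 : l / (2 * Real.log l ^ 10) = (l / Real.log l ^ 10) / 2 := by
    field_simp
  linarith

lemma mul_log_le_log_mollifierLength (h : LargeLog ε l) {c : ℝ} (hc : 2 * c * Real.log l ^ 11 ≤ l) :
    c * Real.log l ≤ Real.log (mollifierLength l) := by
  refine le_trans ?_ h.le_log_mollifierLength
  have hu := h.le_log_l
  rw [le_div_iff₀ (by positivity)]
  linarith [pow_succ (Real.log l) 10]

lemma five_mul_log_le (h : LargeLog ε l) : 5 * Real.log l ≤ Real.log (mollifierLength l) := by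
  refine h.mul_log_le_log_mollifierLength ?_
  have h1 : Real.log l ^ 11 ≤ Real.log l ^ 20 := pow_le_pow_right₀ (by linarith [h.le_log_l]) (by norm_num)
  have h2 : 0 ≤ Real.log l ^ 20 := by positivity
  linarith [h.pow_le]

lemma admissible {T : ℝ} (h : LargeLog ε (Real.log T)) (hT : 100 ≤ T) :
    Admissible T (mollifierLength (Real.log T)) := by
  set l := Real.log T with hl
  have hu := h.le_log_l
  have hl80 := h.le_l
  set Y := mollifierLength l with hY
  have h1 := h.log_mollifierLength_le
  have h2 := h.le_log_mollifierLength
  have h3 := h.five_mul_log_le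
  rw [← hY] at h1 h2 h3
  have hY0 : 0 < Y := by
    rcases Nat.eq_zero_or_pos Y with h0 | h0
    · rw [h0] at h3; simp at h3; linarith
    · exact h0
  have hY0' : (0 : ℝ) < Y := by exact_mod_cast hY0
  have hYexp : (Y : ℝ) = Real.exp (Real.log Y) := (Real.exp_log hY0').symm
  refine ⟨hT, ?_, ?_, ?_, ?_⟩
  · by_contra hlt
    have : Y = 1 := by omega
    rw [this] at h3; simp at h3; linarith
  · have h4 : 40 * Real.log Y ≤ l := by
      have : l / Real.log l ^ 10 ≤ l / 40 := by
        have : (40 : ℝ) ≤ Real.log l ^ 10 := by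
          calc (40 : ℝ) ≤ 5 ^ 10 := by norm_num
            _ ≤ _ := by gcongr
        gcongr
      linarith
    have h5 : Real.log ((Y : ℝ) ^ 40) ≤ Real.log T := by
      rw [Real.log_pow]; exact_mod_cast h4
    exact (Real.log_le_log_iff (by positivity) (by linarith)).mp h5
  · have h4 : (l / (2 * Real.log l ^ 10)) ^ 2 ≤ Real.log Y ^ 2 := by gcongr
    refine le_trans ?_ h4
    rw [div_pow, le_div_iff₀ (by positivity)]
    have := h.pow_le
    have e : (2 * Real.log l ^ 10) ^ 2 = 4 * Real.log l ^ 20 := by ring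
    rw [e]
    nlinarith
  · rw [hYexp, ← Real.exp_log (by positivity : 0 < l ^ 2)]
    refine Real.exp_le_exp.mpr ?_
    rw [Real.log_pow]
    push_cast
    linarith

lemma log_le_of_le_rpow (h : LargeLog ε l) (hε : 0 < ε) {X : ℝ} (hX : 1 < X) (hXl : X ≤ l ^ (2 - ε)) :
    Real.log X ≤ 2 * Real.log l := by
  have hl := h.le_l
  have hu := h.le_log_l
  have h1 := Real.log_le_log (by linarith) hXl
  rw [Real.log_rpow (by linarith)] at h1
  nlinarith

lemma prod_inv_one_sub_rpow_le_rpow (h : LargeLog ε l) (hε : 0 < ε) (hε1 : ε ≤ 1) {X : ℝ} (hX : 1 < X)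
    (hXl : X ≤ l ^ (2 - ε)) :
    ∏ p ∈ primesLe ⌊X⌋₊, (1 - (p : ℝ) ^ (-(1 / 2 - ε / 8)))⁻¹ ≤ (mollifierLength l : ℝ) ^ (ε / 16) := by
  have hl := h.le_l
  have hu := h.le_log_l
  have h5 := h.five_mul_log_le
  have hlow := h.le_log_mollifierLength
  set Y := mollifierLength l with hY
  have hY0 : (0 : ℝ) < Y := by
    rcases Nat.eq_zero_or_pos Y with h0 | h0
    · rw [h0] at h5; simp at h5; linarith
    · exact_mod_cast h0
  refine (prod_inv_one_sub_rpow_le hX.le (by linarith) (by linarith)).trans ?_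
  rw [Real.rpow_def_of_pos hY0]
  refine Real.exp_le_exp.mpr ?_
  have h1 : X ^ (1 - (1 / 2 - ε / 8)) ≤ l ^ (1 - ε / 4) := by
    calc X ^ (1 - (1 / 2 - ε / 8)) ≤ (l ^ (2 - ε)) ^ (1 - (1 / 2 - ε / 8)) :=
          Real.rpow_le_rpow (by linarith) hXl (by linarith)
      _ = l ^ ((2 - ε) * (1 - (1 / 2 - ε / 8))) := by rw [← Real.rpow_mul (by linarith)]
      _ ≤ l ^ (1 - ε / 4) := Real.rpow_le_rpow_of_exponent_le (by linarith) (by nlinarith)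
  have h2 : 1 + Real.log X ≤ 3 * Real.log l := by
    linarith [h.log_le_of_le_rpow hε hX hXl]
  have h3 : 0 ≤ 1 + Real.log X := by linarith [Real.log_nonneg hX.le]
  have h4 : l ^ (1 - ε / 4) = l / l ^ (ε / 4) := by
    rw [Real.rpow_sub (by linarith), Real.rpow_one]
  have h6 : 0 < l ^ (ε / 4) := by positivity
  have h7 := h.pow_le_rpow
  calc 8 * (X ^ (1 - (1 / 2 - ε / 8)) * (1 + Real.log X)) ≤ 8 * (l ^ (1 - ε / 4) * (3 * Real.log l)) := by
        gcongr
    _ = 24 * Real.log l * l / l ^ (ε / 4) := by rw [h4]; ring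
    _ ≤ l / (2 * Real.log l ^ 10) * (ε / 16) := by
        rw [div_le_iff₀ h6, div_mul_eq_mul_div, div_mul_eq_mul_div, le_div_iff₀ (by positivity)]
        have e : 768 / ε * Real.log l ^ 11 * (ε / 16 * l) = 24 * Real.log l * l * (2 * Real.log l ^ 10) := by
          field_simp; ring
        rw [← e]
        calc 768 / ε * Real.log l ^ 11 * (ε / 16 * l) ≤ l ^ (ε / 4) * (ε / 16 * l) := by gcongr
          _ = l * (ε / 16) * l ^ (ε / 4) := by ring
    _ ≤ Real.log Y * (ε / 16) := by gcongr

end LargeLog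

set_option maxHeartbeats 1000000 in
/-- The mollified second moment with an error saving two powers of `log log T`. -/
theorem exists_abs_integral_mollified_sub_le {q : ℕ} [NeZero q] {χ : DirichletCharacter ℂ q}
    (hχ : χ.IsPrimitive) {ε : ℝ} (hε : 0 < ε) (hε1 : ε ≤ 1) : ∃ C : ℝ, 0 ≤ C ∧
      ∀ T : ℝ, 100 ≤ T → LargeLog ε (Real.log T) → ∀ X : ℝ, (q : ℝ) ^ 2 < X → X ≤ Real.log T ^ (2 - ε) →
      |(∫ t in T..(2 * T), ‖DirichletCharacter.LFunction χ (1 / 2 + t * I) *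
          QX X χ (1 / 2 + t * I)‖ ^ 2) - T * (mollifierProd X * Real.log T)| ≤
        C * T * Real.log T / Real.log (Real.log T) ^ 2 := by
  obtain ⟨C, hC0, hC⟩ := exists_abs_integral_norm_sq_sub_le hχ
  obtain ⟨C₁, hC₁1, hC₁⟩ := exists_prod_inv_le
  refine ⟨2 * C * (108 * C₁ ^ 3 + 2) + 24 * C₁ + 19, by positivity, fun T hT h X hXq hXl => ?_⟩
  have hadm := h.admissible hT
  have hq1 : (1 : ℝ) ≤ q := by exact_mod_cast NeZero.one_le
  have hX1 : 1 < X := lt_of_le_of_lt (one_le_pow₀ hq1) hXq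
  have hZb := h.prod_inv_one_sub_rpow_le_rpow hε hε1 hX1 hXl
  have hlX := h.log_le_of_le_rpow hε hX1 hXl
  have hVb := hC₁ X hX1
  have hmul := h.mul_log_le_log_mollifierLength (c := 24 / ε) (by
    have := h.pow_le_eps
    calc 2 * (24 / ε) * Real.log (Real.log T) ^ 11 = 48 / ε * Real.log (Real.log T) ^ 11 := by ring
      _ ≤ _ := this)
  have hyub := h.log_mollifierLength_le
  have hu5 := h.le_log_l
  have hl80 := h.le_l
  have hpow := h.pow_le
  set Y := mollifierLength (Real.log T) with hY
  have hmain := hC T Y hadm X (ε / 8) (1 / Real.log (Real.log T) ^ 2) _ _ _ hXq (by positivity)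
    (by linarith) (by positivity) (by
      rw [div_le_one (by positivity)]; exact one_le_pow₀ (by linarith)) rfl rfl rfl
  have hY1 := hadm.one_le_Y
  have hw := hadm.one_le_one_add_log
  have hylT := hadm.logY_le
  have hy2 := hadm.two_le_logY
  set V := ∏ p ∈ primesLe ⌊X⌋₊, (1 - 1 / (p : ℝ))⁻¹ with hV
  set Z := ∏ p ∈ primesLe ⌊X⌋₊, (1 - (p : ℝ) ^ (-(1 / 2 - ε / 8)))⁻¹ with hZ
  have hV0 : 0 ≤ V := by
    refine Finset.prod_nonneg fun p hp => inv_nonneg.mpr ?_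
    have hp1 : (1 : ℝ) ≤ p := by exact_mod_cast (mem_primesLe.mp hp).1.one_le
    linarith [div_le_one_of_le₀ hp1 (by linarith : (0 : ℝ) ≤ p)]
  have hZ0 : 0 ≤ Z := by
    refine Finset.prod_nonneg fun p hp => inv_nonneg.mpr ?_
    have hp1 : (1 : ℝ) ≤ p := by exact_mod_cast (mem_primesLe.mp hp).1.one_le
    linarith [Real.rpow_le_one_of_one_le_of_nonpos hp1 (by linarith : -(1 / 2 - ε / 8) ≤ 0)]
  set l := Real.log T with hl
  set u := Real.log l with hu
  set y := Real.log Y with hy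
  set w := 1 + Real.log (1 + 7 * y) with hwdef
  have hlX0 : 0 < Real.log X := Real.log_pos hX1
  have hVu : V ≤ 3 * C₁ * u := by
    refine hVb.trans ?_
    have : 1 + Real.log X ≤ 3 * u := by linarith
    nlinarith
  have hwu : w ≤ 2 * u := by
    have h1 : Real.log (1 + 7 * y) ≤ u := Real.log_le_log (by linarith) (by linarith)
    linarith
  have hZY : Z ^ 2 / (Y : ℝ) ^ 2 ≤ 1 := by
    refine div_le_one_of_le₀ (pow_le_pow_left₀ hZ0 (hZb.trans ?_) 2) (by positivity)
    calc (Y : ℝ) ^ (ε / 16) ≤ (Y : ℝ) ^ (1 : ℝ) := Real.rpow_le_rpow_of_exponent_le hY1 (by linarith)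
      _ = Y := Real.rpow_one _
  have hYpos : (0 : ℝ) < Y := by linarith
  have hτ : (Y : ℝ) ^ (-(ε / 8)) * Z ≤ (Y : ℝ) ^ (-(ε / 16)) := by
    calc (Y : ℝ) ^ (-(ε / 8)) * Z ≤ (Y : ℝ) ^ (-(ε / 8)) * (Y : ℝ) ^ (ε / 16) := by gcongr
      _ = (Y : ℝ) ^ (-(ε / 16)) := by rw [← Real.rpow_add hYpos]; congr 1; ring
  have hτ1 : (Y : ℝ) ^ (-(ε / 8)) * Z ≤ 1 :=
    hτ.trans (Real.rpow_le_one_of_one_le_of_nonpos hY1 (by linarith))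
  have hτ2 : ((Y : ℝ) ^ (-(ε / 8)) * Z) ^ 2 * l ^ 3 ≤ 1 := by
    have h1 : ((Y : ℝ) ^ (-(ε / 8)) * Z) ^ 2 ≤ ((Y : ℝ) ^ (-(ε / 16))) ^ 2 :=
      pow_le_pow_left₀ (by positivity) hτ 2
    have h2 : ((Y : ℝ) ^ (-(ε / 16))) ^ 2 = Real.exp (-(ε / 8 * y)) := by
      rw [← Real.rpow_natCast, ← Real.rpow_mul hYpos.le, Real.rpow_def_of_pos hYpos]
      congr 1; push_cast; ring
    have h3 : l ^ 3 = Real.exp (3 * u) := by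
      rw [mul_comm, Real.exp_mul, Real.exp_log (by linarith)]; norm_cast
    have h4 : 3 * u ≤ ε / 8 * y := by
      have : ε / 8 * (24 / ε * u) ≤ ε / 8 * y := by gcongr
      have e : ε / 8 * (24 / ε * u) = 3 * u := by field_simp; norm_num
      linarith
    calc _ ≤ Real.exp (-(ε / 8 * y)) * Real.exp (3 * u) := by rw [← h2, ← h3]; gcongr
      _ = Real.exp (3 * u - ε / 8 * y) := by rw [← Real.exp_add]; congr 1; ring
      _ ≤ 1 := Real.exp_le_one_iff.mpr (by linarith)
  have hu1 : 1 ≤ u := by linarith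
  have hpows : ∀ k : ℕ, k ≤ 20 → u ^ k ≤ l := by
    intro k hk
    have h1 : u ^ k ≤ u ^ 20 := pow_le_pow_right₀ hu1 hk
    have h2 : 0 ≤ u ^ 20 := by positivity
    linarith
  have hyl : ∀ k : ℕ, k ≤ 10 → u ^ k * y ≤ l / u ^ (10 - k) := by
    intro k hk
    have e : l / u ^ (10 - k) = u ^ k * (l / u ^ 10) := by
      rw [← Nat.sub_add_cancel hk, pow_add, Nat.add_sub_cancel]
      field_simp
    rw [e]
    gcongr
  have hl2 : ∀ k : ℕ, 2 ≤ k → l / u ^ k ≤ l / u ^ 2 := fun k hk =>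
    div_le_div_of_nonneg_left (by linarith) (by positivity) (pow_le_pow_right₀ hu1 hk)
  set m := l / u ^ 2 with hm
  have hm0 : 0 < m := by positivity
  have hone : 1 ≤ m := by
    rw [hm, le_div_iff₀ (by positivity), one_mul]; exact hpows 2 (by norm_num)
  have hu2m : u ^ 2 ≤ m := by
    rw [hm, le_div_iff₀ (by positivity), ← pow_add]; exact hpows 4 (by norm_num)
  have hyV : (1 + y) * V ≤ 6 * C₁ * m := by
    have h1 : u ^ 1 * y ≤ m := (hyl 1 (by norm_num)).trans (hl2 9 (by norm_num))
    calc (1 + y) * V ≤ (2 * y) * (3 * C₁ * u) := mul_le_mul (by linarith) hVu hV0 (by linarith)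
      _ = 6 * C₁ * (u ^ 1 * y) := by ring
      _ ≤ 6 * C₁ * m := by gcongr
  set τ := (Y : ℝ) ^ (-(ε / 8)) * Z with hτdef
  have hR : (1 + y) * V + 2 * τ ≤ (6 * C₁ + 2) * m := by linarith
  have hml : m ≤ l := div_le_self (by linarith) (one_le_pow₀ hu1)
  have hinner : w ^ 2 * y * V ^ 3 ≤ 108 * C₁ ^ 3 * (u ^ 5 * y) := by
    calc w ^ 2 * y * V ^ 3 ≤ (2 * u) ^ 2 * y * (3 * C₁ * u) ^ 3 := by gcongr
      _ = 108 * C₁ ^ 3 * (u ^ 5 * y) := by ring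
  have hT0 : 0 < T := by linarith
  have hfirst : 2 / (1 / u ^ 2) * (C * T * (w ^ 2 * y * V ^ 3 + Z ^ 2 / (Y : ℝ) ^ 2 + τ ^ 2 * l ^ 3))
      ≤ 2 * C * (108 * C₁ ^ 3 + 2) * (T * m) := by
    have e : 2 / (1 / u ^ 2) = 2 * u ^ 2 := by field_simp
    rw [e]
    have h1 : u ^ 7 * y ≤ m := (hyl 7 (by norm_num)).trans (hl2 3 (by norm_num))
    have h2 : u ^ 2 * (w ^ 2 * y * V ^ 3 + Z ^ 2 / (Y : ℝ) ^ 2 + τ ^ 2 * l ^ 3) ≤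
        (108 * C₁ ^ 3 + 2) * m := by
      calc u ^ 2 * (w ^ 2 * y * V ^ 3 + Z ^ 2 / (Y : ℝ) ^ 2 + τ ^ 2 * l ^ 3)
          ≤ u ^ 2 * (108 * C₁ ^ 3 * (u ^ 5 * y) + 1 + 1) := by gcongr
        _ = 108 * C₁ ^ 3 * (u ^ 7 * y) + 2 * u ^ 2 := by ring
        _ ≤ 108 * C₁ ^ 3 * m + 2 * m := by gcongr
        _ = _ := by ring
    calc _ = 2 * C * T * (u ^ 2 * (w ^ 2 * y * V ^ 3 + Z ^ 2 / (Y : ℝ) ^ 2 + τ ^ 2 * l ^ 3)) := by ring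
      _ ≤ 2 * C * T * ((108 * C₁ ^ 3 + 2) * m) := by gcongr
      _ = _ := by ring
  have hsecond : 1 / u ^ 2 * (2 * T * (l + ((1 + y) * V + 2 * τ))) ≤ (12 * C₁ + 6) * (T * m) := by
    have h1 : l + ((1 + y) * V + 2 * τ) ≤ (6 * C₁ + 3) * l := by
      have : (6 * C₁ + 2) * m ≤ (6 * C₁ + 2) * l := by gcongr
      linarith
    calc _ ≤ 1 / u ^ 2 * (2 * T * ((6 * C₁ + 3) * l)) := by gcongr
      _ = (12 * C₁ + 6) * (T * m) := by rw [hm]; ring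
  have hthird : T * (2 * ((1 + y) * V + 2 * τ) + 9 * y) ≤ (12 * C₁ + 13) * (T * m) := by
    have h1 : y ≤ m := by
      have := (hyl 0 (by norm_num)).trans (hl2 10 (by norm_num))
      simpa using this
    calc _ ≤ T * (2 * ((6 * C₁ + 2) * m) + 9 * m) := by gcongr
      _ = _ := by ring
  have e : (2 * C * (108 * C₁ ^ 3 + 2) + 24 * C₁ + 19) * T * l / u ^ 2
      = 2 * C * (108 * C₁ ^ 3 + 2) * (T * m) + (12 * C₁ + 6) * (T * m) + (12 * C₁ + 13) * (T * m) := by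
    rw [hm]; ring
  rw [e]
  exact hmain.trans (add_le_add (add_le_add hfirst hsecond) hthird)

end LQ

/-- For a primitive character `χ` modulo `q` and `q² < X ≤ (log T)^{2−ε}`,
`(1/T) ∫_T^{2T} |L(1/2+it,χ) Q_X(1/2+it,χ)|² dt = (log(qT))/(e^γ log X) (1 + O_{q,ε}(1/log X))`. -/
theorem mean_square_L_times_QX (q : ℕ) [NeZero q] (χ : DirichletCharacter ℂ q)
    (hχ : χ.IsPrimitive) (ε : ℝ) (hε : 0 < ε) :
    ∃ C T₀ : ℝ, ∀ T : ℝ, T₀ ≤ T → ∀ X : ℝ, (q : ℝ) ^ 2 < X → X ≤ Real.log T ^ (2 - ε) →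
      ∃ E : ℝ, |E| ≤ C / Real.log X ∧
        (1 / T) * (∫ t in T..(2*T),
            ‖DirichletCharacter.LFunction χ (1/2 + t * Complex.I) *
              QX X χ (1/2 + t * Complex.I)‖ ^ 2)
          = Real.log ((q : ℝ) * T) / (Real.exp Real.eulerMascheroniConstant * Real.log X)
              * (1 + E) := by
  obtain ⟨C, hC0, hC⟩ := LQ.exists_abs_integral_mollified_sub_le hχ (ε := min ε 1) (by positivity)
    (min_le_right _ _)
  obtain ⟨C₂, hC₂0, hC₂⟩ := LQ.exists_mollifierProd_bound
  obtain ⟨T₀, hT₀⟩ := Filter.eventually_atTop.mp ((Real.tendsto_log_atTop.eventually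
    (LQ.eventually_largeLog (ε := min ε 1) (by positivity))).and (eventually_ge_atTop (100 : ℝ)))
  refine ⟨4 * C * Real.exp Real.eulerMascheroniConstant + C₂ + Real.log q, T₀, fun T hT X hXq hXl => ?_⟩
  obtain ⟨hlarge, hT100⟩ := hT₀ T hT
  have hq1 : (1 : ℝ) ≤ q := by exact_mod_cast NeZero.one_le
  have hX1 : 1 < X := lt_of_le_of_lt (one_le_pow₀ hq1) hXq
  have hl80 := hlarge.le_l
  have hu5 := hlarge.le_log_l
  have hXl' : X ≤ Real.log T ^ (2 - min ε 1) :=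
    hXl.trans (Real.rpow_le_rpow_of_exponent_le (by linarith) (by linarith [min_le_left ε 1]))
  have hlX := hlarge.log_le_of_le_rpow (by positivity) hX1 hXl'
  have hmain := hC T hT100 hlarge X hXq hXl'
  have hprod := hC₂ X hX1
  rw [← LQ.mollifierProd] at hprod
  have hul : 2 * Real.log (Real.log T) ≤ Real.log T := by
    have h1 := hlarge.pow_le
    have h2 := le_self_pow₀ (by linarith : 1 ≤ Real.log (Real.log T)) (by norm_num : 20 ≠ 0)
    linarith
  have hLq : Real.log ((q : ℝ) * T) = Real.log q + Real.log T :=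
    Real.log_mul (by linarith) (by linarith)
  have hlq0 : 0 ≤ Real.log q := Real.log_nonneg hq1
  have hx0 : 0 < Real.log X := Real.log_pos hX1
  have hT0 : 0 < T := by linarith
  rw [hLq]
  set J := ∫ t in T..(2 * T), ‖DirichletCharacter.LFunction χ (1/2 + t * Complex.I) *
      QX X χ (1/2 + t * Complex.I)‖ ^ 2 with hJ
  set l := Real.log T with hl
  set u := Real.log l with hu
  set x := Real.log X with hx
  set g := Real.exp Real.eulerMascheroniConstant with hg
  set W := LQ.mollifierProd X with hW
  have hg0 : 0 < g := Real.exp_pos _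
  have hL0 : 0 < Real.log q + l := by linarith
  set E₁ := g * x / (Real.log q + l) * (J / T - W * l) with hE₁
  set E₂ := (W * (g * x) - 1) * (l / (Real.log q + l)) with hE₂
  set E₃ := -(Real.log q / (Real.log q + l)) with hE₃
  have h1 : |E₁| ≤ 4 * C * g / x := by
    have h2 : J / T - W * l = (J - T * (W * l)) / T := by field_simp
    have h3 : |J / T - W * l| ≤ C * l / u ^ 2 := by
      rw [h2, abs_div, abs_of_pos hT0, div_le_iff₀ hT0]
      exact hmain.trans_eq (by ring)
    have h4 : C * l / u ^ 2 ≤ 4 * (C * l) / x ^ 2 := by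
      rw [div_le_div_iff₀ (by positivity) (by positivity)]
      have h5 : x ^ 2 ≤ (2 * u) ^ 2 := by gcongr
      calc C * l * x ^ 2 ≤ C * l * (2 * u) ^ 2 := by gcongr
        _ = 4 * (C * l) * u ^ 2 := by ring
    rw [hE₁, abs_mul, abs_of_pos (by positivity : 0 < g * x / (Real.log q + l))]
    calc _ ≤ g * x / l * (4 * (C * l) / x ^ 2) := by
          refine mul_le_mul ?_ (h3.trans h4) (abs_nonneg _) (by positivity)
          exact div_le_div_of_nonneg_left (by positivity) (by linarith) (by linarith)
      _ = 4 * C * g / x := by field_simp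
  have h2 : |E₂| ≤ C₂ / x := by
    rw [hE₂, abs_mul, abs_of_nonneg (by positivity : 0 ≤ l / (Real.log q + l))]
    calc _ ≤ C₂ / x * 1 := mul_le_mul hprod (div_le_one_of_le₀ (by linarith) hL0.le)
          (by positivity) (by positivity)
      _ = C₂ / x := mul_one _
  have h3 : |E₃| ≤ Real.log q / x := by
    rw [hE₃, abs_neg, abs_of_nonneg (by positivity)]
    exact div_le_div_of_nonneg_left hlq0 hx0 (by linarith)
  refine ⟨E₁ + E₂ + E₃, ?_, ?_⟩
  · refine (abs_add_three _ _ _).trans ?_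
    rw [add_div, add_div]
    linarith
  · rw [hE₁, hE₂, hE₃]
    field_simp
    ring
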